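/- Reduction to complex modified KdV. Let a, b, d, e ∈ ℝ with b ≠ 0, and suppose c = (d−e)·a/(3b). Let u : ℝ × ℝ → ℂ be of class C³ in x and C¹ in t, and define v(x,t) = exp( i (a/(3b)) x + i (a³/(27b²)) t ) · u( x + (a²/(3b)) t , t ). Then u satisfies ∂_t u + i a ∂_x² u + b ∂_x³ u + i c |u|² u + d |u|² ∂_x u + e u² ∂_x ū = 0 on ℝ² if and only if v satisfies the complex modified Korteweg–de Vries type equation ∂_t v + b ∂_x³ v + d |v|² ∂_x v + e v² ∂_x v̄ = 0 on ℝ². -/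

import Mathlib

open Complex

/-- The higher order nonlinear Schrödinger (Airy–Schrödinger) equation
`∂ₜu + i a ∂ₓ²u + b ∂ₓ³u + i c |u|²u + d |u|²∂ₓu + e u²∂ₓū = 0`,
for `u : ℝ → ℝ → ℂ`, written as `u x t` (space first, time second). -/
def AirySchrodingerEq (a b c d e : ℝ) (u : ℝ → ℝ → ℂ) : Prop :=
  ∀ x t : ℝ,
    deriv (fun τ => u x τ) t
      + Complex.I * (a : ℂ) * iteratedDeriv 2 (fun y => u y t) x
      + (b : ℂ) * iteratedDeriv 3 (fun y => u y t) x
      + Complex.I * (c : ℂ) * (‖u x t‖ : ℂ) ^ 2 * u x t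
      + (d : ℂ) * (‖u x t‖ : ℂ) ^ 2 * deriv (fun y => u y t) x
      + (e : ℂ) * (u x t) ^ 2 * deriv (fun y => (starRingEnd ℂ) (u y t)) x = 0

section Regularity

open Filter Topology MeasureTheory Set

/-- `f` is three times continuously differentiable with successive derivatives `f1, f2, f3`. -/
structure Jet (f f1 f2 f3 : ℝ → ℂ) : Prop where
  d0 : ∀ x, HasDerivAt f (f1 x) x
  d1 : ∀ x, HasDerivAt f1 (f2 x) x
  d2 : ∀ x, HasDerivAt f2 (f3 x) x
  c3 : Continuous f3

/-- The average of `f` over the segment from `x` to `x + h`. -/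
noncomputable def avg (h : ℝ) (f : ℝ → ℂ) (x : ℝ) : ℂ := ∫ r in (0 : ℝ)..1, f (x + h * r)

/-- The difference quotient of `f` with step `h`. -/
noncomputable def dq (h : ℝ) (f : ℝ → ℂ) (x : ℝ) : ℂ := (f (x + h) - f x) / h

/-- The squared `L²` norm on `[a, b]`. -/
noncomputable def nsq (a b : ℝ) (f : ℝ → ℂ) : ℝ := ∫ x in a..b, ‖f x‖ ^ 2

section Averages

theorem Jet.cont0 {f f1 f2 f3 : ℝ → ℂ} (j : Jet f f1 f2 f3) : Continuous f :=
  continuous_iff_continuousAt.2 fun x => (j.d0 x).continuousAt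
theorem Jet.cont1 {f f1 f2 f3 : ℝ → ℂ} (j : Jet f f1 f2 f3) : Continuous f1 :=
  continuous_iff_continuousAt.2 fun x => (j.d1 x).continuousAt
theorem Jet.cont2 {f f1 f2 f3 : ℝ → ℂ} (j : Jet f f1 f2 f3) : Continuous f2 :=
  continuous_iff_continuousAt.2 fun x => (j.d2 x).continuousAt

theorem continuous_avg (h : ℝ) {f : ℝ → ℂ} (hf : Continuous f) : Continuous (avg h f) := by
  unfold avg
  apply intervalIntegral.continuous_parametric_intervalIntegral_of_continuous' (a₀ := 0)
  fun_prop

theorem avg_zero (f : ℝ → ℂ) (x : ℝ) : avg 0 f x = f x := by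
  simp [avg]

theorem continuous_dq (h : ℝ) {f : ℝ → ℂ} (hf : Continuous f) : Continuous (dq h f) := by
  unfold dq; fun_prop

theorem mul_avg_eq_integral {h : ℝ} {f : ℝ → ℂ} (x : ℝ) :
    h * avg h f x = ∫ y in x..(x + h), f y := by
  have := intervalIntegral.smul_integral_comp_add_mul (a := 0) (b := 1) f h x
  simp only [mul_zero, add_zero, mul_one] at this
  rw [← this, avg, Complex.real_smul]

theorem avg_eq_dq {h : ℝ} (hh : h ≠ 0) {f f1 : ℝ → ℂ} (hd : ∀ x, HasDerivAt f (f1 x) x)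
    (hc : Continuous f1) : avg h f1 = dq h f := by
  funext x
  have h1 := mul_avg_eq_integral (h := h) (f := f1) x
  rw [intervalIntegral.integral_eq_sub_of_hasDerivAt (fun y _ => hd y)
    (hc.intervalIntegrable _ _)] at h1
  have : (h : ℂ) ≠ 0 := by exact_mod_cast hh
  rw [dq, ← h1]; field_simp

theorem hasDerivAt_avg {h : ℝ} (hh : h ≠ 0) {f : ℝ → ℂ} (hf : Continuous f) (x : ℝ) :
    HasDerivAt (avg h f) (dq h f x) x := by
  have hC : (h : ℂ) ≠ 0 := by exact_mod_cast hh
  have e : avg h f = fun x => ((∫ y in (0:ℝ)..(x + h), f y) - ∫ y in (0:ℝ)..x, f y) / h := by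
    funext x
    rw [intervalIntegral.integral_interval_sub_left (hf.intervalIntegrable _ _)
      (hf.intervalIntegrable _ _), ← mul_avg_eq_integral]
    field_simp
  rw [e]
  have F : ∀ z, HasDerivAt (fun x => ∫ y in (0:ℝ)..x, f y) (f z) z := fun z =>
    intervalIntegral.integral_hasDerivAt_right (hf.intervalIntegrable _ _)
      (hf.stronglyMeasurableAtFilter _ _) hf.continuousAt
  have := ((F (x + h)).comp_add_const x h).sub (F x)
  exact this.div_const _

theorem Jet.avg {f f1 f2 f3 : ℝ → ℂ} (j : Jet f f1 f2 f3) {h : ℝ} (hh : h ≠ 0) :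
    Jet (avg h f) (avg h f1) (avg h f2) (avg h f3) where
  d0 x := by rw [avg_eq_dq hh j.d0 j.cont1]; exact hasDerivAt_avg hh j.cont0 x
  d1 x := by rw [avg_eq_dq hh j.d1 j.cont2]; exact hasDerivAt_avg hh j.cont1 x
  d2 x := by rw [avg_eq_dq hh j.d2 j.c3]; exact hasDerivAt_avg hh j.cont2 x
  c3 := continuous_avg h j.c3

theorem HasDerivAt.dq_fun {h : ℝ} {f f1 : ℝ → ℂ} (hd : ∀ x, HasDerivAt f (f1 x) x) (x : ℝ) :
    HasDerivAt (dq h f) (dq h f1 x) x := by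
  have := ((hd (x + h)).comp_add_const x h).sub (hd x)
  exact this.div_const _

theorem Jet.dq {f f1 f2 f3 : ℝ → ℂ} (j : Jet f f1 f2 f3) (h : ℝ) :
    Jet (dq h f) (dq h f1) (dq h f2) (dq h f3) :=
  ⟨HasDerivAt.dq_fun j.d0, HasDerivAt.dq_fun j.d1, HasDerivAt.dq_fun j.d2,
    continuous_dq h j.c3⟩

theorem Jet.sub {f f1 f2 f3 g g1 g2 g3 : ℝ → ℂ} (j : Jet f f1 f2 f3) (k : Jet g g1 g2 g3) :
    Jet (fun x => f x - g x) (fun x => f1 x - g1 x) (fun x => f2 x - g2 x)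
      (fun x => f3 x - g3 x) :=
  ⟨fun x => (j.d0 x).sub (k.d0 x), fun x => (j.d1 x).sub (k.d1 x),
    fun x => (j.d2 x).sub (k.d2 x), j.c3.sub k.c3⟩

theorem avg_sub_const {h : ℝ} {f : ℝ → ℂ} (hf : Continuous f) (x : ℝ) (c : ℂ) :
    avg h f x - c = avg h (fun y => f y - c) x := by
  unfold avg
  rw [intervalIntegral.integral_sub]
  · simp
  · exact Continuous.intervalIntegrable (by fun_prop) _ _
  · simp

theorem norm_avg_le {h : ℝ} {f : ℝ → ℂ} {x M : ℝ}
    (hM : ∀ r ∈ Icc (0 : ℝ) 1, ‖f (x + h * r)‖ ≤ M) : ‖avg h f x‖ ≤ M := by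
  have := intervalIntegral.norm_integral_le_of_norm_le_const (a := 0) (b := 1)
    (f := fun r => f (x + h * r)) (C := M) (fun r hr => by
      rw [uIoc_of_le zero_le_one] at hr
      exact hM r ⟨hr.1.le, hr.2⟩)
  simpa [_root_.avg] using this

theorem norm_sub_le_of_deriv_bound {a b M x y : ℝ} {f f1 : ℝ → ℂ}
    (hd : ∀ x, HasDerivAt f (f1 x) x) (hM : ∀ y ∈ Icc a b, ‖f1 y‖ ≤ M)
    (hx : x ∈ Icc a b) (hy : y ∈ Icc a b) : ‖f y - f x‖ ≤ M * |y - x| := by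
  have := Convex.norm_image_sub_le_of_norm_hasDerivWithin_le (s := Icc a b) (f := f) (f' := f1)
    (C := M) (fun z _ => (hd z).hasDerivWithinAt) hM (convex_Icc a b) hx hy
  simpa using this

theorem norm_dq_le {h A x : ℝ} {f : ℝ → ℂ} (h1 : ‖f (x + h)‖ ≤ A) (h2 : ‖f x‖ ≤ A) :
    ‖dq h f x‖ ≤ 2 * A / |h| := by
  unfold dq
  rw [norm_div, Complex.norm_real, Real.norm_eq_abs]
  gcongr
  linarith [norm_sub_le (f (x + h)) (f x)]

theorem norm_deriv_le_of_bounds {a b A M l : ℝ} {f f1 f2 : ℝ → ℂ}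
    (hd : ∀ x, HasDerivAt f (f1 x) x) (hd1 : ∀ x, HasDerivAt f1 (f2 x) x)
    (hA : ∀ y ∈ Icc a b, ‖f y‖ ≤ A) (hM : ∀ y ∈ Icc a b, ‖f2 y‖ ≤ M) (hl : 0 < l)
    (hlab : 2 * l ≤ b - a) {x : ℝ} (hx : x ∈ Icc a b) :
    ‖f1 x‖ ≤ 2 * A / l + l * M := by
  have hc : Continuous f1 := continuous_iff_continuousAt.2 fun x => (hd1 x).continuousAt
  have hM0 : 0 ≤ M := (norm_nonneg _).trans (hM x hx)
  obtain ⟨h, hh, hxh⟩ : ∃ h : ℝ, |h| = l ∧ x + h ∈ Icc a b := by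
    by_cases hc : x + l ≤ b
    · exact ⟨l, abs_of_pos hl, by constructor <;> linarith [hx.1]⟩
    · exact ⟨-l, by rw [abs_neg, abs_of_pos hl], by
        push Not at hc; constructor <;> linarith [hx.2]⟩
  have hh0 : h ≠ 0 := by rintro rfl; simp at hh; linarith
  have h1 : ‖dq h f x‖ ≤ 2 * A / l := by rw [← hh]; exact norm_dq_le (hA _ hxh) (hA _ hx)
  have h2 : ‖avg h f1 x - f1 x‖ ≤ l * M := by
    rw [avg_sub_const hc]
    refine norm_avg_le fun r hr => ?_
    have hm := (convex_Icc a b) hx hxh (sub_nonneg.2 hr.2) hr.1 (by ring)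
    have e : (1 - r) • x + r • (x + h) = x + h * r := by simp only [smul_eq_mul]; ring
    rw [e] at hm
    refine (norm_sub_le_of_deriv_bound hd1 hM hx hm).trans ?_
    rw [mul_comm]
    gcongr
    rw [add_sub_cancel_left, abs_mul, hh]
    exact mul_le_of_le_one_right hl.le (abs_le.2 ⟨by linarith [hr.1], hr.2⟩)
  rw [avg_eq_dq hh0 hd hc] at h2
  calc ‖f1 x‖ = ‖dq h f x - (dq h f x - f1 x)‖ := by congr 1; ring
    _ ≤ _ := (norm_sub_le _ _).trans (add_le_add h1 h2)

theorem Jet.interpolation {a b A M l : ℝ} {f f1 f2 f3 : ℝ → ℂ} (j : Jet f f1 f2 f3)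
    (hA : ∀ y ∈ Icc a b, ‖f y‖ ≤ A) (hM : ∀ y ∈ Icc a b, ‖f3 y‖ ≤ M) (hl : 0 < l)
    (hlab : 4 * l ≤ b - a) {x : ℝ} (hx : x ∈ Icc a b) :
    ‖f2 x‖ ≤ 4 * A / l ^ 2 + 2 * l * M ∧ ‖f1 x‖ ≤ 6 * A / l + 2 * l ^ 2 * M := by
  have key : ∀ x ∈ Icc a b, ‖f2 x‖ ≤ 4 * A / l ^ 2 + 2 * l * M := by
    intro x hx
    have hM0 : 0 ≤ M := (norm_nonneg _).trans (hM x hx)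
    obtain ⟨h, hh, hxh, hxhh⟩ : ∃ h : ℝ, |h| = l ∧ x + h ∈ Icc a b ∧ x + h + h ∈ Icc a b := by
      by_cases hc : x + 2 * l ≤ b
      · exact ⟨l, abs_of_pos hl, by constructor <;> linarith [hx.1],
          by constructor <;> linarith [hx.1]⟩
      · push Not at hc
        exact ⟨-l, by rw [abs_neg, abs_of_pos hl], by constructor <;> linarith [hx.2],
          by constructor <;> linarith [hx.2]⟩
    have hh0 : h ≠ 0 := by rintro rfl; simp at hh; linarith
    have h1 : ‖_root_.dq h (_root_.dq h f) x‖ ≤ 4 * A / l ^ 2 := by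
      have e1 : ‖_root_.dq h f x‖ ≤ 2 * A / l := by
        rw [← hh]; exact norm_dq_le (hA _ hxh) (hA _ hx)
      have e2 : ‖_root_.dq h f (x + h)‖ ≤ 2 * A / l := by
        rw [← hh]; exact norm_dq_le (hA _ hxhh) (hA _ hxh)
      have := norm_dq_le e2 e1
      rw [hh] at this
      refine this.trans (le_of_eq ?_)
      field_simp; ring
    have h2 : ‖_root_.avg h (_root_.avg h f2) x - f2 x‖ ≤ 2 * l * M := by
      rw [avg_sub_const (continuous_avg h j.cont2)]
      refine norm_avg_le fun r hr => ?_
      rw [avg_sub_const j.cont2]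
      refine norm_avg_le fun r' hr' => ?_
      have hm := (convex_Icc a b) hx hxhh (a := 1 - (r + r') / 2) (b := (r + r') / 2)
        (by linarith [hr.2, hr'.2]) (by linarith [hr.1, hr'.1]) (by ring)
      have e : (1 - (r + r') / 2) • x + ((r + r') / 2) • (x + h + h) = x + h * r + h * r' := by
        simp only [smul_eq_mul]; ring
      rw [e] at hm
      refine (norm_sub_le_of_deriv_bound j.d2 hM hx hm).trans ?_
      rw [mul_comm]
      gcongr
      have : x + h * r + h * r' - x = h * (r + r') := by ring
      rw [this, abs_mul, hh, mul_comm (2 : ℝ)]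
      gcongr
      exact abs_le.2 ⟨by linarith [hr.1, hr'.1], by linarith [hr.2, hr'.2]⟩
    have e : _root_.avg h (_root_.avg h f2) = _root_.dq h (_root_.dq h f) := by
      rw [avg_eq_dq hh0 (j.avg hh0).d1 (j.avg hh0).cont2, avg_eq_dq hh0 j.d0 j.cont1]
    rw [e] at h2
    calc ‖f2 x‖ = ‖_root_.dq h (_root_.dq h f) x - (_root_.dq h (_root_.dq h f) x - f2 x)‖ := by
          congr 1; ring
      _ ≤ _ := (norm_sub_le _ _).trans (add_le_add h1 h2)
  refine ⟨key x hx, ?_⟩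
  refine (norm_deriv_le_of_bounds j.d0 j.d1 hA key hl (by linarith) hx).trans (le_of_eq ?_)
  field_simp; ring

/-- Third differences of `f` inside `[a, b]` are bounded by `M` times the cube of the step. -/
def ThirdDiffBound (a b M : ℝ) (f : ℝ → ℂ) : Prop :=
  ∀ x h : ℝ, 0 < h → x ∈ Icc a b → x + 3 * h ∈ Icc a b →
    ‖f (x + 3 * h) - 3 * f (x + 2 * h) + 3 * f (x + h) - f x‖ ≤ M * h ^ 3

theorem Jet.dq3 {f f1 f2 f3 : ℝ → ℂ} (j : Jet f f1 f2 f3) {h : ℝ} (hh : 0 < h) (x : ℝ) :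
    f (x + 3 * h) - 3 * f (x + 2 * h) + 3 * f (x + h) - f x =
      h ^ 3 * _root_.avg h (_root_.avg h (_root_.avg h f3)) x := by
  have hh0 := hh.ne'
  have e : _root_.avg h (_root_.avg h (_root_.avg h f3))
      = _root_.dq h (_root_.dq h (_root_.dq h f)) := by
    rw [avg_eq_dq hh0 ((j.avg hh0).avg hh0).d2 ((j.avg hh0).avg hh0).c3,
      avg_eq_dq hh0 (j.avg hh0).d1 (j.avg hh0).cont2, avg_eq_dq hh0 j.d0 j.cont1]
  rw [e]
  have hC : (h : ℂ) ≠ 0 := by exact_mod_cast hh0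
  simp only [_root_.dq]
  rw [show x + 3 * h = x + h + h + h by ring, show x + 2 * h = x + h + h by ring]
  field_simp; ring

theorem Jet.norm_avg3_le {a b M h x : ℝ} {f3 : ℝ → ℂ} (hh : 0 < h) (hx : x ∈ Icc a b)
    (hxh : x + 3 * h ∈ Icc a b) (hM : ∀ y ∈ Icc a b, ‖f3 y‖ ≤ M) :
    ‖_root_.avg h (_root_.avg h (_root_.avg h f3)) x‖ ≤ M := by
  refine norm_avg_le fun r hr => norm_avg_le fun s hs => norm_avg_le fun q hq => hM _ ?_
  have e1 := mul_nonneg hh.le hr.1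
  have e2 := mul_nonneg hh.le hs.1
  have e3 := mul_nonneg hh.le hq.1
  have f1 := mul_le_of_le_one_right hh.le hr.2
  have f2 := mul_le_of_le_one_right hh.le hs.2
  have f3 := mul_le_of_le_one_right hh.le hq.2
  exact ⟨by linarith [hx.1], by linarith [hxh.2]⟩

theorem Jet.thirdDiffBound {a b M : ℝ} {f f1 f2 f3 : ℝ → ℂ} (j : Jet f f1 f2 f3)
    (hM : ∀ y ∈ Icc a b, ‖f3 y‖ ≤ M) : ThirdDiffBound a b M f := by
  intro x h hh hx hxh
  rw [j.dq3 hh, norm_mul, mul_comm, norm_pow, Complex.norm_real, Real.norm_eq_abs, abs_of_pos hh]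
  gcongr
  exact Jet.norm_avg3_le hh hx hxh hM

theorem Jet.norm_le_of_thirdDiffBound {a b M : ℝ} (hab : a < b) {f f1 f2 f3 : ℝ → ℂ}
    (j : Jet f f1 f2 f3) (hM : ThirdDiffBound a b M f) {y : ℝ} (hy : y ∈ Icc a b) :
    ‖f3 y‖ ≤ M := by
  have h1 : Icc a b ⊆ {y | ‖f3 y‖ ≤ M} := by
    rw [← closure_Ico hab.ne]
    refine closure_minimal (fun x hx => ?_) (isClosed_le j.c3.norm continuous_const)
    have ht : Tendsto (fun h : ℝ => _root_.avg h (_root_.avg h (_root_.avg h f3)) x) (𝓝[>] 0)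
        (𝓝 (f3 x)) := by
      rw [Metric.tendsto_nhds]
      intro ε hε
      obtain ⟨δ, hδ, H⟩ := Metric.continuous_iff.1 j.c3 x (ε / 2) (half_pos hε)
      have : ∀ᶠ h in 𝓝[>] (0 : ℝ), h ∈ Ioo 0 (δ / 3) := Ioo_mem_nhdsGT (by positivity)
      filter_upwards [this] with h hh
      rw [dist_eq_norm, avg_sub_const (continuous_avg h (continuous_avg h j.c3))]
      refine (norm_avg_le (M := ε / 2) fun r hr => ?_).trans_lt (half_lt_self hε)
      rw [avg_sub_const (continuous_avg h j.c3)]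
      refine norm_avg_le fun s hs => ?_
      rw [avg_sub_const j.c3]
      refine norm_avg_le fun q hq => ?_
      rw [← dist_eq_norm]
      refine (H _ ?_).le
      have e1 := mul_nonneg hh.1.le hr.1
      have e2 := mul_nonneg hh.1.le hs.1
      have e3 := mul_nonneg hh.1.le hq.1
      have f1 := mul_le_of_le_one_right hh.1.le hr.2
      have f2 := mul_le_of_le_one_right hh.1.le hs.2
      have f3 := mul_le_of_le_one_right hh.1.le hq.2
      rw [Real.dist_eq, abs_lt]
      constructor <;> linarith [hh.2]
    refine le_of_tendsto ht.norm ?_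
    have : ∀ᶠ h in 𝓝[>] (0 : ℝ), h ∈ Ioo 0 ((b - x) / 3) :=
      Ioo_mem_nhdsGT (by linarith [hx.2])
    filter_upwards [this] with h hh
    have := hM x h hh.1 ⟨hx.1, hx.2.le⟩ ⟨by linarith [hx.1, hh.1], by linarith [hh.2]⟩
    rw [j.dq3 hh.1, norm_mul, mul_comm, norm_pow, Complex.norm_real, Real.norm_eq_abs,
      abs_of_pos hh.1] at this
    exact le_of_mul_le_mul_right this (pow_pos hh.1 3)
  exact h1 hy

theorem isClosed_thirdDiffBound (a b M : ℝ) {p : ℝ → ℝ → ℂ}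
    (hp : ∀ x, Continuous fun t => p t x) : IsClosed {t | ThirdDiffBound a b M (p t)} := by
  simp only [ThirdDiffBound, Set.ofPred_forall]
  refine isClosed_iInter fun x => isClosed_iInter fun h => isClosed_iInter fun _ =>
    isClosed_iInter fun _ => isClosed_iInter fun _ => isClosed_le ?_ continuous_const
  have := hp x; have := hp (x + h); have := hp (x + 2 * h); have := hp (x + 3 * h)
  fun_prop

end Averages

section IntegralTools

theorem nsq_nonneg {a b : ℝ} (hab : a ≤ b) (f : ℝ → ℂ) : 0 ≤ nsq a b f :=
  intervalIntegral.integral_nonneg hab fun _ _ => by positivity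

theorem nsq_le_of_bound {a b M : ℝ} (hab : a ≤ b) {f : ℝ → ℂ} (hf : Continuous f)
    (h : ∀ x ∈ Icc a b, ‖f x‖ ^ 2 ≤ M) : nsq a b f ≤ M * (b - a) := by
  have := intervalIntegral.integral_mono_on hab
    ((hf.norm.pow 2).intervalIntegrable a b) (intervalIntegrable_const (c := M) (μ := volume)) h
  simpa [nsq, mul_comm] using this

theorem nsq_mono_interval {a b a' b' : ℝ} (ha : a' ≤ a) (hab : a ≤ b) (hb : b ≤ b') {f : ℝ → ℂ}
    (hf : Continuous f) : nsq a b f ≤ nsq a' b' f :=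
  intervalIntegral.integral_mono_interval ha hab hb
    (Eventually.of_forall fun _ => by positivity) ((hf.norm.pow 2).intervalIntegrable _ _)

theorem nsq_add_interval {a b c : ℝ} {f : ℝ → ℂ} (hf : Continuous f) :
    nsq a c f = nsq a b f + nsq b c f :=
  (intervalIntegral.integral_add_adjacent_intervals ((hf.norm.pow 2).intervalIntegrable _ _)
    ((hf.norm.pow 2).intervalIntegrable _ _)).symm

theorem cauchy_schwarz_interval {a b : ℝ} (hab : a ≤ b) {f g : ℝ → ℝ} (hf : Continuous f)
    (hg : Continuous g) :
    ∫ x in a..b, f x * g x ≤ √(∫ x in a..b, f x ^ 2) * √(∫ x in a..b, g x ^ 2) := by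
  have hF : 0 ≤ ∫ x in a..b, f x ^ 2 :=
    intervalIntegral.integral_nonneg hab fun _ _ => by positivity
  rw [← Real.sqrt_mul hF]
  apply Real.le_sqrt_of_sq_le
  have := discrim_le_zero (a := ∫ x in a..b, f x ^ 2) (b := 2 * ∫ x in a..b, f x * g x)
    (c := ∫ x in a..b, g x ^ 2) (fun y => by
      have h0 : 0 ≤ ∫ x in a..b, (y * f x + g x) ^ 2 :=
        intervalIntegral.integral_nonneg hab fun _ _ => by positivity
      have e : ∀ x, (y * f x + g x) ^ 2 = y * y * f x ^ 2 + 2 * y * (f x * g x) + g x ^ 2 :=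
        fun x => by ring
      simp only [e] at h0
      rw [intervalIntegral.integral_add, intervalIntegral.integral_add,
        intervalIntegral.integral_const_mul, intervalIntegral.integral_const_mul] at h0
      · linarith
      all_goals exact Continuous.intervalIntegrable (by fun_prop) _ _)
  unfold discrim at this
  linarith

theorem integral_norm_mul_norm_le {a b : ℝ} (hab : a ≤ b) {f g : ℝ → ℂ} (hf : Continuous f)
    (hg : Continuous g) : ∫ x in a..b, ‖f x‖ * ‖g x‖ ≤ √(nsq a b f) * √(nsq a b g) :=
  cauchy_schwarz_interval hab hf.norm hg.norm

theorem two_sqrt_mul_le {A B θ : ℝ} (hA : 0 ≤ A) (hB : 0 ≤ B) (hθ : 0 < θ) :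
    2 * (√A * √B) ≤ A / θ + θ * B := by
  have h1 := Real.sq_sqrt hA
  have h2 := Real.sq_sqrt hB
  rw [div_add' _ _ _ hθ.ne', le_div_iff₀ hθ]
  have h3 : θ ^ 2 * √B ^ 2 = θ ^ 2 * B := by rw [h2]
  nlinarith [sq_nonneg (√A - θ * √B)]

theorem sobolev_interval {a b x : ℝ} (hab : a < b) {f f1 : ℝ → ℂ}
    (hd : ∀ x, HasDerivAt f (f1 x) x) (hc : Continuous f1) (hx : x ∈ Icc a b) :
    ‖f x‖ ^ 2 ≤ nsq a b f / (b - a) + 2 * (√(nsq a b f) * √(nsq a b f1)) := by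
  have hf : Continuous f := continuous_iff_continuousAt.2 fun x => (hd x).continuousAt
  have hi : ∀ y ∈ Icc a b, ‖f x‖ ^ 2 ≤ ‖f y‖ ^ 2 + 2 * (√(nsq a b f) * √(nsq a b f1)) := by
    intro y hy
    have e : ∫ s in y..x, 2 * inner ℝ (f s) (f1 s) = ‖f x‖ ^ 2 - ‖f y‖ ^ 2 :=
      intervalIntegral.integral_eq_sub_of_hasDerivAt (fun s _ => (hd s).norm_sq)
        (Continuous.intervalIntegrable (by fun_prop) _ _)
    have h1 : |∫ s in y..x, 2 * inner ℝ (f s) (f1 s)| ≤ |∫ s in y..x, 2 * (‖f s‖ * ‖f1 s‖)| := by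
      refine intervalIntegral.norm_integral_le_abs_of_norm_le (f := fun s => 2 * inner ℝ (f s) (f1 s))
        (Eventually.of_forall fun s => ?_) (Continuous.intervalIntegrable (by fun_prop) _ _)
      rw [norm_mul, Real.norm_ofNat]
      gcongr
      exact norm_inner_le_norm _ _
    have h2 : |∫ s in y..x, 2 * (‖f s‖ * ‖f1 s‖)| ≤ ∫ s in a..b, 2 * (‖f s‖ * ‖f1 s‖) := by
      have := intervalIntegral.abs_integral_mono_interval (c := a) (d := b) (a := y) (b := x)
        (μ := volume) (f := fun s => 2 * (‖f s‖ * ‖f1 s‖)) ?_ (Eventually.of_forall fun s => by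
          simp only [Pi.zero_apply]; positivity)
        (Continuous.intervalIntegrable (by fun_prop) _ _)
      · refine this.trans_eq (abs_of_nonneg ?_)
        exact intervalIntegral.integral_nonneg hab.le fun _ _ => by positivity
      · rw [uIoc_of_le hab.le, uIoc]
        exact Ioc_subset_Ioc (le_min hy.1 hx.1) (max_le hy.2 hx.2)
    have h3 := integral_norm_mul_norm_le hab.le hf hc
    rw [e] at h1
    simp only [intervalIntegral.integral_const_mul] at h1 h2
    linarith [le_abs_self (‖f x‖ ^ 2 - ‖f y‖ ^ 2)]
  have := intervalIntegral.integral_mono_on hab.le (intervalIntegrable_const (μ := volume))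
    (Continuous.intervalIntegrable (by fun_prop) _ _) hi
  rw [intervalIntegral.integral_add (Continuous.intervalIntegrable (by fun_prop) _ _)
    (Continuous.intervalIntegrable (by fun_prop) _ _), intervalIntegral.integral_const,
    intervalIntegral.integral_const, smul_eq_mul, smul_eq_mul] at this
  have hba : 0 < b - a := sub_pos.2 hab
  rw [div_add' _ _ _ hba.ne', le_div_iff₀ hba]
  unfold nsq at *
  linarith

/-- A convergence criterion: pointwise limits which are bounded in `L²` converge in `L¹`. -/
theorem tendsto_integral_norm_of_nsq_bounded {ι : Type*} {l : Filter ι} [l.IsCountablyGenerated]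
    {a b C : ℝ} (hab : a ≤ b) {q : ι → ℝ → ℂ} (hq : ∀ᶠ i in l, Continuous (q i))
    (hlim : ∀ x ∈ Icc a b, Tendsto (fun i => q i x) l (𝓝 0))
    (hC : ∀ᶠ i in l, nsq a b (q i) ≤ C) :
    Tendsto (fun i => ∫ x in a..b, ‖q i x‖) l (𝓝 0) := by
  rw [Metric.tendsto_nhds]
  intro ε hε
  set M : ℝ := 2 * (|C| + 1) / ε with hM
  have hM0 : 0 < M := by positivity
  have h1 : Tendsto (fun i => ∫ x in a..b, min ‖q i x‖ M) l (𝓝 (∫ x in a..b, (0 : ℝ))) := by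
    refine intervalIntegral.tendsto_integral_filter_of_dominated_convergence (fun _ => M) ?_ ?_
      (by simp) ?_
    · filter_upwards [hq] with i hi
      exact Continuous.aestronglyMeasurable (by fun_prop)
    · refine Eventually.of_forall fun i => Eventually.of_forall fun x _ => ?_
      rw [Real.norm_eq_abs, abs_of_nonneg (le_min (norm_nonneg _) hM0.le)]
      exact min_le_right _ _
    · refine Eventually.of_forall fun x hx => ?_
      rw [uIoc_of_le hab] at hx
      have := (hlim x ⟨hx.1.le, hx.2⟩).norm.min (tendsto_const_nhds (x := M))
      simpa [hM0.le] using this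
  rw [intervalIntegral.integral_zero, Metric.tendsto_nhds] at h1
  filter_upwards [h1 (ε / 2) (half_pos hε), hq, hC] with i h1 hi hC
  rw [Real.dist_eq, sub_zero] at h1 ⊢
  rw [abs_of_nonneg (intervalIntegral.integral_nonneg hab fun _ _ => norm_nonneg _)]
  have h2 : ∫ x in a..b, ‖q i x‖ ≤ ∫ x in a..b, (min ‖q i x‖ M + M⁻¹ * ‖q i x‖ ^ 2) := by
    refine intervalIntegral.integral_mono_on hab (Continuous.intervalIntegrable (by fun_prop) _ _)
      (Continuous.intervalIntegrable (by fun_prop) _ _) fun x _ => ?_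
    rcases le_total ‖q i x‖ M with h | h
    · rw [min_eq_left h]; exact le_add_of_nonneg_right (by positivity)
    · have : ‖q i x‖ ≤ M⁻¹ * ‖q i x‖ ^ 2 := by
        rw [inv_mul_eq_div, le_div_iff₀ hM0, pow_two]; gcongr
      exact this.trans (le_add_of_nonneg_left (le_min (norm_nonneg _) hM0.le))
  rw [intervalIntegral.integral_add (Continuous.intervalIntegrable (by fun_prop) _ _)
    (Continuous.intervalIntegrable (by fun_prop) _ _), intervalIntegral.integral_const_mul] at h2
  have h3 : M⁻¹ * nsq a b (q i) < ε / 2 := by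
    have : nsq a b (q i) < |C| + 1 := by linarith [le_abs_self C]
    calc M⁻¹ * nsq a b (q i) < M⁻¹ * (|C| + 1) := by gcongr
      _ = ε / 2 := by rw [hM]; field_simp
  unfold nsq at h3
  linarith [le_abs_self (∫ x in a..b, min ‖q i x‖ M)]

theorem nsq_sub_le {a b : ℝ} (hab : a ≤ b) {f g : ℝ → ℂ} (hf : Continuous f)
    (hg : Continuous g) : nsq a b (fun x => f x - g x) ≤ 2 * nsq a b f + 2 * nsq a b g := by
  unfold nsq
  rw [← intervalIntegral.integral_const_mul, ← intervalIntegral.integral_const_mul,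
    ← intervalIntegral.integral_add (Continuous.intervalIntegrable (by fun_prop) _ _)
    (Continuous.intervalIntegrable (by fun_prop) _ _)]
  refine intervalIntegral.integral_mono_on hab (Continuous.intervalIntegrable (by fun_prop) _ _)
      (Continuous.intervalIntegrable (by fun_prop) _ _) fun x _ => ?_
  have := norm_sub_le (f x) (g x)
  nlinarith [sq_nonneg (‖f x‖ - ‖g x‖), norm_nonneg (f x - g x)]

theorem nsq_add_le {a b : ℝ} (hab : a ≤ b) {f g : ℝ → ℂ} (hf : Continuous f)
    (hg : Continuous g) : nsq a b (fun x => f x + g x) ≤ 2 * nsq a b f + 2 * nsq a b g := by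
  have := nsq_sub_le hab hf hg.neg
  simpa [nsq] using this

theorem nsq_const_mul (a b : ℝ) (c : ℂ) (f : ℝ → ℂ) :
    nsq a b (fun x => c * f x) = ‖c‖ ^ 2 * nsq a b f := by
  simp [nsq, mul_pow]

theorem tendsto_integral_norm_sub {ι : Type*} {l : Filter ι} [l.IsCountablyGenerated]
    {a b C : ℝ} (hab : a ≤ b) {q : ι → ℝ → ℂ} {q0 : ℝ → ℂ} (hq : ∀ᶠ i in l, Continuous (q i))
    (hq0 : Continuous q0) (hlim : ∀ x ∈ Icc a b, Tendsto (fun i => q i x) l (𝓝 (q0 x)))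
    (hC : ∀ᶠ i in l, nsq a b (q i) ≤ C) :
    Tendsto (fun i => ∫ x in a..b, ‖q i x - q0 x‖) l (𝓝 0) := by
  refine tendsto_integral_norm_of_nsq_bounded (C := 2 * C + 2 * nsq a b q0) hab ?_ ?_ ?_
  · filter_upwards [hq] with i hi
    exact hi.sub hq0
  · intro x hx
    simpa using (hlim x hx).sub_const (q0 x)
  · filter_upwards [hq, hC] with i hi hC
    linarith [nsq_sub_le hab hi hq0]

/-- Averaging over steps `h ≥ 0` does not increase the squared norm, up to enlarging the
interval. -/
theorem nsq_avg_le {a b h : ℝ} (hab : a ≤ b) (hh : 0 ≤ h) {f : ℝ → ℂ} (hf : Continuous f) :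
    nsq a b (avg h f) ≤ nsq a (b + h) f := by
  have h1 : ∀ x, ‖avg h f x‖ ^ 2 ≤ ∫ r in (0 : ℝ)..1, ‖f (x + h * r)‖ ^ 2 := by
    intro x
    have e1 : ‖avg h f x‖ ≤ ∫ r in (0 : ℝ)..1, ‖f (x + h * r)‖ :=
      intervalIntegral.norm_integral_le_integral_norm zero_le_one
    have e2 := cauchy_schwarz_interval zero_le_one
      (f := fun r => ‖f (x + h * r)‖) (g := fun _ => (1 : ℝ)) (by fun_prop) (by fun_prop)
    simp only [mul_one, one_pow, intervalIntegral.integral_const, sub_zero, smul_eq_mul,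
      Real.sqrt_one] at e2
    calc ‖avg h f x‖ ^ 2 ≤ √(∫ r in (0 : ℝ)..1, ‖f (x + h * r)‖ ^ 2) ^ 2 := by
          gcongr; exact e1.trans e2
      _ = _ := Real.sq_sqrt (intervalIntegral.integral_nonneg zero_le_one
          fun _ _ => by positivity)
  have hcont : Continuous fun x => ∫ r in (0 : ℝ)..1, ‖f (x + h * r)‖ ^ 2 := by
    apply intervalIntegral.continuous_parametric_intervalIntegral_of_continuous' (a₀ := 0)
    fun_prop
  calc nsq a b (avg h f) ≤ ∫ x in a..b, ∫ r in (0 : ℝ)..1, ‖f (x + h * r)‖ ^ 2 :=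
        intervalIntegral.integral_mono_on hab
          (((continuous_avg h hf).norm.pow 2).intervalIntegrable _ _)
          (hcont.intervalIntegrable _ _) fun x _ => h1 x
    _ = ∫ r in (0 : ℝ)..1, ∫ x in a..b, ‖f (x + h * r)‖ ^ 2 := by
        simp only [intervalIntegral.integral_of_le hab,
          intervalIntegral.integral_of_le zero_le_one]
        rw [MeasureTheory.integral_integral_swap]
        rw [Measure.prod_restrict]
        have : Continuous fun z : ℝ × ℝ => ‖f (z.1 + h * z.2)‖ ^ 2 := by fun_prop
        exact (this.continuousOn.integrableOn_compact (isCompact_Icc.prod isCompact_Icc)).mono_set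
          (prod_mono Ioc_subset_Icc_self Ioc_subset_Icc_self)
    _ ≤ ∫ _ in (0 : ℝ)..1, nsq a (b + h) f := by
        refine intervalIntegral.integral_mono_on zero_le_one ?_ (by simp) fun r hr => ?_
        · apply Continuous.intervalIntegrable
          apply intervalIntegral.continuous_parametric_intervalIntegral_of_continuous' (a₀ := a)
          fun_prop
        · rw [intervalIntegral.integral_comp_add_right (fun y => ‖f y‖ ^ 2)]
          have h1 := mul_nonneg hh hr.1
          have h2 := mul_le_of_le_one_right hh hr.2
          exact nsq_mono_interval (by linarith) (by linarith) (by linarith) hf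
    _ = _ := by simp

end IntegralTools

section TimeDerivatives

/-- `s ↦ z s` is Lipschitz at `t` for the `L²` norm on `[a, b]`. -/
def LipAt (a b : ℝ) (z : ℝ → ℝ → ℂ) (t : ℝ) : Prop :=
  ∃ C, ∀ᶠ s in 𝓝 t, nsq a b (fun x => z s x - z t x) ≤ C * (s - t) ^ 2

theorem LipAt.mono {a b a' b' t : ℝ} {z : ℝ → ℝ → ℂ} (hz : ∀ s, Continuous (z s))
    (h : LipAt a b z t) (ha : a ≤ a') (hab : a' ≤ b') (hb : b' ≤ b) : LipAt a' b' z t := by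
  obtain ⟨C, hC⟩ := h
  refine ⟨C, hC.mono fun s hs => (nsq_mono_interval ha hab hb ?_).trans hs⟩
  exact (hz s).sub (hz t)

theorem LipAt.sub_const {a b t : ℝ} {z : ℝ → ℝ → ℂ} (h : LipAt a b z t) (g : ℝ → ℂ) :
    LipAt a b (fun s x => z s x - g x) t := by
  simpa [LipAt] using h

theorem avg_sub {h : ℝ} {f g : ℝ → ℂ} (hf : Continuous f) (hg : Continuous g) (x : ℝ) :
    avg h (fun y => f y - g y) x = avg h f x - avg h g x := by
  unfold avg
  rw [intervalIntegral.integral_sub]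
  all_goals exact Continuous.intervalIntegrable (by fun_prop) _ _

theorem LipAt.avg {a b h t : ℝ} {z : ℝ → ℝ → ℂ} (hz : ∀ s, Continuous (z s)) (hab : a ≤ b)
    (hh : 0 ≤ h) (H : LipAt a (b + h) z t) : LipAt a b (fun s => avg h (z s)) t := by
  obtain ⟨C, hC⟩ := H
  refine ⟨C, hC.mono fun s hs => le_trans ?_ hs⟩
  have := nsq_avg_le hab hh ((hz s).sub (hz t))
  refine le_trans (le_of_eq ?_) this
  congr 1; funext x
  exact (avg_sub (hz s) (hz t) x).symm

theorem nsq_shift {a b h : ℝ} (f : ℝ → ℂ) :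
    nsq a b (fun x => f (x + h)) = nsq (a + h) (b + h) f := by
  unfold nsq
  rw [intervalIntegral.integral_comp_add_right (fun y => ‖f y‖ ^ 2)]

theorem nsq_dq_le {a b h : ℝ} (hab : a ≤ b) (hh : 0 < h) {f : ℝ → ℂ} (hf : Continuous f) :
    nsq a b (dq h f) ≤ 4 / h ^ 2 * nsq a (b + h) f := by
  have e : dq h f = fun x => ((h : ℂ)⁻¹) * (f (x + h) - f x) := by
    funext x; rw [dq, inv_mul_eq_div]
  rw [e, nsq_const_mul, norm_inv, Complex.norm_real, Real.norm_eq_abs, abs_of_pos hh]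
  have h1 := nsq_sub_le hab (f := fun x => f (x + h)) (by fun_prop) hf
  rw [nsq_shift] at h1
  have h2 := nsq_mono_interval (a := a + h) (b := b + h) (a' := a) (b' := b + h) (by linarith)
    (by linarith) le_rfl hf
  have h3 := nsq_mono_interval (a := a) (b := b) (a' := a) (b' := b + h) le_rfl hab (by linarith) hf
  have h4 : nsq a b (fun x => f (x + h) - f x) ≤ 4 * nsq a (b + h) f := by linarith
  calc h⁻¹ ^ 2 * nsq a b (fun x => f (x + h) - f x) ≤ h⁻¹ ^ 2 * (4 * nsq a (b + h) f) := by gcongr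
    _ = _ := by field_simp

theorem LipAt.dq {a b h t : ℝ} {z : ℝ → ℝ → ℂ} (hz : ∀ s, Continuous (z s)) (hab : a ≤ b)
    (hh : 0 < h) (H : LipAt a (b + h) z t) : LipAt a b (fun s => dq h (z s)) t := by
  obtain ⟨C, hC⟩ := H
  refine ⟨4 / h ^ 2 * C, hC.mono fun s hs => ?_⟩
  have := nsq_dq_le hab hh ((hz s).sub (hz t))
  calc nsq a b (fun x => _root_.dq h (z s) x - _root_.dq h (z t) x)
      = nsq a b (_root_.dq h (z s - z t)) := by
        congr 1; funext x; simp only [_root_.dq, Pi.sub_apply]; ring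
    _ ≤ 4 / h ^ 2 * nsq a (b + h) (z s - z t) := this
    _ ≤ 4 / h ^ 2 * (C * (s - t) ^ 2) := by gcongr; exact hs
    _ = _ := by ring

theorem LipAt.eventually_slope {a b t : ℝ} {z : ℝ → ℝ → ℂ} (h : LipAt a b z t) :
    ∃ C, ∀ᶠ s in 𝓝[≠] t, nsq a b (fun x => slope (fun σ => z σ x) t s) ≤ C := by
  obtain ⟨C, hC⟩ := h
  refine ⟨C, ?_⟩
  filter_upwards [hC.filter_mono nhdsWithin_le_nhds, self_mem_nhdsWithin] with s hs hne
  have hst : s - t ≠ 0 := sub_ne_zero.2 hne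
  have e : (fun x => slope (fun σ => z σ x) t s)
      = fun x => (((s - t)⁻¹ : ℝ) : ℂ) * (z s x - z t x) := by
    funext x; rw [slope_def_module, Complex.real_smul]
  rw [e, nsq_const_mul, Complex.norm_real, Real.norm_eq_abs, sq_abs, inv_pow,
    inv_mul_le_iff₀ (by positivity), mul_comm]
  exact hs

theorem continuous_slope_fst {z : ℝ → ℝ → ℂ} (hz : ∀ s, Continuous (z s)) (t s : ℝ) :
    Continuous fun x => slope (fun σ => z σ x) t s := by
  simp only [slope_def_module]
  exact ((hz s).sub (hz t)).const_smul _

theorem LipAt.tendsto_slope {a b t : ℝ} {z : ℝ → ℝ → ℂ} {zt : ℝ → ℂ} (hab : a ≤ b)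
    (hz : ∀ s, Continuous (z s)) (hzt : Continuous zt) (h : LipAt a b z t)
    (hd : ∀ x ∈ Icc a b, HasDerivAt (fun s => z s x) (zt x) t) :
    Tendsto (fun s => ∫ x in a..b, ‖slope (fun σ => z σ x) t s - zt x‖) (𝓝[≠] t) (𝓝 0) := by
  obtain ⟨C, hC⟩ := h.eventually_slope
  exact tendsto_integral_norm_sub hab (Eventually.of_forall fun s => continuous_slope_fst hz t s)
    hzt (fun x hx => hasDerivAt_iff_tendsto_slope.1 (hd x hx)) hC

theorem LipAt.hasDerivAt_avg {a b h t x : ℝ} {z : ℝ → ℝ → ℂ} {zt : ℝ → ℂ}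
    (hz : ∀ s, Continuous (z s)) (hzt : Continuous zt) (H : LipAt a b z t)
    (hd : ∀ x ∈ Icc a b, HasDerivAt (fun s => z s x) (zt x) t) (hh : 0 < h) (hx : a ≤ x)
    (hxh : x + h ≤ b) : HasDerivAt (fun s => _root_.avg h (z s) x) (_root_.avg h zt x) t := by
  rw [hasDerivAt_iff_tendsto_slope, tendsto_iff_norm_sub_tendsto_zero]
  have h1 := (H.tendsto_slope (by linarith) hz hzt hd).const_mul h⁻¹
  rw [mul_zero] at h1
  refine squeeze_zero (fun _ => norm_nonneg _) (fun s => ?_) h1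
  have e : slope (fun s => _root_.avg h (z s) x) t s - _root_.avg h zt x
      = (h : ℂ)⁻¹ * ∫ y in x..(x + h), (slope (fun σ => z σ y) t s - zt y) := by
    have hC : (h : ℂ) ≠ 0 := by exact_mod_cast hh.ne'
    rw [← mul_avg_eq_integral, inv_mul_cancel_left₀ hC,
      avg_sub (continuous_slope_fst hz t s) hzt, slope_def_module, ← avg_sub (hz s) (hz t)]
    congr 1
    simp only [slope_def_module, _root_.avg]
    rw [intervalIntegral.integral_smul]
  rw [e, norm_mul, norm_inv, Complex.norm_real, Real.norm_eq_abs, abs_of_pos hh]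
  gcongr
  refine (intervalIntegral.norm_integral_le_integral_norm (by linarith)).trans ?_
  exact intervalIntegral.integral_mono_interval hx (by linarith) hxh
    (Eventually.of_forall fun _ => norm_nonneg _)
    (((continuous_slope_fst hz t s).sub hzt).norm.intervalIntegrable _ _)

theorem LipAt.hasDerivAt_energy {a b t : ℝ} {z : ℝ → ℝ → ℂ} {zt : ℝ → ℂ} {φ : ℝ → ℝ}
    (hab : a ≤ b) (hφ : Continuous φ) (hz : ∀ s, Continuous (z s)) (hzt : Continuous zt)
    (H : LipAt a b z t) (hd : ∀ x ∈ Icc a b, HasDerivAt (fun s => z s x) (zt x) t) :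
    HasDerivAt (fun s => ∫ x in a..b, φ x * ‖z s x‖ ^ 2)
      (∫ x in a..b, φ x * (2 * inner ℝ (z t x) (zt x))) t := by
  have hL := H.tendsto_slope hab hz hzt hd
  obtain ⟨C, hC⟩ := H.eventually_slope
  set q : ℝ → ℝ → ℂ := fun s x => slope (fun σ => z σ x) t s with hqdef
  have hq : ∀ s, Continuous (q s) := fun s => continuous_slope_fst hz t s
  have hzt' := hz t
  obtain ⟨K, hK⟩ : ∃ K, ∀ x ∈ Icc a b, |φ x| ≤ K :=
    isCompact_Icc.exists_bound_of_continuousOn hφ.continuousOn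
  obtain ⟨L, hL'⟩ : ∃ L, ∀ x ∈ Icc a b, ‖z t x‖ ≤ L :=
    isCompact_Icc.exists_bound_of_continuousOn (hz t).continuousOn
  rw [hasDerivAt_iff_tendsto_slope, tendsto_iff_norm_sub_tendsto_zero]
  have hid : ∀ s, s ≠ t → slope (fun s => ∫ x in a..b, φ x * ‖z s x‖ ^ 2) t s
      - (∫ x in a..b, φ x * (2 * inner ℝ (z t x) (zt x)))
      = ∫ x in a..b, (φ x * (2 * inner ℝ (z t x) (q s x - zt x)) +
        (s - t) * (φ x * ‖q s x‖ ^ 2)) := by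
    intro s hs
    have hst : s - t ≠ 0 := sub_ne_zero.2 hs
    have hs' := hz s
    have hqs := hq s
    rw [slope_def_module, ← intervalIntegral.integral_sub
      (Continuous.intervalIntegrable (by fun_prop) _ _)
      (Continuous.intervalIntegrable (by fun_prop) _ _), smul_eq_mul,
      ← intervalIntegral.integral_const_mul, ← intervalIntegral.integral_sub
      (Continuous.intervalIntegrable (by fun_prop) _ _)
      (Continuous.intervalIntegrable (by fun_prop) _ _)]
    refine intervalIntegral.integral_congr fun x _ => ?_
    have e : z s x = z t x + (s - t) • q s x := by
      simp only [hqdef, slope_def_module, smul_smul, mul_inv_cancel₀ hst, one_smul]; ring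
    simp only [inner_sub_right]
    rw [e, norm_add_sq_real, norm_smul, inner_smul_right, mul_pow, Real.norm_eq_abs, sq_abs]
    field_simp
    ring
  have hlim : Tendsto (fun s => 2 * K * L * (∫ x in a..b, ‖q s x - zt x‖) + |s - t| * (K * C))
      (𝓝[≠] t) (𝓝 0) := by
    have h1 : Tendsto (fun s => |s - t| * (K * C)) (𝓝[≠] t) (𝓝 0) := by
      have : Continuous fun s => |s - t| * (K * C) := by fun_prop
      simpa using (this.tendsto t).mono_left nhdsWithin_le_nhds
    simpa using (hL.const_mul (2 * K * L)).add h1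
  refine squeeze_zero' (Eventually.of_forall fun _ => norm_nonneg _) ?_ hlim
  filter_upwards [hC, self_mem_nhdsWithin] with s hs hne
  have hqs := hq s
  have hK0 : ∀ x ∈ Icc a b, 0 ≤ K := fun x hx => (abs_nonneg _).trans (hK x hx)
  rw [hid s hne]
  refine (intervalIntegral.norm_integral_le_integral_norm hab).trans ?_
  calc _ ≤ ∫ x in a..b, (2 * K * L * ‖q s x - zt x‖ + |s - t| * (K * ‖q s x‖ ^ 2)) := by
        refine intervalIntegral.integral_mono_on hab
          (Continuous.intervalIntegrable (by fun_prop) _ _)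
          (Continuous.intervalIntegrable (by fun_prop) _ _) fun x hx => ?_
        refine (norm_add_le _ _).trans (add_le_add ?_ ?_)
        · rw [Real.norm_eq_abs, abs_mul, abs_mul, abs_two]
          have h1 := (abs_real_inner_le_norm (z t x) (q s x - zt x)).trans
            (mul_le_mul_of_nonneg_right (hL' x hx) (norm_nonneg _))
          have := mul_le_mul (hK x hx) h1 (abs_nonneg _) (hK0 x hx)
          linarith
        · rw [Real.norm_eq_abs, abs_mul, abs_mul, abs_of_nonneg (sq_nonneg ‖q s x‖)]
          gcongr
          exact hK x hx
    _ = 2 * K * L * (∫ x in a..b, ‖q s x - zt x‖) + |s - t| * (K * nsq a b (q s)) := by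
        rw [intervalIntegral.integral_add (Continuous.intervalIntegrable (by fun_prop) _ _)
          (Continuous.intervalIntegrable (by fun_prop) _ _), intervalIntegral.integral_const_mul,
          intervalIntegral.integral_const_mul, intervalIntegral.integral_const_mul, nsq]
    _ ≤ _ := by
        gcongr
        exact hK0 a ⟨le_rfl, hab⟩

end TimeDerivatives

section Energy

/-- A weight vanishing to second order at the ends of `[a, b]`, nonnegative there, and positive
with positive derivative on `[A, B]`. -/
structure Weight (a b A B c C : ℝ) (φ φ1 φ2 φ3 : ℝ → ℝ) : Prop where
  d0 : ∀ x, HasDerivAt φ (φ1 x) x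
  d1 : ∀ x, HasDerivAt φ1 (φ2 x) x
  d2 : ∀ x, HasDerivAt φ2 (φ3 x) x
  c3 : Continuous φ3
  la : φ a = 0
  la1 : φ1 a = 0
  la2 : φ2 a = 0
  lb : φ b = 0
  lb1 : φ1 b = 0
  lb2 : φ2 b = 0
  nonneg : ∀ x ∈ Icc a b, 0 ≤ φ x
  le : ∀ x ∈ Icc a b, φ x ≤ C
  le1 : ∀ x ∈ Icc a b, |φ1 x| ≤ C
  le3 : ∀ x ∈ Icc a b, |φ3 x| ≤ C
  ge : ∀ x ∈ Icc A B, c ≤ φ x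
  ge1 : ∀ x ∈ Icc A B, c ≤ φ1 x
  c_pos : 0 < c
  C_pos : 0 < C

theorem Weight.exists {a b A B : ℝ} (h1 : a < A) (h2 : A < B) (h3 : B < b) :
    ∃ (φ φ1 φ2 φ3 : ℝ → ℝ) (c C : ℝ), Weight a b A B c C φ φ1 φ2 φ3 := by
  set L : ℝ := 6 * (b - a) / ((A - a) * (b - B)) with hL
  have hAa : 0 < A - a := sub_pos.2 h1
  have hbB : 0 < b - B := sub_pos.2 h3
  have hba : 0 < b - a := by linarith
  have hLpos : 0 < L := by positivity
  set w : ℝ → ℝ := fun x => (x - a) * (b - x) with hw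
  set w1 : ℝ → ℝ := fun x => a + b - 2 * x with hw1
  have dw : ∀ x, HasDerivAt w (w1 x) x := fun x => by
    refine (((hasDerivAt_id x).sub_const a).mul ((hasDerivAt_id x).const_sub b)).congr_deriv ?_
    simp only [hw1, id]; ring
  have dw1 : ∀ x, HasDerivAt w1 (-2) x := fun x => by
    refine (((hasDerivAt_id x).const_mul 2).const_sub (a + b)).congr_deriv ?_
    ring
  set E : ℝ → ℝ := fun x => Real.exp (L * x) with hE
  have dE : ∀ x, HasDerivAt E (L * E x) x := fun x => by
    refine (((hasDerivAt_id x).const_mul L).exp).congr_deriv ?_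
    simp only [hE, id]; ring
  have hEpos : ∀ x, 0 < E x := fun x => Real.exp_pos _
  set φ : ℝ → ℝ := fun x => w x ^ 3 * E x with hφ
  set φ1 : ℝ → ℝ := fun x => (3 * w x ^ 2 * w1 x + L * w x ^ 3) * E x with hφ1
  set φ2 : ℝ → ℝ := fun x => (6 * w x * w1 x ^ 2 - 6 * w x ^ 2 + 6 * L * w x ^ 2 * w1 x +
    L ^ 2 * w x ^ 3) * E x with hφ2
  set φ3 : ℝ → ℝ := fun x => (6 * w1 x ^ 3 - 36 * w x * w1 x + 18 * L * w x * w1 x ^ 2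
    - 18 * L * w x ^ 2 + 9 * L ^ 2 * w x ^ 2 * w1 x + L ^ 3 * w x ^ 3) * E x with hφ3
  have cw : Continuous w := by fun_prop
  have cw1 : Continuous w1 := by fun_prop
  have cE : Continuous E := by fun_prop
  have cφ : Continuous φ := by fun_prop
  have cφ1 : Continuous φ1 := by fun_prop
  have cφ3 : Continuous φ3 := by fun_prop
  have wa : w a = 0 := by simp [hw]
  have wb : w b = 0 := by simp [hw]
  have wpos : ∀ x ∈ Icc A B, (A - a) * (b - B) ≤ w x := fun x hx => by
    have e1 := hx.1; have e2 := hx.2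
    exact mul_le_mul (by linarith) (by linarith) hbB.le (by linarith)
  have φpos : ∀ x ∈ Icc A B, 0 < φ x := fun x hx => by
    have : 0 < w x := (mul_pos hAa hbB).trans_le (wpos x hx)
    have := hEpos x
    simp only [hφ]; positivity
  have φ1pos : ∀ x ∈ Icc A B, 0 < φ1 x := fun x hx => by
    have h0 := mul_pos hAa hbB
    have hwx : 0 < w x := h0.trans_le (wpos x hx)
    have hLw : 6 * (b - a) ≤ L * w x := by
      rw [hL, div_mul_eq_mul_div, le_div_iff₀ h0]
      gcongr
      exact wpos x hx
    have hw1x : -(b - a) ≤ w1 x := by simp only [hw1]; linarith [hx.2]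
    have : 0 < 3 * w1 x + L * w x := by linarith
    have e : φ1 x = w x ^ 2 * (3 * w1 x + L * w x) * E x := by simp only [hφ1]; ring
    have := hEpos x
    rw [e]; positivity
  obtain ⟨x0, hx0, m0⟩ := isCompact_Icc.exists_isMinOn (nonempty_Icc.2 h2.le) cφ.continuousOn
  obtain ⟨x1, hx1, m1⟩ := isCompact_Icc.exists_isMinOn (nonempty_Icc.2 h2.le) cφ1.continuousOn
  obtain ⟨C0, k0⟩ := isCompact_Icc.exists_bound_of_continuousOn (s := Icc a b) cφ.continuousOn
  obtain ⟨C1, k1⟩ := isCompact_Icc.exists_bound_of_continuousOn (s := Icc a b) cφ1.continuousOn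
  obtain ⟨C3, k3⟩ := isCompact_Icc.exists_bound_of_continuousOn (s := Icc a b) cφ3.continuousOn
  have hm : a ∈ Icc a b := ⟨le_rfl, by linarith⟩
  have p0 := (norm_nonneg _).trans (k0 a hm)
  have p1 := (norm_nonneg _).trans (k1 a hm)
  have p3 := (norm_nonneg _).trans (k3 a hm)
  refine ⟨φ, φ1, φ2, φ3, min (φ x0) (φ1 x1), C0 + C1 + C3 + 1,
    ⟨fun x => ?_, fun x => ?_, fun x => ?_, cφ3, by simp [hφ, wa], by simp [hφ1, wa],
    by simp [hφ2, wa], by simp [hφ, wb], by simp [hφ1, wb], by simp [hφ2, wb],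
    fun x hx => ?_, fun x hx => ?_, fun x hx => ?_, fun x hx => ?_,
    fun x hx => (min_le_left _ _).trans (m0 hx), fun x hx => (min_le_right _ _).trans (m1 hx),
    lt_min (φpos _ hx0) (φ1pos _ hx1), by positivity⟩⟩
  · refine (((dw x).pow 3).mul (dE x)).congr_deriv ?_
    simp only [hφ1, Pi.pow_apply]; push_cast; ring
  · refine ((((((dw x).pow 2).const_mul 3).mul (dw1 x)).add (((dw x).pow 3).const_mul L)).mul
      (dE x)).congr_deriv ?_ |>.congr_of_eventuallyEq ?_
    · simp only [hφ2]
      simp only [Pi.add_apply, Pi.mul_apply, Pi.pow_apply]; push_cast; ring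
    · exact Eventually.of_forall fun y => by
        simp only [hφ1, Pi.add_apply, Pi.mul_apply, Pi.pow_apply]
  · refine (((((((dw x).const_mul 6).mul ((dw1 x).pow 2)).sub (((dw x).pow 2).const_mul 6)).add
      ((((dw x).pow 2).const_mul (6 * L)).mul (dw1 x))).add (((dw x).pow 3).const_mul (L ^ 2))).mul
      (dE x)).congr_deriv ?_ |>.congr_of_eventuallyEq ?_
    · simp only [hφ3]
      simp only [Pi.add_apply, Pi.sub_apply, Pi.mul_apply, Pi.pow_apply]; push_cast; ring
    · exact Eventually.of_forall fun y => by
        simp only [hφ2, Pi.add_apply, Pi.sub_apply, Pi.mul_apply, Pi.pow_apply]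
  · have : 0 ≤ w x := mul_nonneg (by linarith [hx.1]) (by linarith [hx.2])
    have := hEpos x
    simp only [hφ]; positivity
  · have := (le_abs_self _).trans (k0 x hx)
    linarith
  · have := k1 x hx
    rw [Real.norm_eq_abs] at this
    linarith
  · have := k3 x hx
    rw [Real.norm_eq_abs] at this
    linarith

end Energy

section EnergyInequalities

theorem Jet.integral_weight {φ φ1 φ2 φ3 : ℝ → ℝ} (hφ : ∀ x, HasDerivAt φ (φ1 x) x)
    (hφ1 : ∀ x, HasDerivAt φ1 (φ2 x) x) (hφ2 : ∀ x, HasDerivAt φ2 (φ3 x) x)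
    (hφ3 : Continuous φ3) {z z1 z2 z3 : ℝ → ℂ} (j : Jet z z1 z2 z3) (a b : ℝ) :
    ∫ x in a..b, φ x * (2 * inner ℝ (z x) (z3 x)) =
      (φ b * (2 * inner ℝ (z b) (z2 b)) - φ b * ‖z1 b‖ ^ 2 - φ1 b * (2 * inner ℝ (z b) (z1 b))
        + φ2 b * ‖z b‖ ^ 2)
      - (φ a * (2 * inner ℝ (z a) (z2 a)) - φ a * ‖z1 a‖ ^ 2
        - φ1 a * (2 * inner ℝ (z a) (z1 a)) + φ2 a * ‖z a‖ ^ 2)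
      + ∫ x in a..b, (3 * (φ1 x * ‖z1 x‖ ^ 2) - φ3 x * ‖z x‖ ^ 2) := by
  have c0 := j.cont0; have c1 := j.cont1; have c2 := j.cont2; have c3 := j.c3
  have k0 : Continuous φ := continuous_iff_continuousAt.2 fun x => (hφ x).continuousAt
  have k1 : Continuous φ1 := continuous_iff_continuousAt.2 fun x => (hφ1 x).continuousAt
  have k2 : Continuous φ2 := continuous_iff_continuousAt.2 fun x => (hφ2 x).continuousAt
  rw [← sub_eq_iff_eq_add, ← intervalIntegral.integral_sub
    (Continuous.intervalIntegrable (by fun_prop) _ _)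
    (Continuous.intervalIntegrable (by fun_prop) _ _)]
  refine intervalIntegral.integral_eq_sub_of_hasDerivAt
    (f := fun x => φ x * (2 * inner ℝ (z x) (z2 x)) - φ x * ‖z1 x‖ ^ 2
      - φ1 x * (2 * inner ℝ (z x) (z1 x)) + φ2 x * ‖z x‖ ^ 2) (fun x _ => ?_)
    (Continuous.intervalIntegrable (by fun_prop) _ _)
  have d1 := (hφ x).mul (((j.d0 x).inner ℝ (j.d2 x)).const_mul 2)
  have d2 := (hφ x).mul ((j.d1 x).norm_sq)
  have d3 := (hφ1 x).mul (((j.d0 x).inner ℝ (j.d1 x)).const_mul 2)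
  have d4 := (hφ2 x).mul ((j.d0 x).norm_sq)
  refine (((d1.sub d2).sub d3).add d4).congr_deriv ?_
  rw [real_inner_self_eq_norm_sq]
  ring

variable {a b A B c C : ℝ} {φ φ1 φ2 φ3 : ℝ → ℝ}

theorem Weight.cont (W : Weight a b A B c C φ φ1 φ2 φ3) : Continuous φ :=
  continuous_iff_continuousAt.2 fun x => (W.d0 x).continuousAt
theorem Weight.cont1 (W : Weight a b A B c C φ φ1 φ2 φ3) : Continuous φ1 :=
  continuous_iff_continuousAt.2 fun x => (W.d1 x).continuousAt

theorem Weight.energy_le (W : Weight a b A B c C φ φ1 φ2 φ3) (hab : a ≤ b)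
    {z z1 z2 z3 g : ℝ → ℂ} (j : Jet z z1 z2 z3) (hg : Continuous g) {m : ℝ}
    (hm : ∀ x ∈ Icc a A ∪ Icc B b, ‖z1 x‖ ^ 2 ≤ m) (hm0 : 0 ≤ m) :
    ∫ x in a..b, φ x * (2 * inner ℝ (z x) (-z3 x + g x)) ≤
      -3 * c * nsq a b z1 + C * nsq a b z + (3 * C + 3 * c) * (b - a) * m
        + ∫ x in a..b, φ x * (2 * inner ℝ (z x) (g x)) := by
  have c0 := j.cont0; have c1 := j.cont1; have c2 := j.cont2; have c3 := j.c3
  have k0 := W.cont; have k1 := W.cont1; have k3 := W.c3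
  have e1 := j.integral_weight W.d0 W.d1 W.d2 W.c3 a b
  rw [W.la, W.la1, W.la2, W.lb, W.lb1, W.lb2] at e1
  simp only [zero_mul, sub_zero, add_zero, zero_add] at e1
  have e2 : ∫ x in a..b, φ x * (2 * inner ℝ (z x) (-z3 x + g x)) =
      (∫ x in a..b, φ x * (2 * inner ℝ (z x) (g x)))
        - ∫ x in a..b, φ x * (2 * inner ℝ (z x) (z3 x)) := by
    rw [← intervalIntegral.integral_sub (Continuous.intervalIntegrable (by fun_prop) _ _)
      (Continuous.intervalIntegrable (by fun_prop) _ _)]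
    refine intervalIntegral.integral_congr fun x _ => ?_
    simp only [inner_add_right, inner_neg_right]; ring
  have e3 : ∫ x in a..b, (-3 * c * ‖z1 x‖ ^ 2 + C * ‖z x‖ ^ 2 + (3 * C + 3 * c) * m) =
      -3 * c * nsq a b z1 + C * nsq a b z + (3 * C + 3 * c) * (b - a) * m := by
    rw [intervalIntegral.integral_add (Continuous.intervalIntegrable (by fun_prop) _ _)
      (Continuous.intervalIntegrable (by fun_prop) _ _),
      intervalIntegral.integral_add (Continuous.intervalIntegrable (by fun_prop) _ _)
      (Continuous.intervalIntegrable (by fun_prop) _ _), intervalIntegral.integral_const_mul,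
      intervalIntegral.integral_const_mul, intervalIntegral.integral_const, smul_eq_mul]
    unfold nsq; ring
  have e4 : ∫ x in a..b, -(3 * (φ1 x * ‖z1 x‖ ^ 2) - φ3 x * ‖z x‖ ^ 2) ≤
      ∫ x in a..b, (-3 * c * ‖z1 x‖ ^ 2 + C * ‖z x‖ ^ 2 + (3 * C + 3 * c) * m) := by
    refine intervalIntegral.integral_mono_on hab (Continuous.intervalIntegrable (by fun_prop) _ _)
      (Continuous.intervalIntegrable (by fun_prop) _ _) fun x hx => ?_
    have h3 : φ3 x * ‖z x‖ ^ 2 ≤ C * ‖z x‖ ^ 2 := by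
      gcongr; exact (le_abs_self _).trans (W.le3 x hx)
    have h1 : -φ1 x * ‖z1 x‖ ^ 2 ≤ -c * ‖z1 x‖ ^ 2 + (C + c) * m := by
      have hC := W.C_pos; have hc := W.c_pos
      by_cases hs : x ∈ Icc A B
      · have : -φ1 x * ‖z1 x‖ ^ 2 ≤ -c * ‖z1 x‖ ^ 2 := by
          gcongr; exact W.ge1 x hs
        have : 0 ≤ (C + c) * m := by positivity
        linarith
      · have hx' : x ∈ Icc a A ∪ Icc B b := by
          by_cases h : x < A
          · exact Or.inl ⟨hx.1, h.le⟩
          · exact Or.inr ⟨(not_le.1 fun h' => hs ⟨not_lt.1 h, h'⟩).le, hx.2⟩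
        have h1 : -φ1 x * ‖z1 x‖ ^ 2 ≤ C * ‖z1 x‖ ^ 2 := by
          gcongr; exact (neg_le_abs _).trans (W.le1 x hx)
        have h2 : (C + c) * ‖z1 x‖ ^ 2 ≤ (C + c) * m := by gcongr; exact hm x hx'
        linarith
    linarith
  rw [intervalIntegral.integral_neg, e3] at e4
  rw [e2, e1]
  linarith

theorem Weight.energy_dq_le (W : Weight a b A B c C φ φ1 φ2 φ3) (hab : a ≤ b)
    {z z1 z2 z3 f : ℝ → ℂ} (j : Jet z z1 z2 z3) {h : ℝ} (hh : h ≠ 0) (hf : Continuous f) {m : ℝ}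
    (hm : ∀ x ∈ Icc a A ∪ Icc B b, ‖z1 x‖ ^ 2 ≤ m) (hm0 : 0 ≤ m) :
    ∫ x in a..b, φ x * (2 * inner ℝ (z x) (-z3 x + dq h f x)) ≤
      -2 * c * nsq a b z1 + 2 * C * nsq a b z + (3 * C + 3 * c) * (b - a) * m
        + (C + C ^ 2 / c) * nsq a b (avg h f) := by
  have c0 := j.cont0; have c1 := j.cont1
  have k0 := W.cont; have k1 := W.cont1
  have hC := W.C_pos; have hc := W.c_pos
  have cg := continuous_dq h hf
  have cG := continuous_avg h hf
  refine (W.energy_le hab j cg hm hm0).trans ?_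
  have e1 : ∫ x in a..b, (φ1 x * (2 * inner ℝ (z x) (avg h f x)) +
      φ x * (2 * (inner ℝ (z x) (dq h f x) + inner ℝ (z1 x) (avg h f x)))) = 0 := by
    rw [intervalIntegral.integral_eq_sub_of_hasDerivAt
      (fun x _ => (W.d0 x).mul (((j.d0 x).inner ℝ (hasDerivAt_avg hh hf x)).const_mul 2))
      (Continuous.intervalIntegrable (by fun_prop) _ _)]
    simp [W.la, W.lb]
  have e2 : (∫ x in a..b, φ x * (2 * inner ℝ (z x) (dq h f x))) =
      ∫ x in a..b, -(φ1 x * (2 * inner ℝ (z x) (avg h f x)) +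
        φ x * (2 * (inner ℝ (z1 x) (avg h f x)))) := by
    rw [← sub_eq_zero, ← intervalIntegral.integral_sub
      (Continuous.intervalIntegrable (by fun_prop) _ _)
      (Continuous.intervalIntegrable (by fun_prop) _ _), ← e1]
    refine intervalIntegral.integral_congr fun x _ => ?_
    ring
  have e3 : ∫ x in a..b, -(φ1 x * (2 * inner ℝ (z x) (avg h f x)) +
        φ x * (2 * (inner ℝ (z1 x) (avg h f x)))) ≤
      ∫ x in a..b, (C * ‖z x‖ ^ 2 + c * ‖z1 x‖ ^ 2 + (C + C ^ 2 / c) * ‖avg h f x‖ ^ 2) := by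
    refine intervalIntegral.integral_mono_on hab (Continuous.intervalIntegrable (by fun_prop) _ _)
      (Continuous.intervalIntegrable (by fun_prop) _ _) fun x hx => ?_
    have h1 : -(φ1 x * (2 * inner ℝ (z x) (avg h f x))) ≤
        C * (‖z x‖ ^ 2 + ‖avg h f x‖ ^ 2) := by
      have i1 := abs_real_inner_le_norm (z x) (avg h f x)
      calc -(φ1 x * (2 * inner ℝ (z x) (avg h f x))) ≤
            |φ1 x| * (2 * |inner ℝ (z x) (avg h f x)|) := by
            rw [← abs_two (α := ℝ), ← abs_mul, ← abs_mul, abs_two]; exact neg_le_abs _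
        _ ≤ C * (2 * (‖z x‖ * ‖avg h f x‖)) := by gcongr; exact W.le1 x hx
        _ ≤ _ := by gcongr; linarith [two_mul_le_add_sq ‖z x‖ ‖avg h f x‖]
    have h2 : -(φ x * (2 * inner ℝ (z1 x) (avg h f x))) ≤
        c * ‖z1 x‖ ^ 2 + C ^ 2 / c * ‖avg h f x‖ ^ 2 := by
      have i1 := abs_real_inner_le_norm (z1 x) (avg h f x)
      calc -(φ x * (2 * inner ℝ (z1 x) (avg h f x))) ≤
            φ x * (2 * |inner ℝ (z1 x) (avg h f x)|) := by
            have := neg_le_abs (inner ℝ (z1 x) (avg h f x))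
            have h0 := W.nonneg x hx
            nlinarith
        _ ≤ C * (2 * (‖z1 x‖ * ‖avg h f x‖)) := by gcongr; exact W.le x hx
        _ ≤ _ := by
          have : 0 ≤ c * (‖z1 x‖ - C / c * ‖avg h f x‖) ^ 2 := by positivity
          have e : c * (‖z1 x‖ - C / c * ‖avg h f x‖) ^ 2 = c * ‖z1 x‖ ^ 2 + C ^ 2 / c *
            ‖avg h f x‖ ^ 2 - C * (2 * (‖z1 x‖ * ‖avg h f x‖)) := by field_simp; ring
          linarith
    linarith
  rw [intervalIntegral.integral_add (Continuous.intervalIntegrable (by fun_prop) _ _)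
      (Continuous.intervalIntegrable (by fun_prop) _ _),
      intervalIntegral.integral_add (Continuous.intervalIntegrable (by fun_prop) _ _)
      (Continuous.intervalIntegrable (by fun_prop) _ _), intervalIntegral.integral_const_mul,
      intervalIntegral.integral_const_mul, intervalIntegral.integral_const_mul] at e3
  rw [e2]
  unfold nsq at *
  linarith

/-- Bounds of the squared norm by the weighted one. -/
theorem Weight.nsq_le (W : Weight a b A B c C φ φ1 φ2 φ3) (hab : a ≤ b) {f : ℝ → ℂ}
    (hf : Continuous f) {m : ℝ} (hm : ∀ x ∈ Icc a A ∪ Icc B b, ‖f x‖ ^ 2 ≤ m) (hm0 : 0 ≤ m) :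
    nsq a b f ≤ c⁻¹ * (∫ x in a..b, φ x * ‖f x‖ ^ 2) + (b - a) * m := by
  have k0 := W.cont; have hc := W.c_pos
  have : nsq a b f ≤ ∫ x in a..b, (c⁻¹ * (φ x * ‖f x‖ ^ 2) + m) := by
    refine intervalIntegral.integral_mono_on hab (Continuous.intervalIntegrable (by fun_prop) _ _)
      (Continuous.intervalIntegrable (by fun_prop) _ _) fun x hx => ?_
    by_cases hs : x ∈ Icc A B
    · have : ‖f x‖ ^ 2 ≤ c⁻¹ * (φ x * ‖f x‖ ^ 2) := by
        rw [← mul_assoc]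
        refine le_mul_of_one_le_left (by positivity) ?_
        rw [inv_mul_eq_div, one_le_div hc]; exact W.ge x hs
      linarith
    · have hx' : x ∈ Icc a A ∪ Icc B b := by
        by_cases h : x < A
        · exact Or.inl ⟨hx.1, h.le⟩
        · exact Or.inr ⟨(not_le.1 fun h' => hs ⟨not_lt.1 h, h'⟩).le, hx.2⟩
      have := W.nonneg x hx
      have h2 : 0 ≤ c⁻¹ * (φ x * ‖f x‖ ^ 2) := by positivity
      linarith [hm x hx']
  rwa [intervalIntegral.integral_add (Continuous.intervalIntegrable (by fun_prop) _ _)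
    (Continuous.intervalIntegrable (by fun_prop) _ _), intervalIntegral.integral_const_mul,
    intervalIntegral.integral_const, smul_eq_mul] at this

theorem Weight.energy_le_nsq (W : Weight a b A B c C φ φ1 φ2 φ3) (hab : a ≤ b) {f : ℝ → ℂ}
    (hf : Continuous f) : ∫ x in a..b, φ x * ‖f x‖ ^ 2 ≤ C * nsq a b f := by
  have k0 := W.cont
  unfold nsq
  rw [← intervalIntegral.integral_const_mul]
  refine intervalIntegral.integral_mono_on hab (Continuous.intervalIntegrable (by fun_prop) _ _)
      (Continuous.intervalIntegrable (by fun_prop) _ _) fun x hx => ?_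
  gcongr
  exact W.le x hx

theorem Weight.energy_nonneg (W : Weight a b A B c C φ φ1 φ2 φ3) (hab : a ≤ b) (f : ℝ → ℂ) :
    0 ≤ ∫ x in a..b, φ x * ‖f x‖ ^ 2 :=
  intervalIntegral.integral_nonneg hab fun x hx => mul_nonneg (W.nonneg x hx) (by positivity)

/-- Continuity in the step of the weighted energy of an average. -/
theorem tendsto_energy_avg {φ : ℝ → ℝ} (hφ : Continuous φ) {f : ℝ → ℂ} (hf : Continuous f)
    (a b : ℝ) : Tendsto (fun h => ∫ x in a..b, φ x * ‖avg h f x‖ ^ 2) (𝓝[>] 0)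
      (𝓝 (∫ x in a..b, φ x * ‖f x‖ ^ 2)) := by
  have h1 : Continuous fun p : ℝ × ℝ => avg p.1 f p.2 := by
    unfold avg
    apply intervalIntegral.continuous_parametric_intervalIntegral_of_continuous' (a₀ := 0)
    fun_prop
  have h2 : Continuous fun h => ∫ x in a..b, φ x * ‖avg h f x‖ ^ 2 := by
    apply intervalIntegral.continuous_parametric_intervalIntegral_of_continuous' (a₀ := a)
    exact (hφ.comp continuous_snd).mul (h1.norm.pow 2)
  have := (h2.tendsto 0).mono_left (nhdsWithin_le_nhds (s := Ioi 0))
  simpa [avg_zero] using this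

end EnergyInequalities

section Comparison

theorem le_linear_of_hasDerivAt {r r' : ℝ → ℝ} {s t C ρ : ℝ}
    (hd : ∀ x ∈ Icc s t, HasDerivAt r (r' x) x) (hC0 : 0 ≤ C)
    (hC : ∀ x ∈ Icc s t, r x ≤ ρ → r' x ≤ C) (hρ : r s + (C + 1) * (t - s) ≤ ρ) :
    ∀ x ∈ Icc s t, r x ≤ r s + (C + 1) * (x - s) := by
  refine image_le_of_deriv_right_lt_deriv_boundary' (f := r) (f' := r')
    (B := fun x => r s + (C + 1) * (x - s)) (B' := fun _ => C + 1)
    (fun x hx => (hd x hx).continuousAt.continuousWithinAt)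
    (fun x hx => (hd x (Ico_subset_Icc_self hx)).hasDerivWithinAt) (by simp)
    (by fun_prop) (fun x _ => ?_) (fun x hx he => ?_)
  · have := (((hasDerivAt_id x).sub_const s).const_mul (C + 1)).const_add (r s)
    simpa using this.hasDerivWithinAt
  · have : r' x ≤ C := hC x (Ico_subset_Icc_self hx) (by
      rw [he]
      have : x - s ≤ t - s := by linarith [hx.2]
      have := mul_le_mul_of_nonneg_left this (by linarith : 0 ≤ C + 1)
      linarith)
    linarith

theorem le_of_hasDerivAt_le {r r' : ℝ → ℝ} {s t C : ℝ} (hst : s ≤ t)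
    (hd : ∀ x ∈ Icc s t, HasDerivAt r (r' x) x) (hC : ∀ x ∈ Icc s t, r' x ≤ C) :
    r t ≤ r s + C * (t - s) := by
  have := Convex.image_sub_le_mul_sub_of_deriv_le (convex_Icc s t) (f := r) (C := C)
    (fun x hx => (hd x hx).continuousAt.continuousWithinAt)
    (fun x hx => (hd x (interior_subset hx)).differentiableAt.differentiableWithinAt)
    (fun x hx => by rw [(hd x (interior_subset hx)).deriv]; exact hC x (interior_subset hx))
    s ⟨le_rfl, hst⟩ t ⟨hst, le_rfl⟩ hst
  linarith

theorem lt_of_bootstrap {r : ℝ → ℝ} {s t ρ : ℝ} (hc : ContinuousOn r (Icc s t)) (hs : r s < ρ)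
    (hb : ∀ x ∈ Icc s t, (∀ u ∈ Icc s x, r u ≤ ρ) → r x < ρ) : ∀ x ∈ Icc s t, r x < ρ := by
  by_contra! hcon
  obtain ⟨x, hx, hrx⟩ := hcon
  set S := Icc s t ∩ {x | ρ ≤ r x} with hS
  have hSc : IsClosed S := hc.preimage_isClosed_of_isClosed isClosed_Icc isClosed_Ici
  have hSn : S.Nonempty := ⟨x, hx, hrx⟩
  have hSb : BddBelow S := ⟨s, fun y hy => hy.1.1⟩
  have hm := hSc.csInf_mem hSn hSb
  set m := sInf S with hmdef
  have hlt : ∀ u ∈ Ico s m, r u < ρ := fun u hu => by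
    by_contra! h
    exact absurd (csInf_le hSb (⟨⟨hu.1, hu.2.le.trans hm.1.2⟩, h⟩ : u ∈ S)) (not_le.2 hu.2)
  have hsm : s < m := lt_of_le_of_ne hm.1.1 (by
    intro h; exact absurd (h ▸ hm.2 : ρ ≤ r s) (not_le.2 hs))
  have hle : ∀ u ∈ Icc s m, r u ≤ ρ := by
    rw [← closure_Ico hsm.ne]
    intro u hu
    have hc' : ContinuousOn r (closure (Ico s m)) := by
      rw [closure_Ico hsm.ne]; exact hc.mono (Icc_subset_Icc_right hm.1.2)
    exact ContinuousWithinAt.closure_le hu ((hc' u hu).mono subset_closure)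
      continuousWithinAt_const (fun y hy => (hlt y hy).le)
  exact absurd (hb m hm.1 hle) (not_lt.2 hm.2)

end Comparison

section Equation

/-- The lower order part of the equation. -/
noncomputable def nl (κ d e : ℝ) (q r : ℂ) : ℂ :=
  -(κ * r) - d * (‖q‖ : ℂ) ^ 2 * r - e * q ^ 2 * (starRingEnd ℂ) r

theorem norm_nl_le (κ d e : ℝ) (q r : ℂ) :
    ‖nl κ d e q r‖ ≤ (|κ| + |d| + |e|) * (1 + ‖q‖ ^ 2) * ‖r‖ := by
  have h1 : ‖nl κ d e q r‖ ≤ |κ| * ‖r‖ + |d| * ‖q‖ ^ 2 * ‖r‖ + |e| * ‖q‖ ^ 2 * ‖r‖ := by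
    unfold nl
    refine (norm_sub_le _ _).trans (add_le_add ((norm_sub_le _ _).trans (add_le_add ?_ ?_)) ?_)
    all_goals simp
  refine h1.trans ?_
  have := norm_nonneg r
  have : 0 ≤ |κ| * ‖q‖ ^ 2 * ‖r‖ := by positivity
  have : 0 ≤ |d| * ‖r‖ := by positivity
  have : 0 ≤ |e| * ‖r‖ := by positivity
  linarith

theorem norm_nl_sub_le (κ d e : ℝ) (q r q' r' : ℂ) :
    ‖nl κ d e q r - nl κ d e q' r'‖ ≤ (|κ| + |d| + |e|) * ((1 + ‖q‖ ^ 2) * ‖r - r'‖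
      + (‖q‖ + ‖q'‖) * ‖q - q'‖ * ‖r'‖) := by
  have e1 : nl κ d e q r - nl κ d e q' r' = nl κ d e q (r - r')
      + (-(d * ((‖q‖ : ℂ) ^ 2 - (‖q'‖ : ℂ) ^ 2) * r')
        - e * ((q + q') * (q - q')) * (starRingEnd ℂ) r') := by
    simp only [nl, map_sub]; ring
  have e2 : ‖(‖q‖ : ℂ) ^ 2 - (‖q'‖ : ℂ) ^ 2‖ ≤ (‖q‖ + ‖q'‖) * ‖q - q'‖ := by
    have : (‖q‖ : ℂ) ^ 2 - (‖q'‖ : ℂ) ^ 2 = (((‖q‖ + ‖q'‖) * (‖q‖ - ‖q'‖) : ℝ) : ℂ) := by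
      push_cast; ring
    rw [this, Complex.norm_real, Real.norm_eq_abs, abs_mul, abs_of_nonneg (by positivity)]
    gcongr
    exact abs_norm_sub_norm_le q q'
  rw [e1]
  refine (norm_add_le _ _).trans ?_
  have h1 := norm_nl_le κ d e q (r - r')
  have h2 : ‖-(d * ((‖q‖ : ℂ) ^ 2 - (‖q'‖ : ℂ) ^ 2) * r')
      - e * ((q + q') * (q - q')) * (starRingEnd ℂ) r'‖
      ≤ |d| * ((‖q‖ + ‖q'‖) * ‖q - q'‖) * ‖r'‖ + |e| * ((‖q‖ + ‖q'‖) * ‖q - q'‖) * ‖r'‖ := by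
    refine (norm_sub_le _ _).trans (add_le_add ?_ ?_)
    · rw [norm_neg, norm_mul, norm_mul, Complex.norm_real, Real.norm_eq_abs]
      gcongr
    · rw [norm_mul, norm_mul, norm_mul, Complex.norm_real, Real.norm_eq_abs, RCLike.norm_conj]
      gcongr
      exact norm_add_le _ _
  have : 0 ≤ |κ| * ((‖q‖ + ‖q'‖) * ‖q - q'‖) * ‖r'‖ := by positivity
  linarith

theorem inner_nl (κ d e : ℝ) (q r : ℂ) :
    inner ℝ q (nl κ d e q r) = -κ * inner ℝ q r - (d + e) * ‖q‖ ^ 2 * inner ℝ q r := by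
  have h : ‖q‖ ^ 2 = q.re ^ 2 + q.im ^ 2 := by
    rw [← Complex.normSq_eq_norm_sq, Complex.normSq_apply]; ring
  have h' : ((‖q‖ : ℂ)) ^ 2 = ((q.re ^ 2 + q.im ^ 2 : ℝ) : ℂ) := by
    rw [← h]; push_cast; ring
  simp only [nl, h', h, Complex.inner]
  simp [pow_two]
  ring

theorem Continuous.nl (κ d e : ℝ) {q r : ℝ → ℂ} (hq : Continuous q) (hr : Continuous r) :
    Continuous fun x => nl κ d e (q x) (r x) := by
  unfold _root_.nl
  have := Complex.continuous_conj.comp hr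
  simp only [Function.comp_def] at this
  fun_prop

theorem hasDerivAt_flux {q q1 : ℝ → ℂ} (hd : ∀ x, HasDerivAt q (q1 x) x) (κ d e x : ℝ) :
    HasDerivAt (fun x => -κ * ‖q x‖ ^ 2 - (d + e) / 2 * (‖q x‖ ^ 2) ^ 2)
      (2 * inner ℝ (q x) (nl κ d e (q x) (q1 x))) x := by
  rw [inner_nl]
  have h := (hd x).norm_sq
  refine ((h.const_mul (-κ)).sub ((h.pow 2).const_mul ((d + e) / 2))).congr_deriv ?_
  push_cast
  ring

/-- A family `p` which is `C³` in space and `C¹` in time, separately, and satisfies the equation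
`pₜ = -pₓₓₓ + nl (p, pₓ)` wherever `pₓ` is jointly continuous. -/
structure SepSol (κ d e : ℝ) (p p1 p2 p3 pt : ℝ → ℝ → ℂ) : Prop where
  jet : ∀ t, Jet (p t) (p1 t) (p2 t) (p3 t)
  dt : ∀ x t, HasDerivAt (fun s => p s x) (pt t x) t
  ct : ∀ x, Continuous fun t => pt t x
  pde : ∀ t x, ContinuousAt (Function.uncurry p1) (t, x) →
    pt t x = -p3 t x + nl κ d e (p t x) (p1 t x)

/-- Times at which the equation holds on `[a, b]` and `p` is Lipschitz in `L²`. -/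
def GoodTime (a b : ℝ) (p p1 : ℝ → ℝ → ℂ) (t : ℝ) : Prop :=
  (∀ x ∈ Icc a b, ContinuousAt (Function.uncurry p1) (t, x)) ∧ LipAt a b p t

variable {κ d e : ℝ} {p p1 p2 p3 pt : ℝ → ℝ → ℂ}

theorem SepSol.cont (S : SepSol κ d e p p1 p2 p3 pt) (t : ℝ) : Continuous (p t) := (S.jet t).cont0

theorem SepSol.continuous_nl (S : SepSol κ d e p p1 p2 p3 pt) (t : ℝ) :
    Continuous fun x => nl κ d e (p t x) (p1 t x) :=
  Continuous.nl κ d e (S.jet t).cont0 (S.jet t).cont1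

theorem SepSol.hasDerivAt (S : SepSol κ d e p p1 p2 p3 pt) {a b t : ℝ}
    (hg : GoodTime a b p p1 t) {x : ℝ} (hx : x ∈ Icc a b) :
    HasDerivAt (fun s => p s x) (-p3 t x + nl κ d e (p t x) (p1 t x)) t := by
  rw [← S.pde t x (hg.1 x hx)]; exact S.dt x t

end Equation

section GapSetting

/-- The setting of the a priori estimates: a time interval of good times, strips along the sides
where everything is controlled by `n`, and an initial time whose derivatives are bounded by `n`. -/
structure GapData (κ d e a b A B σ n t1 t2 : ℝ) (p p1 p2 p3 pt : ℝ → ℝ → ℂ) : Prop where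
  sol : SepSol κ d e p p1 p2 p3 pt
  aA : a < A
  AB : A < B
  Bb : B < b
  σ_pos : 0 < σ
  time : t1 < t2
  one_le : 1 ≤ n
  good : ∀ t ∈ Ioo t1 t2, GoodTime a (b + 2 * σ) p p1 t
  s0 : ∀ t ∈ Icc t1 t2, ∀ x ∈ Icc a (A + 2 * σ) ∪ Icc B (b + 2 * σ), ‖p t x‖ ≤ n
  s1 : ∀ t ∈ Icc t1 t2, ∀ x ∈ Icc a (A + 2 * σ) ∪ Icc B (b + 2 * σ), ‖p1 t x‖ ≤ n
  s2 : ∀ t ∈ Icc t1 t2, ∀ x ∈ Icc a (A + 2 * σ) ∪ Icc B (b + 2 * σ), ‖p2 t x‖ ≤ n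
  s3 : ∀ t ∈ Icc t1 t2, ∀ x ∈ Icc a (A + 2 * σ) ∪ Icc B (b + 2 * σ), ‖p3 t x‖ ≤ n
  lip : ∀ t ∈ Icc t1 t2, ∀ x ∈ Icc a (A + 2 * σ) ∪ Icc B (b + 2 * σ),
    ‖p t x - p t1 x‖ ≤ n * (t - t1)
  i0 : ∀ x ∈ Icc a (b + 2 * σ), ‖p t1 x‖ ≤ n
  i1 : ∀ x ∈ Icc a (b + 2 * σ), ‖p1 t1 x‖ ≤ n
  i2 : ∀ x ∈ Icc a (b + 2 * σ), ‖p2 t1 x‖ ≤ n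
  i3 : ∀ x ∈ Icc a (b + 2 * σ), ‖p3 t1 x‖ ≤ n

variable {κ d e a b A B σ n t1 t2 c C : ℝ} {p p1 p2 p3 pt : ℝ → ℝ → ℂ} {φ φ1 φ2 φ3 : ℝ → ℝ}

theorem GapData.ab (G : GapData κ d e a b A B σ n t1 t2 p p1 p2 p3 pt) : a < b := by
  linarith [G.aA, G.AB, G.Bb]

theorem GapData.ab2 (G : GapData κ d e a b A B σ n t1 t2 p p1 p2 p3 pt) : a < b + 2 * σ := by
  linarith [G.ab, G.σ_pos]

theorem GapData.mem_left (G : GapData κ d e a b A B σ n t1 t2 p p1 p2 p3 pt) :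
    a ∈ Icc a (A + 2 * σ) ∪ Icc B (b + 2 * σ) :=
  Or.inl ⟨le_rfl, by linarith [G.aA, G.σ_pos]⟩

theorem GapData.mem_right (G : GapData κ d e a b A B σ n t1 t2 p p1 p2 p3 pt) :
    b + 2 * σ ∈ Icc a (A + 2 * σ) ∪ Icc B (b + 2 * σ) :=
  Or.inr ⟨by linarith [G.Bb, G.σ_pos], le_rfl⟩

/-- Averages with small positive steps based in the inner strips stay in the strips. -/
theorem GapData.strip_add (_G : GapData κ d e a b A B σ n t1 t2 p p1 p2 p3 pt) {x y : ℝ}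
    (hx : x ∈ Icc a A ∪ Icc B b) (hy : 0 ≤ y) (hyσ : y ≤ 2 * σ) :
    x + y ∈ Icc a (A + 2 * σ) ∪ Icc B (b + 2 * σ) := by
  rcases hx with hx | hx
  · exact Or.inl ⟨by linarith [hx.1], by linarith [hx.2]⟩
  · exact Or.inr ⟨by linarith [hx.1], by linarith [hx.2]⟩

theorem GapData.strip_of_inner (G : GapData κ d e a b A B σ n t1 t2 p p1 p2 p3 pt) {x : ℝ}
    (hx : x ∈ Icc a A ∪ Icc B b) : x ∈ Icc a (A + 2 * σ) ∪ Icc B (b + 2 * σ) := by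
  simpa using G.strip_add hx le_rfl (by linarith [G.σ_pos])

theorem GapData.strip_of_right (G : GapData κ d e a b A B σ n t1 t2 p p1 p2 p3 pt) {x : ℝ}
    (hx : x ∈ Icc b (b + 2 * σ)) : x ∈ Icc a (A + 2 * σ) ∪ Icc B (b + 2 * σ) :=
  Or.inr ⟨by linarith [hx.1, G.Bb], hx.2⟩

theorem nsq_extend_le {a b s M : ℝ} (hs : 0 ≤ s) {f : ℝ → ℂ} (hf : Continuous f)
    (hM : ∀ x ∈ Icc b (b + s), ‖f x‖ ^ 2 ≤ M) : nsq a (b + s) f ≤ nsq a b f + s * M := by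
  rw [nsq_add_interval (b := b) hf]
  have := nsq_le_of_bound (by linarith : b ≤ b + s) hf hM
  linarith

theorem GapData.exists_nsq_le (G : GapData κ d e a b A B σ n t1 t2 p p1 p2 p3 pt) :
    ∃ K, ∀ t ∈ Ioo t1 t2, nsq a (b + 2 * σ) (p t) ≤ K := by
  set b' := b + 2 * σ with hb'
  have hab := G.ab2.le
  set M : ℝ := 2 * (2 * n * n + n ^ 2 + (|κ| * n ^ 2 + |d + e| / 2 * (n ^ 2) ^ 2)) with hM
  have hn := G.one_le
  have hder : ∀ t ∈ Ioo t1 t2, ∃ D, HasDerivAt (fun s => nsq a b' (p s)) D t ∧ |D| ≤ M := by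
    intro t ht
    have j := G.sol.jet t
    have c0 := j.cont0; have c3 := j.c3; have cN := G.sol.continuous_nl t
    have h := (G.good t ht).2.hasDerivAt_energy hab (φ := fun _ => 1) continuous_const
      G.sol.cont (zt := fun x => -p3 t x + nl κ d e (p t x) (p1 t x)) (by fun_prop)
      (fun x hx => G.sol.hasDerivAt (G.good t ht) hx)
    simp only [one_mul] at h
    refine ⟨_, h, ?_⟩
    have e1 := j.integral_weight (φ := fun _ => 1) (φ1 := fun _ => 0) (φ2 := fun _ => 0)
      (φ3 := fun _ => 0) (fun x => hasDerivAt_const x 1) (fun x => hasDerivAt_const x 0)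
      (fun x => hasDerivAt_const x 0) continuous_const a b'
    simp only [one_mul, zero_mul, mul_zero, sub_zero, add_zero, intervalIntegral.integral_zero]
      at e1
    have e2 := intervalIntegral.integral_eq_sub_of_hasDerivAt (a := a) (b := b')
      (fun x _ => hasDerivAt_flux j.d0 κ d e x)
      (Continuous.intervalIntegrable (by fun_prop) _ _)
    have e3 : ∫ x in a..b', 2 * inner ℝ (p t x) (-p3 t x + nl κ d e (p t x) (p1 t x)) =
        (∫ x in a..b', 2 * inner ℝ (p t x) (nl κ d e (p t x) (p1 t x)))
          - ∫ x in a..b', 2 * inner ℝ (p t x) (p3 t x) := by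
      rw [← intervalIntegral.integral_sub (Continuous.intervalIntegrable (by fun_prop) _ _)
        (Continuous.intervalIntegrable (by fun_prop) _ _)]
      refine intervalIntegral.integral_congr fun x _ => ?_
      simp only [inner_add_right, inner_neg_right]; ring
    rw [e3, e2, e1]
    have key : ∀ x ∈ Icc a (A + 2 * σ) ∪ Icc B (b + 2 * σ),
        |(-κ * ‖p t x‖ ^ 2 - (d + e) / 2 * (‖p t x‖ ^ 2) ^ 2)
          - (2 * inner ℝ (p t x) (p2 t x) - ‖p1 t x‖ ^ 2)| ≤ M / 2 := by
      intro x hx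
      have ht' := Ioo_subset_Icc_self ht
      have k0 := G.s0 t ht' x hx
      have k1 := G.s1 t ht' x hx
      have k2 := G.s2 t ht' x hx
      have i1 : |inner ℝ (p t x) (p2 t x)| ≤ n * n :=
        (abs_real_inner_le_norm _ _).trans (by gcongr)
      have i2 : |κ * ‖p t x‖ ^ 2| ≤ |κ| * n ^ 2 := by
        rw [abs_mul, abs_of_nonneg (sq_nonneg ‖p t x‖)]; gcongr
      have i3 : |(d + e) / 2 * (‖p t x‖ ^ 2) ^ 2| ≤ |d + e| / 2 * (n ^ 2) ^ 2 := by
        rw [abs_mul, abs_div, abs_two, abs_of_nonneg (sq_nonneg (‖p t x‖ ^ 2))]; gcongr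
      have i4 : ‖p1 t x‖ ^ 2 ≤ n ^ 2 := by gcongr
      have i5 : 0 ≤ ‖p1 t x‖ ^ 2 := by positivity
      rw [abs_le] at i1 i2 i3 ⊢
      constructor <;> linarith [i1.1, i1.2, i2.1, i2.2, i3.1, i3.2]
    have k1 := key a G.mem_left
    have k2 := key b' G.mem_right
    rw [abs_le] at k1 k2 ⊢
    constructor <;> linarith [k1.1, k1.2, k2.1, k2.2]
  choose! D hD hDM using hder
  set m := (t1 + t2) / 2 with hm
  have hmm : m ∈ Ioo t1 t2 := ⟨by linarith [G.time], by linarith [G.time]⟩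
  refine ⟨nsq a b' (p m) + M * (t2 - t1), fun t ht => ?_⟩
  have := Convex.norm_image_sub_le_of_norm_hasDerivWithin_le (s := Ioo t1 t2)
    (f := fun s => nsq a b' (p s)) (f' := D) (C := M)
    (fun z hz => (hD z hz).hasDerivWithinAt) hDM (convex_Ioo t1 t2) hmm ht
  rw [Real.norm_eq_abs, Real.norm_eq_abs] at this
  have h1 := le_abs_self (nsq a b' (p t) - nsq a b' (p m))
  have hM0 : 0 ≤ M := by positivity
  have h2 : |t - m| ≤ t2 - t1 := abs_le.2 ⟨by linarith [ht.1, hmm.2], by linarith [ht.2, hmm.1]⟩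
  have := mul_le_mul_of_nonneg_left h2 hM0
  linarith

end GapSetting

section Qualitative

variable {κ d e a b A B σ n t1 t2 c C : ℝ} {p p1 p2 p3 pt : ℝ → ℝ → ℂ} {φ φ1 φ2 φ3 : ℝ → ℝ}

theorem sobolev_interval_young {a b x K θ : ℝ} (hab : a < b) {f f1 : ℝ → ℂ}
    (hd : ∀ x, HasDerivAt f (f1 x) x) (hc : Continuous f1) (hK : nsq a b f ≤ K) (hθ : 0 < θ)
    (hx : x ∈ Icc a b) : ‖f x‖ ^ 2 ≤ K / (b - a) + K / θ + θ * nsq a b f1 := by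
  have h := sobolev_interval hab hd hc hx
  have h2 := two_sqrt_mul_le (nsq_nonneg hab.le f) (nsq_nonneg hab.le f1) hθ
  have h3 : nsq a b f / (b - a) ≤ K / (b - a) :=
    div_le_div_of_nonneg_right hK (by linarith)
  have h4 : nsq a b f / θ ≤ K / θ := div_le_div_of_nonneg_right hK hθ.le
  linarith

theorem Weight.integral_nl_le (W : Weight a b A B c C φ φ1 φ2 φ3) (hab : a ≤ b) (κ d e : ℝ)
    {q q1 : ℝ → ℂ} (hd : ∀ x, HasDerivAt q (q1 x) x) (hc : Continuous q1) {S : ℝ}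
    (hS : ∀ x ∈ Icc a b, ‖q x‖ ^ 2 ≤ S) :
    ∫ x in a..b, φ x * (2 * inner ℝ (q x) (nl κ d e (q x) (q1 x))) ≤
      C * (|κ| + |d + e| / 2 * S) * nsq a b q := by
  have cq : Continuous q := continuous_iff_continuousAt.2 fun x => (hd x).continuousAt
  have cφ := W.cont
  have cφ1 := W.cont1
  have cN := Continuous.nl κ d e cq hc
  have h1 := intervalIntegral.integral_eq_sub_of_hasDerivAt (a := a) (b := b)
    (fun x _ => (W.d0 x).mul (hasDerivAt_flux hd κ d e x))
    (Continuous.intervalIntegrable (by fun_prop) _ _)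
  simp only [W.la, W.lb, zero_mul, sub_zero, Pi.mul_apply] at h1
  rw [intervalIntegral.integral_add (Continuous.intervalIntegrable (by fun_prop) _ _)
    (Continuous.intervalIntegrable (by fun_prop) _ _)] at h1
  have h2 : -(∫ x in a..b, φ1 x * (-κ * ‖q x‖ ^ 2 - (d + e) / 2 * (‖q x‖ ^ 2) ^ 2)) ≤
      C * (|κ| + |d + e| / 2 * S) * nsq a b q := by
    rw [nsq, ← intervalIntegral.integral_const_mul, ← intervalIntegral.integral_neg]
    refine intervalIntegral.integral_mono_on hab (Continuous.intervalIntegrable (by fun_prop) _ _)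
      (Continuous.intervalIntegrable (by fun_prop) _ _) fun x hx => ?_
    have e1 : -(φ1 x * (-κ * ‖q x‖ ^ 2 - (d + e) / 2 * (‖q x‖ ^ 2) ^ 2)) =
      φ1 x * (κ + (d + e) / 2 * ‖q x‖ ^ 2) * ‖q x‖ ^ 2 := by ring
    rw [e1]
    refine mul_le_mul_of_nonneg_right ?_ (sq_nonneg _)
    refine (le_abs_self _).trans ?_
    rw [abs_mul]
    have hC := W.C_pos
    refine mul_le_mul (W.le1 x hx) ((abs_add_le _ _).trans (add_le_add le_rfl ?_))
      (abs_nonneg _) hC.le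
    rw [abs_mul, abs_div, abs_two, abs_of_nonneg (sq_nonneg ‖q x‖)]
    gcongr
    exact hS x hx
  linarith

theorem Weight.exists_integral_nl_le (W : Weight a b A B c C φ φ1 φ2 φ3) (hab : a < b)
    (κ d e : ℝ) {K0 : ℝ} (hK0 : 0 ≤ K0) : ∃ K, 0 ≤ K ∧ ∀ q q1 : ℝ → ℂ,
      (∀ x, HasDerivAt q (q1 x) x) → Continuous q1 → nsq a b q ≤ K0 →
      ∫ x in a..b, φ x * (2 * inner ℝ (q x) (nl κ d e (q x) (q1 x))) ≤ c * nsq a b q1 + K := by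
  have hC := W.C_pos
  have hc := W.c_pos
  have hba : 0 < b - a := by linarith
  set L := C * (|d + e| / 2) * K0 with hL
  have hL0 : 0 ≤ L := by positivity
  set θ := c / (L + 1) with hθ
  have hθ0 : 0 < θ := by positivity
  refine ⟨C * |κ| * K0 + L * (K0 / (b - a) + K0 / θ), by positivity, fun q q1 hd hc1 hq => ?_⟩
  have h := W.integral_nl_le hab.le κ d e hd hc1
    (fun x hx => sobolev_interval_young hab hd hc1 hq hθ0 hx)
  have hD := nsq_nonneg hab.le q1
  refine h.trans ?_
  have h2 : C * (|κ| + |d + e| / 2 * (K0 / (b - a) + K0 / θ + θ * nsq a b q1)) * nsq a b q ≤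
      C * (|κ| + |d + e| / 2 * (K0 / (b - a) + K0 / θ + θ * nsq a b q1)) * K0 := by
    gcongr
  have h3 : L * θ ≤ c := by
    rw [hθ, mul_div_assoc', div_le_iff₀ (by positivity)]
    nlinarith
  have h4 := mul_le_mul_of_nonneg_right h3 hD
  calc _ ≤ _ := h2
    _ = C * |κ| * K0 + L * (K0 / (b - a) + K0 / θ) + L * θ * nsq a b q1 := by rw [hL]; ring
    _ ≤ _ := by linarith

/-- The weighted energy of `p` dissipates the `L²` norm of `p1`. -/
theorem GapData.exists_energy_deriv_le (G : GapData κ d e a b A B σ n t1 t2 p p1 p2 p3 pt)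
    (W : Weight a b A B c C φ φ1 φ2 φ3) : ∃ K, ∀ t ∈ Ioo t1 t2, ∃ D,
      HasDerivAt (fun s => ∫ x in a..b, φ x * ‖p s x‖ ^ 2) D t ∧
      D ≤ -c * nsq a (b + 2 * σ) (p1 t) + K := by
  obtain ⟨K0, hK0⟩ := G.exists_nsq_le
  have hC := W.C_pos
  have hc := W.c_pos
  have hσ := G.σ_pos
  have hab := G.ab
  obtain ⟨K1, -, hK1⟩ := W.exists_integral_nl_le hab κ d e (le_max_right K0 0)
  refine ⟨C * max K0 0 + (3 * C + 3 * c) * (b - a) * n ^ 2 + K1 + c * (2 * σ * n ^ 2),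
    fun t ht => ?_⟩
  have j := G.sol.jet t
  have c0 := j.cont0; have c1 := j.cont1; have c3 := j.c3; have cN := G.sol.continuous_nl t
  have hgood := G.good t ht
  have ht' := Ioo_subset_Icc_self ht
  have hg2 := hgood.2.mono G.sol.cont le_rfl hab.le (by linarith)
  refine ⟨_, hg2.hasDerivAt_energy hab.le W.cont G.sol.cont
    (zt := fun x => -p3 t x + nl κ d e (p t x) (p1 t x)) (by fun_prop)
    (fun x hx => G.sol.hasDerivAt hgood ⟨hx.1, by linarith [hx.2]⟩), ?_⟩
  have hn0 : 0 ≤ n := by linarith [G.one_le]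
  have hE : nsq a b (p t) ≤ max K0 0 :=
    ((nsq_mono_interval le_rfl hab.le (by linarith) c0).trans (hK0 t ht)).trans (le_max_left _ _)
  have h1 := W.energy_le hab.le j cN (m := n ^ 2)
    (fun x hx => pow_le_pow_left₀ (norm_nonneg _) (G.s1 t ht' x (G.strip_of_inner hx)) 2)
    (by positivity)
  have h2 := hK1 _ _ j.d0 j.cont1 hE
  have h3 : nsq a (b + 2 * σ) (p1 t) ≤ nsq a b (p1 t) + 2 * σ * n ^ 2 :=
    nsq_extend_le (by linarith) c1 fun x hx =>
      pow_le_pow_left₀ (norm_nonneg _) (G.s1 t ht' x (G.strip_of_right hx)) 2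
  have h4 := mul_le_mul_of_nonneg_left h3 hc.le
  have h5 := mul_le_mul_of_nonneg_left hE hC.le
  have h6 := mul_nonneg hc.le (nsq_nonneg hab.le (p1 t))
  linarith

theorem exists_nsq_nl_le (hab : a < b) (κ d e : ℝ) {K0 : ℝ} (hK0 : 0 ≤ K0) :
    ∃ K, 0 ≤ K ∧ ∀ q q1 : ℝ → ℂ, (∀ x, HasDerivAt q (q1 x) x) → Continuous q1 →
      nsq a b q ≤ K0 →
      nsq a b (fun x => nl κ d e (q x) (q1 x)) ≤ K * (1 + nsq a b q1) ^ 2 := by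
  have hba : 0 < b - a := by linarith
  set L := |κ| + |d| + |e| with hL
  have hL0 : 0 ≤ L := by positivity
  set S := K0 / (b - a) with hS
  have hS0 : 0 ≤ S := by positivity
  refine ⟨L ^ 2 * (2 * (1 + S) ^ 2 + 8 * K0), by positivity,
    fun q q1 hd hc1 hq => ?_⟩
  have cq : Continuous q := continuous_iff_continuousAt.2 fun x => (hd x).continuousAt
  have cN := Continuous.nl κ d e cq hc1
  set D := nsq a b q1 with hD
  have hD0 : 0 ≤ D := nsq_nonneg hab.le q1
  have hpt : ∀ x ∈ Icc a b, ‖nl κ d e (q x) (q1 x)‖ ^ 2 ≤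
      (L ^ 2 * (2 * (1 + S) ^ 2 + 8 * K0) * (1 + D)) * ‖q1 x‖ ^ 2 := by
    intro x hx
    have h := sobolev_interval hab hd hc1 hx
    have h' : ‖q x‖ ^ 2 ≤ S + 2 * (√K0 * √D) := by
      refine h.trans ?_
      have := div_le_div_of_nonneg_right hq hba.le
      have := Real.sqrt_le_sqrt hq
      gcongr
    have h2 : (1 + ‖q x‖ ^ 2) ^ 2 ≤ (2 * (1 + S) ^ 2 + 8 * K0) * (1 + D) := by
      have e1 : (1 + ‖q x‖ ^ 2) ^ 2 ≤ (1 + S + 2 * (√K0 * √D)) ^ 2 := by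
        refine pow_le_pow_left₀ (by positivity) (by linarith) 2
      have e2 : (√K0 * √D) ^ 2 = K0 * D := by
        rw [mul_pow, Real.sq_sqrt hK0, Real.sq_sqrt hD0]
      have e3 : (1 + S + 2 * (√K0 * √D)) ^ 2 ≤ 2 * (1 + S) ^ 2 + 8 * (K0 * D) := by
        rw [← e2]; nlinarith [sq_nonneg (1 + S - 2 * (√K0 * √D))]
      have e4 : 0 ≤ (1 + S) ^ 2 * D := by positivity
      linarith
    have h3 := pow_le_pow_left₀ (norm_nonneg _) (norm_nl_le κ d e (q x) (q1 x)) 2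
    calc _ ≤ _ := h3
      _ = L ^ 2 * (1 + ‖q x‖ ^ 2) ^ 2 * ‖q1 x‖ ^ 2 := by ring
      _ ≤ L ^ 2 * ((2 * (1 + S) ^ 2 + 8 * K0) * (1 + D)) * ‖q1 x‖ ^ 2 := by gcongr
      _ = _ := by ring
  have h4 : nsq a b (fun x => nl κ d e (q x) (q1 x)) ≤
      (L ^ 2 * (2 * (1 + S) ^ 2 + 8 * K0) * (1 + D)) * D := by
    rw [nsq, hD, nsq, ← intervalIntegral.integral_const_mul]
    exact intervalIntegral.integral_mono_on hab.le
      (Continuous.intervalIntegrable (by fun_prop) _ _)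
      (Continuous.intervalIntegrable (by fun_prop) _ _) hpt
  refine h4.trans ?_
  have : 0 ≤ L ^ 2 * (2 * (1 + S) ^ 2 + 8 * K0) * (1 + D) := by positivity
  calc _ ≤ (L ^ 2 * (2 * (1 + S) ^ 2 + 8 * K0) * (1 + D)) * (1 + D) := by gcongr; linarith
    _ = _ := by ring

theorem Weight.integral_inner_le (W : Weight a b A B c C φ φ1 φ2 φ3) (hab : a ≤ b)
    {z f : ℝ → ℂ} (hz : Continuous z) (hf : Continuous f) :
    ∫ x in a..b, φ x * (2 * inner ℝ (z x) (f x)) ≤ 2 * C * (√(nsq a b z) * √(nsq a b f)) := by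
  have cφ := W.cont
  have h : ∫ x in a..b, φ x * (2 * inner ℝ (z x) (f x)) ≤
      ∫ x in a..b, 2 * C * (‖z x‖ * ‖f x‖) := by
    refine intervalIntegral.integral_mono_on hab (Continuous.intervalIntegrable (by fun_prop) _ _)
      (Continuous.intervalIntegrable (by fun_prop) _ _) fun x hx => ?_
    calc φ x * (2 * inner ℝ (z x) (f x)) ≤ φ x * (2 * (‖z x‖ * ‖f x‖)) := by
          gcongr
          · exact W.nonneg x hx
          · exact real_inner_le_norm _ _
      _ ≤ C * (2 * (‖z x‖ * ‖f x‖)) := by gcongr; exact W.le x hx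
      _ = _ := by ring
  rw [intervalIntegral.integral_const_mul] at h
  have := W.C_pos
  exact h.trans (by gcongr; exact integral_norm_mul_norm_le hab hz hf)

theorem GapData.jet_sub (G : GapData κ d e a b A B σ n t1 t2 p p1 p2 p3 pt) (t : ℝ) :
    Jet (fun x => p t x - p t1 x) (fun x => p1 t x - p1 t1 x) (fun x => p2 t x - p2 t1 x)
      (fun x => p3 t x - p3 t1 x) :=
  (G.sol.jet t).sub (G.sol.jet t1)

/-- The source term in the equation for `p t - p t1`. -/
noncomputable def source (κ d e : ℝ) (p p1 p3 : ℝ → ℝ → ℂ) (t1 t x : ℝ) : ℂ :=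
  nl κ d e (p t x) (p1 t x) - p3 t1 x

theorem GapData.continuous_source (G : GapData κ d e a b A B σ n t1 t2 p p1 p2 p3 pt) (t : ℝ) :
    Continuous (source κ d e p p1 p3 t1 t) :=
  (G.sol.continuous_nl t).sub (G.sol.jet t1).c3

theorem GapData.hasDerivAt_sub (G : GapData κ d e a b A B σ n t1 t2 p p1 p2 p3 pt) {t x : ℝ}
    (ht : t ∈ Ioo t1 t2) (hx : x ∈ Icc a (b + 2 * σ)) :
    HasDerivAt (fun s => p s x - p t1 x)
      (-(p3 t x - p3 t1 x) + source κ d e p p1 p3 t1 t x) t :=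
  ((G.sol.hasDerivAt (G.good t ht) hx).sub_const _).congr_deriv (by unfold source; ring)

theorem continuous_sub_initial (hp : ∀ t, Continuous (p t)) (t1 s : ℝ) :
    Continuous fun x => p s x - p t1 x := (hp s).sub (hp t1)

/-- The averaged differences grow at most like the dissipation, uniformly in the step. -/
theorem GapData.exists_energy_avg_deriv_le
    (G : GapData κ d e a b A B σ n t1 t2 p p1 p2 p3 pt)
    (W : Weight a b A B c C φ φ1 φ2 φ3) : ∃ K, 0 ≤ K ∧ ∀ ε ∈ Ioc 0 σ, ∀ t ∈ Ioo t1 t2, ∃ D,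
      HasDerivAt (fun s => ∫ x in a..b, φ x * ‖avg ε (fun y => p s y - p t1 y) x‖ ^ 2) D t ∧
      D ≤ K * (1 + nsq a (b + 2 * σ) (p1 t)) := by
  obtain ⟨K0, hK0⟩ := G.exists_nsq_le
  have hC := W.C_pos
  have hc := W.c_pos
  have hσ := G.σ_pos
  have hab := G.ab
  have hab2 := G.ab2
  have hn0 : 0 ≤ n := by linarith [G.one_le]
  have hba : 0 < b - a := by linarith
  set b' := b + 2 * σ with hb'
  obtain ⟨L, hL0, hL⟩ := exists_nsq_nl_le hab2 κ d e (le_max_right K0 0)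
  set N := n ^ 2 * (b' - a) with hN
  have hN0 : 0 ≤ N := mul_nonneg (by positivity) (by linarith)
  set E := 2 * max K0 0 + 2 * N with hE
  have hE0 : 0 ≤ E := by positivity
  refine ⟨C * E + (3 * C + 3 * c) * (b - a) * (2 * n) ^ 2 + 2 * C * (√E * √(2 * L + 2 * N)),
    by positivity, fun ε hε t ht => ?_⟩
  have cw := continuous_sub_initial G.sol.cont t1
  have cs := G.continuous_source t
  have j := G.jet_sub t
  have ja := j.avg hε.1.ne'
  have ht' := Ioo_subset_Icc_self ht
  have cwt : Continuous fun x => -(p3 t x - p3 t1 x) + source κ d e p p1 p3 t1 t x := by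
    have := j.c3; fun_prop
  have hlip : LipAt a b' (fun s x => p s x - p t1 x) t := (G.good t ht).2.sub_const _
  have hlipa := (hlip.mono cw le_rfl (by linarith [hε.1]) (by linarith [hε.2] : b + ε ≤ b')).avg cw
    hab.le hε.1.le
  refine ⟨_, hlipa.hasDerivAt_energy hab.le W.cont (fun s => continuous_avg ε (cw s))
    (continuous_avg ε cwt) (fun x hx => hlip.hasDerivAt_avg cw cwt
      (fun y hy => G.hasDerivAt_sub ht hy) hε.1 hx.1 (by linarith [hx.2, hε.2])), ?_⟩
  have e1 : ∀ x, avg ε (fun x => -(p3 t x - p3 t1 x) + source κ d e p p1 p3 t1 t x) x =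
      -avg ε (fun x => p3 t x - p3 t1 x) x + avg ε (source κ d e p p1 p3 t1 t) x := by
    intro x
    have := avg_sub (h := ε) cs j.c3 x
    rw [neg_add_eq_sub, ← this]
    congr 1; ext y; ring
  simp only [e1]
  have h1 := W.energy_le hab.le ja (continuous_avg ε cs) (m := (2 * n) ^ 2) (fun x hx =>
    pow_le_pow_left₀ (norm_nonneg _) (norm_avg_le fun r hr => by
      have hm := G.strip_add hx (y := ε * r) (mul_nonneg hε.1.le hr.1)
        (by nlinarith [hε.1, hε.2, hr.1, hr.2])
      have k1 := G.s1 t ht' _ hm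
      have k2 := G.i1 (x + ε * r) (by
        rcases hm with hm | hm
        · exact ⟨hm.1, by linarith [hm.2, G.AB, G.Bb]⟩
        · exact ⟨by linarith [hm.1, G.AB, G.aA], hm.2⟩)
      exact (norm_sub_le _ _).trans (by linarith)) 2) (by positivity)
  have hg : nsq a b' (p t1) ≤ N := nsq_le_of_bound hab2.le (G.sol.cont t1) fun x hx =>
    pow_le_pow_left₀ (norm_nonneg _) (G.i0 x hx) 2
  have hg3 : nsq a b' (p3 t1) ≤ N := nsq_le_of_bound hab2.le (G.sol.jet t1).c3 fun x hx =>
    pow_le_pow_left₀ (norm_nonneg _) (G.i3 x hx) 2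
  have hpt : nsq a b' (p t) ≤ max K0 0 := (hK0 t ht).trans (le_max_left _ _)
  have hw : nsq a b' (fun x => p t x - p t1 x) ≤ E := by
    have := nsq_sub_le hab2.le (G.sol.cont t) (G.sol.cont t1)
    linarith
  set D := nsq a b' (p1 t) with hD
  have hD0 : 0 ≤ D := nsq_nonneg hab2.le _
  have hf : nsq a b' (source κ d e p p1 p3 t1 t) ≤ (2 * L + 2 * N) * (1 + D) ^ 2 := by
    have e2 := nsq_sub_le hab2.le (G.sol.continuous_nl t) (G.sol.jet t1).c3
    have e3 := hL _ _ (G.sol.jet t).d0 (G.sol.jet t).cont1 hpt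
    have e4 : N * 1 ≤ N * (1 + D) ^ 2 := by gcongr; nlinarith
    unfold source
    linarith
  have havg : ∀ {f : ℝ → ℂ}, Continuous f → nsq a b (avg ε f) ≤ nsq a b' f := fun hf' =>
    (nsq_avg_le hab.le hε.1.le hf').trans (nsq_mono_interval le_rfl (by linarith [hε.1])
      (by linarith [hε.2]) hf')
  have hz := (havg (cw t)).trans hw
  have hfa := (havg cs).trans hf
  have h2 := W.integral_inner_le hab.le ja.cont0 (continuous_avg ε cs)
  have h3 : √(nsq a b (avg ε (fun x => p t x - p t1 x))) *
      √(nsq a b (avg ε (source κ d e p p1 p3 t1 t))) ≤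
      √E * (√(2 * L + 2 * N) * (1 + D)) := by
    refine mul_le_mul (Real.sqrt_le_sqrt hz) ?_ (Real.sqrt_nonneg _) (Real.sqrt_nonneg _)
    refine (Real.sqrt_le_sqrt hfa).trans ?_
    rw [Real.sqrt_mul (by positivity), Real.sqrt_sq (by positivity)]
  have h4 := mul_le_mul_of_nonneg_left h3 (by positivity : 0 ≤ 2 * C)
  have h5 := mul_le_mul_of_nonneg_left hz hC.le
  have h6 := mul_nonneg hc.le (nsq_nonneg hab.le (avg ε fun x => p1 t x - p1 t1 x))
  have h7 : 0 ≤ C * E * D := by positivity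
  have h8 : 0 ≤ (3 * C + 3 * c) * (b - a) * (2 * n) ^ 2 * D := by positivity
  linarith

theorem GapData.tendsto_energy_avg_initial
    (G : GapData κ d e a b A B σ n t1 t2 p p1 p2 p3 pt)
    (W : Weight a b A B c C φ φ1 φ2 φ3) {ε : ℝ} (hε : ε ∈ Ioc 0 σ) :
    Tendsto (fun s => ∫ x in a..b, φ x * ‖avg ε (fun y => p s y - p t1 y) x‖ ^ 2) (𝓝[>] t1)
      (𝓝 0) := by
  obtain ⟨K0, hK0⟩ := G.exists_nsq_le
  have hab := G.ab
  have hσ := G.σ_pos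
  have hC := W.C_pos
  have cw := continuous_sub_initial G.sol.cont t1
  have hev : ∀ᶠ s in 𝓝[>] t1, s ∈ Ioo t1 t2 := Ioo_mem_nhdsGT G.time
  have hI := tendsto_integral_norm_sub (l := 𝓝[>] t1) G.ab2.le (q := p) (q0 := p t1)
    (Eventually.of_forall fun s => G.sol.cont s) (G.sol.cont t1)
    (fun x _ => ((G.sol.dt x t1).continuousAt.tendsto).mono_left nhdsWithin_le_nhds)
    (hev.mono fun s hs => hK0 s hs)
  have hlim : Tendsto (fun s => C * ((∫ x in a..(b + 2 * σ), ‖p s x - p t1 x‖) / ε) ^ 2 * (b - a))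
      (𝓝[>] t1) (𝓝 0) := by
    have := (((hI.div_const ε).pow 2).const_mul C).mul_const (b - a)
    simpa using this
  refine squeeze_zero (fun s => W.energy_nonneg hab.le _) (fun s => ?_) hlim
  refine (W.energy_le_nsq hab.le (continuous_avg ε (cw s))).trans ?_
  rw [mul_assoc]
  gcongr
  refine nsq_le_of_bound hab.le (continuous_avg ε (cw s)) fun x hx => ?_
  refine pow_le_pow_left₀ (norm_nonneg _) ?_ 2
  rw [le_div_iff₀ hε.1]
  have h1 := mul_avg_eq_integral (h := ε) (f := fun y => p s y - p t1 y) x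
  have h2 : ‖avg ε (fun y => p s y - p t1 y) x‖ * ε =
      ‖∫ y in x..(x + ε), (p s y - p t1 y)‖ := by
    rw [← h1, norm_mul, Complex.norm_real, Real.norm_of_nonneg hε.1.le, mul_comm]
  rw [h2]
  refine (intervalIntegral.norm_integral_le_integral_norm (by linarith [hε.1])).trans ?_
  refine intervalIntegral.integral_mono_interval hx.1 (by linarith [hε.1])
    (by linarith [hx.2, hε.2]) (Eventually.of_forall fun y => norm_nonneg _)
    (Continuous.intervalIntegrable (cw s).norm _ _)

/-- The initial value is attained strongly in `L²`. -/
theorem GapData.tendsto_energy (G : GapData κ d e a b A B σ n t1 t2 p p1 p2 p3 pt)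
    (W : Weight a b A B c C φ φ1 φ2 φ3) :
    Tendsto (fun s => ∫ x in a..b, φ x * ‖p s x - p t1 x‖ ^ 2) (𝓝[>] t1) (𝓝 0) := by
  obtain ⟨K0, hK0⟩ := G.exists_nsq_le
  obtain ⟨K1, hK1⟩ := G.exists_energy_deriv_le W
  obtain ⟨K2, hK2, hY⟩ := G.exists_energy_avg_deriv_le W
  choose! Q' hQ' hQK using hK1
  have hab := G.ab
  have hσ := G.σ_pos
  have hC := W.C_pos
  have hc := W.c_pos
  have hev : Ioo t1 t2 ∈ 𝓝[>] t1 := Ioo_mem_nhdsGT G.time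
  set K3 := K2 + K2 * K1 / c with hK3
  set F : ℝ → ℝ := fun t => K2 / c * (∫ x in a..b, φ x * ‖p t x‖ ^ 2) - K3 * t with hF
  have hF' : ∀ t ∈ Ioo t1 t2, HasDerivAt F (K2 / c * Q' t - K3) t := fun t ht =>
    (((hQ' t ht).const_mul (K2 / c)).sub ((hasDerivAt_id t).const_mul K3)).congr_deriv
      (by rw [mul_one])
  have hFK : ∀ t ∈ Ioo t1 t2,
      K2 / c * Q' t - K3 ≤ -(K2 * (1 + nsq a (b + 2 * σ) (p1 t))) := fun t ht => by
    have h1 := mul_le_mul_of_nonneg_left (hQK t ht) (by positivity : 0 ≤ K2 / c)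
    have h2 : K2 / c * (-c * nsq a (b + 2 * σ) (p1 t) + K1) =
      -(K2 * nsq a (b + 2 * σ) (p1 t)) + K2 * K1 / c := by field_simp
    linarith
  have hsub : ∀ {s t}, s ∈ Ioo t1 t2 → t ∈ Ioo t1 t2 → Icc s t ⊆ Ioo t1 t2 :=
    fun hs ht x hx => ⟨hs.1.trans_le hx.1, hx.2.trans_lt ht.2⟩
  have hanti : AntitoneOn F (Ioo t1 t2) := fun s hs t ht hst => by
    have := le_of_hasDerivAt_le hst (C := 0) (fun x hx => hF' x (hsub hs ht hx)) fun x hx =>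
      (hFK x (hsub hs ht hx)).trans (neg_nonpos.2 (mul_nonneg hK2
        (add_nonneg zero_le_one (nsq_nonneg G.ab2.le _))))
    simpa using this
  have hbdd : BddAbove (F '' Ioo t1 t2) := by
    refine ⟨K2 / c * (C * K0) + |K3| * max |t1| |t2|, ?_⟩
    rintro _ ⟨t, ht, rfl⟩
    have h1 := W.energy_le_nsq hab.le (G.sol.cont t)
    have h2 : nsq a b (p t) ≤ K0 :=
      (nsq_mono_interval le_rfl hab.le (by linarith) (G.sol.cont t)).trans (hK0 t ht)
    have h3 : ∫ x in a..b, φ x * ‖p t x‖ ^ 2 ≤ C * K0 := h1.trans (by gcongr)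
    have h4 := mul_le_mul_of_nonneg_left h3 (by positivity : 0 ≤ K2 / c)
    have h5 : -(K3 * t) ≤ |K3| * max |t1| |t2| := by
      refine (neg_le_abs _).trans ?_
      rw [abs_mul]
      gcongr
      exact abs_le_max_abs_abs ht.1.le ht.2.le
    simp only [hF]; linarith
  have hlim := hanti.tendsto_nhdsWithin_Ioo_right (nonempty_Ioo.2 G.time) hbdd
  set L := sSup (F '' Ioo t1 t2) with hL
  have key : ∀ t ∈ Ioo t1 t2, ∫ x in a..b, φ x * ‖p t x - p t1 x‖ ^ 2 ≤ L - F t := by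
    intro t ht
    have hε : ∀ ε ∈ Ioc 0 σ,
        ∫ x in a..b, φ x * ‖avg ε (fun y => p t y - p t1 y) x‖ ^ 2 ≤ L - F t := by
      intro ε hε
      choose! Y' hY' hYK using hY ε hε
      have h1 : ∀ s ∈ Ioo t1 t, (∫ x in a..b, φ x * ‖avg ε (fun y => p t y - p t1 y) x‖ ^ 2)
          + F t ≤ (∫ x in a..b, φ x * ‖avg ε (fun y => p s y - p t1 y) x‖ ^ 2) + L := by
        intro s hs
        have hs' : s ∈ Ioo t1 t2 := ⟨hs.1, hs.2.trans ht.2⟩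
        have := le_of_hasDerivAt_le hs.2.le (C := 0)
          (fun x hx => (hY' x (hsub hs' ht hx)).add (hF' x (hsub hs' ht hx))) fun x hx => by
            linarith [hYK x (hsub hs' ht hx), hFK x (hsub hs' ht hx)]
        have h2 := le_csSup hbdd (mem_image_of_mem F hs')
        simp only [Pi.add_apply, zero_mul, add_zero] at this
        linarith
      have h2 := le_of_tendsto_of_tendsto tendsto_const_nhds
        ((G.tendsto_energy_avg_initial W hε).add_const L)
        (by filter_upwards [Ioo_mem_nhdsGT ht.1] with s hs using h1 s hs)
      linarith
    refine le_of_tendsto (tendsto_energy_avg W.cont (continuous_sub_initial G.sol.cont t1 t) a b) ?_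
    filter_upwards [Ioc_mem_nhdsGT hσ] with ε h using hε ε h
  refine squeeze_zero' (Eventually.of_forall fun s => W.energy_nonneg hab.le _)
    (by filter_upwards [hev] with t ht using key t ht) ?_
  simpa using (tendsto_const_nhds (x := L)).sub hlim

end Qualitative

section Quantitative

variable {κ d e a b A B σ n t1 t2 c C : ℝ} {p p1 p2 p3 pt : ℝ → ℝ → ℂ} {φ φ1 φ2 φ3 : ℝ → ℝ}

theorem norm_source_le {κ d e n : ℝ} (hn : 0 ≤ n) {q r g g1 g3 : ℂ} (hg : ‖g‖ ≤ n)
    (hg1 : ‖g1‖ ≤ n) (hg3 : ‖g3‖ ≤ n) :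
    ‖nl κ d e q r - g3‖ ≤ (|κ| + |d| + |e|) * ((1 + 2 * n ^ 2 + 2 * ‖q - g‖ ^ 2) * ‖r - g1‖
      + (2 * n + 1 + ‖q - g‖ ^ 2) * ‖q - g‖ * n) + ((|κ| + |d| + |e|) * (1 + n ^ 2) * n + n) := by
  have hq : ‖q‖ ≤ n + ‖q - g‖ := by
    have := norm_add_le g (q - g)
    rw [add_sub_cancel] at this
    linarith
  have hq2 : ‖q‖ ^ 2 ≤ 2 * n ^ 2 + 2 * ‖q - g‖ ^ 2 := by
    have := pow_le_pow_left₀ (norm_nonneg q) hq 2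
    nlinarith [sq_nonneg (n - ‖q - g‖)]
  have hq3 : ‖q‖ + ‖g‖ ≤ 2 * n + 1 + ‖q - g‖ ^ 2 := by
    nlinarith [sq_nonneg (‖q - g‖ - 1), norm_nonneg (q - g)]
  have h1 := norm_nl_sub_le κ d e q r g g1
  have h2 := norm_nl_le κ d e g g1
  have h3 : (|κ| + |d| + |e|) * (1 + ‖g‖ ^ 2) * ‖g1‖ ≤ (|κ| + |d| + |e|) * (1 + n ^ 2) * n := by
    gcongr
  have h4 : nl κ d e q r - g3 = (nl κ d e q r - nl κ d e g g1) + (nl κ d e g g1 - g3) := by ring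
  rw [h4]
  refine (norm_add_le _ _).trans (add_le_add (h1.trans ?_) ((norm_sub_le _ _).trans
    (add_le_add (h2.trans h3) hg3)))
  have : 1 + ‖q‖ ^ 2 ≤ 1 + 2 * n ^ 2 + 2 * ‖q - g‖ ^ 2 := by linarith
  gcongr

theorem absorb_product {c M β R P : ℝ} (hc : 0 < c) (hM : 0 ≤ M) (hβ : 0 ≤ β) (hR0 : 0 ≤ R)
    (hR1 : R ≤ 1) (hP0 : 0 ≤ P) (hE : R ^ 2 ≤ c / (2 * M + 1)) :
    M * (1 + (R ^ 2 * β + 2 * (R * P))) * (R * P) + M * (1 + (R ^ 2 * β + 2 * (R * P))) * R ^ 2 ≤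
      2 * c * P ^ 2 + (M * (3 + β) + M * (3 + β) / (c / (M * (3 + β) + 1))) * R := by
  have r2 : R ^ 2 ≤ R := by nlinarith
  have r2' : R ^ 2 ≤ 1 := r2.trans hR1
  have r4 : R ^ 4 ≤ R := by
    have : R ^ 4 = R ^ 2 * R ^ 2 := by ring
    have : R ^ 2 * R ^ 2 ≤ 1 * R ^ 2 := by gcongr
    linarith
  have hRP : 0 ≤ R * P := mul_nonneg hR0 hP0
  have h6 : (1 + (R ^ 2 * β + 2 * (R * P))) * (R * P) + (1 + (R ^ 2 * β + 2 * (R * P))) * R ^ 2 ≤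
      (3 + β) * (R * P) + (3 + β) * R + 2 * (R ^ 2 * P ^ 2) := by
    have q1 : β * (R * P) * R ^ 2 ≤ β * (R * P) * 1 := by gcongr
    have q2 : (R * P) * R ^ 2 ≤ (R * P) * 1 := by gcongr
    have q3 : β * R ^ 4 ≤ β * R := by gcongr
    linarith
  have h7 := mul_le_mul_of_nonneg_left h6 hM
  have h8 : 2 * M * (R ^ 2 * P ^ 2) ≤ c * P ^ 2 := by
    have h9 : 2 * M * R ^ 2 ≤ c := by
      rw [le_div_iff₀ (by positivity)] at hE
      have := sq_nonneg R
      linarith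
    have := mul_le_mul_of_nonneg_right h9 (sq_nonneg P)
    linarith
  set N := M * (3 + β) with hN
  have hN0 : 0 ≤ N := by positivity
  set θ := c / (N + 1) with hθ
  have hθ0 : 0 < θ := by positivity
  have h9 : N * (R * P) ≤ N / θ * R + c * P ^ 2 := by
    have y2 : N * θ ≤ c := by
      rw [hθ, mul_div_assoc', div_le_iff₀ (by positivity)]
      nlinarith
    have y1 : R * P ≤ R ^ 2 / θ + θ * P ^ 2 := by
      have : R ^ 2 / θ + θ * P ^ 2 - 2 * (R * P) = (R - θ * P) ^ 2 / θ := by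
        field_simp; ring
      have : 0 ≤ (R - θ * P) ^ 2 / θ := by positivity
      linarith
    have y3 : R ^ 2 / θ ≤ R / θ := by gcongr
    calc N * (R * P) ≤ N * (R / θ + θ * P ^ 2) := by gcongr; linarith
      _ = N / θ * R + N * θ * P ^ 2 := by ring
      _ ≤ _ := by gcongr
  linarith

theorem Weight.exists_integral_source_le (W : Weight a b A B c C φ φ1 φ2 φ3) (hab : a < b)
    (κ d e : ℝ) {n : ℝ} (hn : 0 ≤ n) : ∃ K η, 0 ≤ K ∧ 0 < η ∧ η ≤ 1 ∧
      ∀ q q1 g g1 g3 : ℝ → ℂ, (∀ x, HasDerivAt q (q1 x) x) → Continuous q1 →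
      (∀ x, HasDerivAt g (g1 x) x) → Continuous g1 → Continuous g3 →
      (∀ x ∈ Icc a b, ‖g x‖ ≤ n) → (∀ x ∈ Icc a b, ‖g1 x‖ ≤ n) → (∀ x ∈ Icc a b, ‖g3 x‖ ≤ n) →
      nsq a b (fun x => q x - g x) ≤ η →
      ∫ x in a..b, φ x * (2 * inner ℝ (q x - g x) (nl κ d e (q x) (q1 x) - g3 x)) ≤
        2 * c * nsq a b (fun x => q1 x - g1 x) + K * √(nsq a b (fun x => q x - g x)) := by
  have hC := W.C_pos
  have hc := W.c_pos
  have hba : 0 < b - a := by linarith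
  set Λ := |κ| + |d| + |e| with hΛ
  have hΛ0 : 0 ≤ Λ := by positivity
  set k := Λ * (1 + n ^ 2) * n + n with hk
  have hk0 : 0 ≤ k := by positivity
  set m0 := 3 + 2 * n ^ 2 + (2 * n + 2) * n with hm0
  have hm00 : 0 ≤ m0 := by positivity
  set M := 2 * C * Λ * m0 with hM
  have hM0 : 0 ≤ M := by positivity
  set β := (b - a)⁻¹ with hβ
  have hβ0 : 0 < β := by positivity
  set η := min 1 (c / (2 * M + 1)) with hη
  have hη0 : 0 < η := lt_min one_pos (by positivity)
  refine ⟨2 * C * k * √(b - a) + (M * (3 + β) + M * (3 + β) / (c / (M * (3 + β) + 1))), η, by positivity, hη0,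
    min_le_left _ _, fun q q1 g g1 g3 hq cq1 hg cg1 cg3 bg bg1 bg3 hE => ?_⟩
  have cq : Continuous q := continuous_iff_continuousAt.2 fun x => (hq x).continuousAt
  have cg : Continuous g := continuous_iff_continuousAt.2 fun x => (hg x).continuousAt
  have cφ := W.cont
  have cN := Continuous.nl κ d e cq cq1
  set E := nsq a b (fun x => q x - g x) with hEdef
  set D := nsq a b (fun x => q1 x - g1 x) with hDdef
  have hE0 : 0 ≤ E := nsq_nonneg hab.le _
  have hD0 : 0 ≤ D := nsq_nonneg hab.le _
  set R := √E with hR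
  set P := √D with hP
  have hR0 : 0 ≤ R := Real.sqrt_nonneg _
  have hP0 : 0 ≤ P := Real.sqrt_nonneg _
  have hRE : R ^ 2 = E := Real.sq_sqrt hE0
  have hPD : P ^ 2 = D := Real.sq_sqrt hD0
  have hR1 : R ≤ 1 := by
    rw [← Real.sqrt_one]; exact Real.sqrt_le_sqrt (hE.trans (min_le_left _ _))
  set S := E / (b - a) + 2 * (R * P) with hS
  have hS0 : 0 ≤ S := by positivity
  have hsup : ∀ x ∈ Icc a b, ‖q x - g x‖ ^ 2 ≤ S := fun x hx =>
    sobolev_interval hab (fun x => (hq x).sub (hg x)) (cq1.sub cg1) hx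
  have hpt : ∀ x ∈ Icc a b, φ x * (2 * inner ℝ (q x - g x) (nl κ d e (q x) (q1 x) - g3 x)) ≤
      M * (1 + S) * (‖q x - g x‖ * ‖q1 x - g1 x‖) + M * (1 + S) * ‖q x - g x‖ ^ 2
        + 2 * C * k * (‖q x - g x‖ * ‖(1 : ℂ)‖) := by
    intro x hx
    have h1 := norm_source_le (κ := κ) (d := d) (e := e) hn (q := q x) (r := q1 x)
      (bg x hx) (bg1 x hx) (bg3 x hx)
    have h2 := hsup x hx
    set X := ‖q x - g x‖ with hX
    set Y := ‖q1 x - g1 x‖ with hY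
    have hX0 : 0 ≤ X := norm_nonneg _
    have hY0 : 0 ≤ Y := norm_nonneg _
    have h3 : φ x * (2 * inner ℝ (q x - g x) (nl κ d e (q x) (q1 x) - g3 x)) ≤
        C * (2 * (X * (Λ * ((1 + 2 * n ^ 2 + 2 * X ^ 2) * Y + (2 * n + 1 + X ^ 2) * X * n) + k))) := by
      refine (mul_le_mul_of_nonneg_left (mul_le_mul_of_nonneg_left
        ((real_inner_le_norm _ _).trans (mul_le_mul_of_nonneg_left h1 hX0)) zero_le_two)
        (W.nonneg x hx)).trans ?_
      gcongr
      exact W.le x hx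
    refine h3.trans ?_
    rw [norm_one, mul_one]
    have h4 : 1 + 2 * n ^ 2 + 2 * X ^ 2 ≤ m0 * (1 + S) := by
      have : 0 ≤ 2 * n ^ 2 * S + (2 * n + 2) * n * (1 + S) := by positivity
      linarith
    have h5 : (2 * n + 1 + X ^ 2) * n ≤ m0 * (1 + S) := by
      have : 0 ≤ (3 + 2 * n ^ 2) * (1 + S) + (2 * n + 1) * n * S + n := by positivity
      have := mul_le_mul_of_nonneg_right h2 hn
      linarith
    have h6 := mul_le_mul_of_nonneg_right h4 (mul_nonneg hX0 hY0)
    have h7 := mul_le_mul_of_nonneg_right h5 (sq_nonneg X)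
    calc _ = 2 * C * Λ * ((1 + 2 * n ^ 2 + 2 * X ^ 2) * (X * Y) + (2 * n + 1 + X ^ 2) * n * X ^ 2)
          + 2 * C * k * X := by ring
      _ ≤ 2 * C * Λ * (m0 * (1 + S) * (X * Y) + m0 * (1 + S) * X ^ 2) + 2 * C * k * X := by
          gcongr
      _ = _ := by rw [hM]; ring
  have c1 : Continuous fun _ : ℝ => (1 : ℂ) := continuous_const
  have h1 : ∫ x in a..b, φ x * (2 * inner ℝ (q x - g x) (nl κ d e (q x) (q1 x) - g3 x)) ≤
      M * (1 + S) * (∫ x in a..b, ‖q x - g x‖ * ‖q1 x - g1 x‖) + M * (1 + S) * E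
        + 2 * C * k * ∫ x in a..b, ‖q x - g x‖ * ‖(1 : ℂ)‖ := by
    rw [hEdef, nsq, ← intervalIntegral.integral_const_mul, ← intervalIntegral.integral_const_mul,
      ← intervalIntegral.integral_const_mul, ← intervalIntegral.integral_add
        (Continuous.intervalIntegrable (by fun_prop) _ _)
        (Continuous.intervalIntegrable (by fun_prop) _ _), ← intervalIntegral.integral_add
        (Continuous.intervalIntegrable (by fun_prop) _ _)
        (Continuous.intervalIntegrable (by fun_prop) _ _)]
    exact intervalIntegral.integral_mono_on hab.le (Continuous.intervalIntegrable (by fun_prop) _ _)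
      (Continuous.intervalIntegrable (by fun_prop) _ _) hpt
  have h2 : ∫ x in a..b, ‖q x - g x‖ * ‖q1 x - g1 x‖ ≤ R * P :=
    integral_norm_mul_norm_le hab.le (cq.sub cg) (cq1.sub cg1)
  have h3 : ∫ x in a..b, ‖q x - g x‖ * ‖(1 : ℂ)‖ ≤ R * √(b - a) := by
    have := integral_norm_mul_norm_le hab.le (cq.sub cg) c1
    have e1 : nsq a b (fun _ => (1 : ℂ)) = b - a := by simp [nsq]
    rwa [e1] at this
  have h4 : M * (1 + S) * (∫ x in a..b, ‖q x - g x‖ * ‖q1 x - g1 x‖) ≤ M * (1 + S) * (R * P) := by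
    gcongr
  have h5 : 2 * C * k * (∫ x in a..b, ‖q x - g x‖ * ‖(1 : ℂ)‖) ≤ 2 * C * k * (R * √(b - a)) := by
    gcongr
  have hSR' : S = E * β + 2 * (R * P) := by rw [hS, hβ, div_eq_mul_inv]
  have h6 := absorb_product hc hM0 hβ0.le hR0 hR1 hP0
    (by rw [hRE]; exact hE.trans (min_le_right _ _))
  rw [hRE, hPD, ← hSR'] at h6
  linarith

theorem GapData.mem_of_strip (G : GapData κ d e a b A B σ n t1 t2 p p1 p2 p3 pt) {x : ℝ}
    (hx : x ∈ Icc a (A + 2 * σ) ∪ Icc B (b + 2 * σ)) : x ∈ Icc a (b + 2 * σ) := by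
  rcases hx with hx | hx
  · exact ⟨hx.1, by linarith [hx.2, G.AB, G.Bb]⟩
  · exact ⟨by linarith [hx.1, G.AB, G.aA], hx.2⟩

theorem GapData.norm_sub2_le (G : GapData κ d e a b A B σ n t1 t2 p p1 p2 p3 pt) {t x : ℝ}
    (ht : t ∈ Icc t1 t2) (hx : x ∈ Icc a (A + 2 * σ) ∪ Icc B (b + 2 * σ)) :
    ‖p2 t x - p2 t1 x‖ ≤ 2 * n := by
  have := norm_sub_le (p2 t x) (p2 t1 x)
  have := G.s2 t ht x hx
  have := G.i2 x (G.mem_of_strip hx)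
  linarith

/-- On the strips the first derivative moves at most like the square root of time. -/
theorem GapData.norm_sub1_sq_le (G : GapData κ d e a b A B σ n t1 t2 p p1 p2 p3 pt) {t x : ℝ}
    (ht : t ∈ Ioc t1 t2) (hτ : t - t1 ≤ σ ^ 2)
    (hx : x ∈ Icc a (A + 2 * σ) ∪ Icc B (b + 2 * σ)) :
    ‖p1 t x - p1 t1 x‖ ^ 2 ≤ 16 * n ^ 2 * (t - t1) := by
  have hτ0 : 0 < t - t1 := by linarith [ht.1]
  have ht' := Ioc_subset_Icc_self ht
  have hl : 0 < √(t - t1) := Real.sqrt_pos.2 hτ0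
  have hlσ : √(t - t1) ≤ σ := by
    rw [← Real.sqrt_sq G.σ_pos.le]; exact Real.sqrt_le_sqrt hτ
  have hsq : √(t - t1) ^ 2 = t - t1 := Real.sq_sqrt hτ0.le
  have j := G.jet_sub t
  have key : ‖p1 t x - p1 t1 x‖ ≤ 2 * (n * (t - t1)) / √(t - t1) + √(t - t1) * (2 * n) := by
    rcases hx with hx | hx
    · exact norm_deriv_le_of_bounds j.d0 j.d1 (fun y hy => G.lip t ht' y (Or.inl hy))
        (fun y hy => G.norm_sub2_le ht' (Or.inl hy)) hl (by linarith [G.aA]) hx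
    · exact norm_deriv_le_of_bounds j.d0 j.d1 (fun y hy => G.lip t ht' y (Or.inr hy))
        (fun y hy => G.norm_sub2_le ht' (Or.inr hy)) hl (by linarith [G.Bb]) hx
  have e1 : 2 * (n * (t - t1)) / √(t - t1) + √(t - t1) * (2 * n) = 4 * n * √(t - t1) := by
    rw [div_add' _ _ _ hl.ne', div_eq_iff hl.ne']
    linear_combination (-2 * n) * hsq
  rw [e1] at key
  calc _ ≤ (4 * n * √(t - t1)) ^ 2 := pow_le_pow_left₀ (norm_nonneg _) key 2
    _ = _ := by rw [mul_pow, hsq]; ring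

theorem GapData.hasDerivAt_energy (G : GapData κ d e a b A B σ n t1 t2 p p1 p2 p3 pt)
    (hφ : Continuous φ) {t : ℝ} (ht : t ∈ Ioo t1 t2) :
    HasDerivAt (fun s => ∫ x in a..b, φ x * ‖p s x - p t1 x‖ ^ 2)
      (∫ x in a..b, φ x * (2 * inner ℝ (p t x - p t1 x)
        (-(p3 t x - p3 t1 x) + source κ d e p p1 p3 t1 t x))) t := by
  have hab2 : b ≤ b + 2 * σ := by linarith [G.σ_pos]
  have cs := G.continuous_source t
  have c3 := (G.jet_sub t).c3
  exact (((G.good t ht).2.sub_const (p t1)).mono (continuous_sub_initial G.sol.cont t1) le_rfl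
    G.ab.le hab2).hasDerivAt_energy G.ab.le hφ (continuous_sub_initial G.sol.cont t1)
    (zt := fun x => -(p3 t x - p3 t1 x) + source κ d e p p1 p3 t1 t x) (by fun_prop)
    (fun x hx => G.hasDerivAt_sub ht ⟨hx.1, hx.2.trans hab2⟩)

/-- Short time control of the weighted energy of `p t - p t1`, uniform over all solutions. -/
theorem Weight.exists_short_time_energy (W : Weight a b A B c C φ φ1 φ2 φ3) (hab : a < b)
    (hσ : 0 < σ) (hn : 1 ≤ n) (κ d e : ℝ) : ∃ K τ0, 0 ≤ K ∧ 0 < τ0 ∧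
      ∀ {t1 t2 : ℝ} {p p1 p2 p3 pt : ℝ → ℝ → ℂ},
      GapData κ d e a b A B σ n t1 t2 p p1 p2 p3 pt → ∀ t ∈ Ioo t1 t2, t - t1 < τ0 →
      ∫ x in a..b, φ x * ‖p t x - p t1 x‖ ^ 2 ≤ K * (t - t1) ^ 2 ∧
      nsq a b (fun x => p t x - p t1 x) ≤ K * (t - t1) ^ 2 ∧
      ∃ D, HasDerivAt (fun s => ∫ x in a..b, φ x * ‖p s x - p t1 x‖ ^ 2) D t ∧
        D ≤ -c * nsq a b (fun x => p1 t x - p1 t1 x) + K * (t - t1) := by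
  have hC := W.C_pos
  have hc := W.c_pos
  have hba : 0 < b - a := by linarith
  have hn0 : 0 ≤ n := by linarith
  obtain ⟨K1, η, hK1, hη, hη1, hsrc⟩ := W.exists_integral_source_le hab κ d e hn0
  set k := √(c⁻¹ + (b - a) * n ^ 2) with hk
  have hk2 : k ^ 2 = c⁻¹ + (b - a) * n ^ 2 := Real.sq_sqrt (by positivity)
  have hk0 : 0 ≤ k := Real.sqrt_nonneg _
  set K2 := (3 * C + 3 * c) * (b - a) * (16 * n ^ 2) with hK2
  have hK20 : 0 ≤ K2 := by positivity
  set K3 := ((C + K1) * k + (K2 + 2)) / 2 with hK3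
  have hK30 : 0 ≤ K3 := by positivity
  set ρ := √η / (k + 1) with hρ
  have hρ0 : 0 < ρ := div_pos (Real.sqrt_pos.2 hη) (by positivity)
  set τ0 := min (σ ^ 2) (ρ / (2 * (K3 + 1))) with hτ0
  have hτ00 : 0 < τ0 := lt_min (by positivity) (by positivity)
  refine ⟨(1 + k ^ 2) * (K3 + 1) ^ 2 + (C + K1) * k * (K3 + 1) + K2, τ0, by positivity, hτ00,
    fun {t1 t2 p p1 p2 p3 pt} G => ?_⟩
  set y : ℝ → ℝ := fun s => ∫ x in a..b, φ x * ‖p s x - p t1 x‖ ^ 2 with hy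
  have hy0 : ∀ s, 0 ≤ y s := fun s => W.energy_nonneg hab.le _
  set r : ℝ → ℝ := fun s => √(y s + (s - t1) ^ 2) with hr
  have hr2 : ∀ s, r s ^ 2 = y s + (s - t1) ^ 2 := fun s =>
    Real.sq_sqrt (add_nonneg (hy0 s) (sq_nonneg _))
  have hE : ∀ t ∈ Ioo t1 t2, nsq a b (fun x => p t x - p t1 x) ≤ k ^ 2 * r t ^ 2 := by
    intro t ht
    have h1 := W.nsq_le hab.le (continuous_sub_initial G.sol.cont t1 t) (m := (n * (t - t1)) ^ 2)
      (fun x hx => pow_le_pow_left₀ (norm_nonneg _)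
        (G.lip t (Ioo_subset_Icc_self ht) x (G.strip_of_inner hx)) 2) (by positivity)
    rw [hk2, hr2]
    have : 0 ≤ c⁻¹ * (t - t1) ^ 2 := by positivity
    have : 0 ≤ (b - a) * n ^ 2 * y t := mul_nonneg (by positivity) (hy0 t)
    have e1 : ∫ x in a..b, φ x * ‖p t x - p t1 x‖ ^ 2 = y t := rfl
    rw [e1] at h1
    linarith
  have hder : ∀ t ∈ Ioo t1 t2, t - t1 < τ0 → ∃ D, HasDerivAt y D t ∧ (r t ≤ ρ →
      D ≤ -c * nsq a b (fun x => p1 t x - p1 t1 x) + (C + K1) * k * r t + K2 * (t - t1)) := by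
    intro t ht hτ
    have hτp : 0 < t - t1 := by linarith [ht.1]
    refine ⟨_, G.hasDerivAt_energy W.cont ht, fun hrρ => ?_⟩
    have hEη : nsq a b (fun x => p t x - p t1 x) ≤ η := by
      refine (hE t ht).trans ?_
      rw [← mul_pow, ← Real.sq_sqrt hη.le]
      refine pow_le_pow_left₀ (mul_nonneg hk0 (Real.sqrt_nonneg _)) ?_ 2
      have : (k + 1) * ρ = √η := by rw [hρ]; field_simp
      nlinarith [Real.sqrt_nonneg (y t + (t - t1) ^ 2)]
    have hE0 := nsq_nonneg hab.le (fun x => p t x - p t1 x)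
    have hsq : √(nsq a b (fun x => p t x - p t1 x)) ≤ k * r t := by
      rw [← Real.sqrt_sq (mul_nonneg hk0 (Real.sqrt_nonneg _)), mul_pow]
      exact Real.sqrt_le_sqrt (hE t ht)
    have hEs : nsq a b (fun x => p t x - p t1 x) ≤ √(nsq a b (fun x => p t x - p t1 x)) := by
      rw [Real.le_sqrt hE0 hE0]
      nlinarith
    have h1 := W.energy_le hab.le (G.jet_sub t) (G.continuous_source t)
      (m := 16 * n ^ 2 * (t - t1)) (fun x hx => G.norm_sub1_sq_le ⟨ht.1, ht.2.le⟩
        (hτ.le.trans (min_le_left _ _)) (G.strip_of_inner hx)) (by positivity)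
    have j := G.sol.jet t
    have j1 := G.sol.jet t1
    have hin : ∀ x ∈ Icc a b, x ∈ Icc a (b + 2 * σ) := fun x hx => ⟨hx.1, by linarith [hx.2]⟩
    have h2 := hsrc _ _ _ _ _ j.d0 j.cont1 j1.d0 j1.cont1 j1.c3 (fun x hx => G.i0 x (hin x hx))
      (fun x hx => G.i1 x (hin x hx)) (fun x hx => G.i3 x (hin x hx)) hEη
    have h3 := mul_le_mul_of_nonneg_left (hEs.trans hsq) hC.le
    have h4 := mul_le_mul_of_nonneg_left hsq hK1
    unfold source at h1 ⊢
    linarith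
  have hrd : ∀ t ∈ Ioo t1 t2, t - t1 < τ0 → ∃ D, HasDerivAt r D t ∧ (r t ≤ ρ → D ≤ K3) := by
    intro t ht hτ
    have hτp : 0 < t - t1 := by linarith [ht.1]
    obtain ⟨D, hD, hDle⟩ := hder t ht hτ
    have hpos : 0 < y t + (t - t1) ^ 2 := add_pos_of_nonneg_of_pos (hy0 t) (by positivity)
    have hrpos : 0 < r t := Real.sqrt_pos.2 hpos
    have hτr : t - t1 ≤ r t := Real.le_sqrt_of_sq_le (by linarith [hy0 t])
    refine ⟨_, (hD.add (((hasDerivAt_id t).sub_const t1).pow 2)).sqrt hpos.ne', fun hrρ => ?_⟩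
    have hDle := hDle hrρ
    change _ / (2 * r t) ≤ _
    rw [div_le_iff₀ (by positivity), hK3]
    have h1 := mul_nonneg hc.le (nsq_nonneg hab.le (fun x => p1 t x - p1 t1 x))
    have h2 := mul_le_mul_of_nonneg_left hτr (by positivity : 0 ≤ K2 + 2)
    simp only [id]
    norm_num
    linarith
  choose! r' hr' hrK using hrd
  have hρτ : (K3 + 1) * τ0 ≤ ρ / 2 := by
    have : τ0 ≤ ρ / (2 * (K3 + 1)) := min_le_right _ _
    rw [le_div_iff₀ (by positivity)] at this
    linarith
  have hrlin : ∀ t ∈ Ioo t1 t2, t - t1 < τ0 → r t ≤ (K3 + 1) * (t - t1) := by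
    intro t ht hτ
    have hlim : Tendsto r (𝓝[>] t1) (𝓝 0) := by
      have h1 : Tendsto (fun s => (s - t1) ^ 2) (𝓝[>] t1) (𝓝 0) := by
        have : Tendsto (fun s : ℝ => (s - t1) ^ 2) (𝓝 t1) (𝓝 ((t1 - t1) ^ 2)) :=
          Continuous.tendsto (by fun_prop) t1
        rw [sub_self, zero_pow two_ne_zero] at this
        exact this.mono_left nhdsWithin_le_nhds
      simpa using ((G.tendsto_energy W).add h1).sqrt
    have hev : ∀ᶠ s in 𝓝[>] t1, r t ≤ r s + (K3 + 1) * (t - t1) := by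
      filter_upwards [Ioo_mem_nhdsGT ht.1, hlim.eventually_lt_const (half_pos hρ0)] with s hs hsρ
      have hsub : ∀ x ∈ Icc s t, x ∈ Ioo t1 t2 ∧ x - t1 < τ0 := fun x hx =>
        ⟨⟨hs.1.trans_le hx.1, hx.2.trans_lt ht.2⟩, by linarith [hx.2]⟩
      have hst : (K3 + 1) * (t - s) ≤ (K3 + 1) * (t - t1) := by
        gcongr; exact hs.1.le
      have hst2 : (K3 + 1) * (t - t1) ≤ (K3 + 1) * τ0 := by gcongr
      have := le_linear_of_hasDerivAt (ρ := ρ)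
        (fun x hx => hr' x (hsub x hx).1 (hsub x hx).2) hK30
        (fun x hx => hrK x (hsub x hx).1 (hsub x hx).2) (by linarith) t ⟨hs.2.le, le_rfl⟩
      linarith
    have := ge_of_tendsto (hlim.add_const ((K3 + 1) * (t - t1))) hev
    simpa using this
  intro t ht hτ
  have hτp : 0 < t - t1 := by linarith [ht.1]
  have h1 := hrlin t ht hτ
  have hr0 : 0 ≤ r t := Real.sqrt_nonneg _
  have h2 : r t ^ 2 ≤ (K3 + 1) ^ 2 * (t - t1) ^ 2 := by
    rw [← mul_pow]; exact pow_le_pow_left₀ hr0 h1 2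
  have hrρ : r t ≤ ρ := by
    have : (K3 + 1) * (t - t1) ≤ (K3 + 1) * τ0 := by gcongr
    linarith
  have hp : 0 ≤ k ^ 2 * (K3 + 1) ^ 2 * (t - t1) ^ 2 := by positivity
  have hp' : 0 ≤ (K3 + 1) ^ 2 * (t - t1) ^ 2 := by positivity
  have hq : 0 ≤ ((C + K1) * k * (K3 + 1) + K2) * (t - t1) ^ 2 := by positivity
  refine ⟨?_, ?_, ?_⟩
  · have := hr2 t
    have : y t ≤ r t ^ 2 := by linarith [sq_nonneg (t - t1)]
    change y t ≤ _
    linarith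
  · have h3 := mul_le_mul_of_nonneg_left h2 (sq_nonneg k)
    linarith [hE t ht]
  · obtain ⟨D, hD, hDle⟩ := hder t ht hτ
    refine ⟨D, hD, (hDle hrρ).trans ?_⟩
    have h3 := mul_le_mul_of_nonneg_left h1 (by positivity : 0 ≤ (C + K1) * k)
    have h4 : 0 ≤ (1 + k ^ 2) * (K3 + 1) ^ 2 * (t - t1) := by positivity
    linarith

end Quantitative

section DerivativeControl

variable {κ d e a b A B σ n t1 t2 c C : ℝ} {p p1 p2 p3 pt : ℝ → ℝ → ℂ} {φ φ1 φ2 φ3 : ℝ → ℝ}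

theorem frequently_le_of_dissipation {y D : ℝ → ℝ} {t1 T c K δ : ℝ} (hT : t1 < T) (hc : 0 < c)
    (hy0 : ∀ s, 0 ≤ y s) (hy : Tendsto y (𝓝[>] t1) (𝓝 0))
    (hd : ∀ t ∈ Ioo t1 T, ∃ y', HasDerivAt y y' t ∧ y' ≤ -c * D t + K * (t - t1)) (hδ : 0 < δ) :
    ∃ᶠ s in 𝓝[>] t1, D s ≤ δ := by
  intro hcon
  choose! y' hy' hyK using hd
  have hcδ : 0 < c * δ / 2 := by positivity
  have hlim : Tendsto (fun t => K * (t - t1)) (𝓝[>] t1) (𝓝 0) := by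
    have : Tendsto (fun t : ℝ => K * (t - t1)) (𝓝 t1) (𝓝 (K * (t1 - t1))) :=
      Continuous.tendsto (by fun_prop) t1
    rw [sub_self, mul_zero] at this
    exact this.mono_left nhdsWithin_le_nhds
  obtain ⟨T', hT', hsub⟩ := (mem_nhdsGT_iff_exists_Ioo_subset).1
    (inter_mem (inter_mem hcon (hlim.eventually_lt_const hcδ)) (Ioo_mem_nhdsGT hT))
  have hT1 : t1 < T' := hT'
  set m := (t1 + T') / 2 with hm
  have hm1 : t1 < m := by linarith
  have hm2 : m < T' := by linarith
  have key : ∀ s ∈ Ioo t1 m, y m ≤ y s + -(c * δ / 2) * (m - s) := by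
    intro s hs
    have hin : ∀ x ∈ Icc s m, x ∈ Ioo t1 T' := fun x hx =>
      ⟨hs.1.trans_le hx.1, hx.2.trans_lt hm2⟩
    refine le_of_hasDerivAt_le hs.2.le (fun x hx => hy' x (hsub (hin x hx)).2) fun x hx => ?_
    obtain ⟨⟨h1, h2⟩, h3⟩ := hsub (hin x hx)
    have h1 : δ < D x := not_le.1 h1
    have h2 : K * (x - t1) < c * δ / 2 := h2
    have := mul_lt_mul_of_pos_left h1 hc
    linarith [hyK x h3]
  have hl2 : Tendsto (fun s => y s + -(c * δ / 2) * (m - s)) (𝓝[>] t1)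
      (𝓝 (0 + -(c * δ / 2) * (m - t1))) := by
    refine hy.add (Tendsto.mono_left ?_ nhdsWithin_le_nhds)
    exact Continuous.tendsto (by fun_prop) t1
  have h := ge_of_tendsto hl2 (by filter_upwards [Ioo_mem_nhdsGT hm1] with s hs using key s hs)
  have : 0 < c * δ / 2 * (m - t1) := mul_pos hcδ (by linarith)
  linarith [hy0 m]

theorem continuousAt_energy {F : ℝ → ℝ → ℂ} {t : ℝ} (hab : a ≤ b) (hφ : Continuous φ)
    (hF : ∀ s, Continuous (F s))
    (hj : ∀ x ∈ Icc a b, ContinuousAt (Function.uncurry F) (t, x)) :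
    ContinuousAt (fun s => ∫ x in a..b, φ x * ‖F s x‖ ^ 2) t := by
  obtain ⟨M, hM⟩ := (isCompact_Icc (a := a) (b := b)).exists_bound_of_continuousOn
    (hF t).continuousOn
  have hev : ∀ᶠ s in 𝓝 t, ∀ x ∈ Icc a b, ‖F s x - F t x‖ < 1 := by
    refine (isCompact_Icc).eventually_forall_of_forall_eventually
      (P := fun s x => ‖F s x - F t x‖ < 1) fun x hx => ?_
    have h1 : ContinuousAt (fun z : ℝ × ℝ => ‖F z.1 z.2 - F t z.2‖) (t, x) :=
      ((hj x hx).sub (((hF t).comp continuous_snd).continuousAt)).norm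
    have h2 : Tendsto (fun z : ℝ × ℝ => ‖F z.1 z.2 - F t z.2‖) (𝓝 (t, x)) (𝓝 0) := by
      simpa [ContinuousAt] using h1
    exact h2.eventually_lt_const one_pos
  refine intervalIntegral.tendsto_integral_filter_of_dominated_convergence
    (fun x => |φ x| * (M + 1) ^ 2)
    (Eventually.of_forall fun s => Continuous.aestronglyMeasurable
      (by have := hF s; fun_prop)) ?_
    (Continuous.intervalIntegrable (by fun_prop) _ _) ?_
  · filter_upwards [hev] with s hs
    refine Eventually.of_forall fun x hx => ?_
    rw [uIoc_of_le hab] at hx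
    have hx' := Ioc_subset_Icc_self hx
    rw [norm_mul, norm_pow, norm_norm, Real.norm_eq_abs]
    gcongr
    have h1 := norm_add_le (F t x) (F s x - F t x)
    rw [add_sub_cancel] at h1
    linarith [hM x hx', hs x hx']
  · refine Eventually.of_forall fun x hx => ?_
    rw [uIoc_of_le hab] at hx
    have h1 : Tendsto (fun s => F s x) (𝓝 t) (𝓝 (F t x)) :=
      (hj x (Ioc_subset_Icc_self hx)).tendsto.comp
        (Continuous.tendsto (f := fun s : ℝ => (s, x)) (by fun_prop) t)
    exact (h1.norm.pow 2).const_mul _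

theorem le_add_of_tendsto_of_hasDerivAt_le {Y : ℝ → ℝ → ℝ} {r : ℝ → ℝ} {s t K σ : ℝ}
    (hst : s ≤ t) (hσ : 0 < σ) (hY : ∀ u, Tendsto (fun h => Y h u) (𝓝[>] 0) (𝓝 (r u)))
    (hd : ∀ h ∈ Ioc 0 σ, ∀ u ∈ Icc s t, ∃ D, HasDerivAt (Y h) D u ∧ D ≤ K) :
    r t ≤ r s + K * (t - s) := by
  refine le_of_tendsto_of_tendsto (hY t) ((hY s).add_const _) ?_
  filter_upwards [Ioc_mem_nhdsGT hσ] with h hh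
  choose! D hD hDK using hd h hh
  exact le_of_hasDerivAt_le hst hD hDK

theorem hasDerivAt_dq_family {h t x : ℝ} {z : ℝ → ℝ → ℂ} {zt : ℝ → ℂ}
    (h1 : HasDerivAt (fun s => z s x) (zt x) t)
    (h2 : HasDerivAt (fun s => z s (x + h)) (zt (x + h)) t) :
    HasDerivAt (fun s => dq h (z s) x) (dq h zt x) t :=
  (h2.sub h1).div_const _

theorem LipAt.hasDerivAt_energy_dq {h t : ℝ} {z : ℝ → ℝ → ℂ} {zt : ℝ → ℂ} (hab : a ≤ b)
    (hh : 0 < h) (hφ : Continuous φ) (hz : ∀ s, Continuous (z s)) (hzt : Continuous zt)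
    (H : LipAt a (b + h) z t)
    (hd : ∀ x ∈ Icc a (b + h), HasDerivAt (fun s => z s x) (zt x) t) :
    HasDerivAt (fun s => ∫ x in a..b, φ x * ‖_root_.dq h (z s) x‖ ^ 2)
      (∫ x in a..b, φ x * (2 * inner ℝ (_root_.dq h (z t) x) (_root_.dq h zt x))) t :=
  (H.dq hz hab hh).hasDerivAt_energy hab hφ (fun s => continuous_dq h (hz s))
    (continuous_dq h hzt) fun x hx => hasDerivAt_dq_family
      (hd x ⟨hx.1, by linarith [hx.2]⟩) (hd (x + h) ⟨by linarith [hx.1], by linarith [hx.2]⟩)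

theorem dq_neg_add (h : ℝ) (f g : ℝ → ℂ) (x : ℝ) :
    dq h (fun y => -f y + g y) x = -dq h f x + dq h g x := by
  unfold dq; ring

theorem GapData.nsq_initial_le (G : GapData κ d e a b A B σ n t1 t2 p p1 p2 p3 pt) {f : ℝ → ℂ}
    (hf : Continuous f) (hb : ∀ x ∈ Icc a (b + 2 * σ), ‖f x‖ ≤ n) :
    nsq a (b + 2 * σ) f ≤ n ^ 2 * (b + 2 * σ - a) :=
  nsq_le_of_bound G.ab2.le hf fun x hx => pow_le_pow_left₀ (norm_nonneg _) (hb x hx) 2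

theorem nsq_le_of_nsq_sub_le {a b K N : ℝ} (hab : a ≤ b) {f g : ℝ → ℂ} (hf : Continuous f)
    (hg : Continuous g) (h1 : nsq a b (fun x => f x - g x) ≤ K) (h2 : nsq a b g ≤ N) :
    nsq a b f ≤ 2 * K + 2 * N := by
  have h := nsq_add_le hab (hf.sub hg) hg
  have e1 : (fun x => (f - g) x + g x) = f := by ext x; simp
  rw [e1] at h
  have : nsq a b (f - g) = nsq a b (fun x => f x - g x) := rfl
  linarith

theorem GapData.nsq_sub_extend_le (G : GapData κ d e a b A B σ n t1 t2 p p1 p2 p3 pt) {t : ℝ}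
    (ht : t ∈ Icc t1 t2) :
    nsq a (b + 2 * σ) (fun x => p t x - p t1 x) ≤ nsq a b (fun x => p t x - p t1 x)
      + 2 * σ * (2 * n) ^ 2 ∧
    nsq a (b + 2 * σ) (fun x => p1 t x - p1 t1 x) ≤ nsq a b (fun x => p1 t x - p1 t1 x)
      + 2 * σ * (2 * n) ^ 2 := by
  have hσ := G.σ_pos
  have j := G.jet_sub t
  refine ⟨nsq_extend_le (by linarith) j.cont0 fun x hx => ?_,
    nsq_extend_le (by linarith) j.cont1 fun x hx => ?_⟩
  · have hx' := G.strip_of_right hx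
    refine pow_le_pow_left₀ (norm_nonneg _) ((norm_sub_le _ _).trans ?_) 2
    linarith [G.s0 t ht x hx', G.i0 x (G.mem_of_strip hx')]
  · have hx' := G.strip_of_right hx
    refine pow_le_pow_left₀ (norm_nonneg _) ((norm_sub_le _ _).trans ?_) 2
    linarith [G.s1 t ht x hx', G.i1 x (G.mem_of_strip hx')]

/-- While `p` stays close to its initial value in `H¹`, the energy of the difference quotients
dissipates, uniformly in the step. -/
theorem Weight.exists_energy_dq_deriv_le (W : Weight a b A B c C φ φ1 φ2 φ3) (hab : a < b)
    (hσ : 0 < σ) (hn : 1 ≤ n) (κ d e : ℝ) : ∃ K, 0 ≤ K ∧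
      ∀ {t1 t2 : ℝ} {p p1 p2 p3 pt : ℝ → ℝ → ℂ},
      GapData κ d e a b A B σ n t1 t2 p p1 p2 p3 pt → ∀ h ∈ Ioc 0 σ, ∀ t ∈ Ioo t1 t2,
      nsq a b (fun x => p t x - p t1 x) ≤ 1 → nsq a b (fun x => p1 t x - p1 t1 x) ≤ 1 →
      ∃ D, HasDerivAt (fun s => ∫ x in a..b, φ x * ‖dq h (fun x => p s x - p t1 x) x‖ ^ 2) D t ∧
        D ≤ -2 * c * nsq a b (dq h (fun x => p1 t x - p1 t1 x)) + K := by
  have hC := W.C_pos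
  have hc := W.c_pos
  have hn0 : 0 ≤ n := by linarith
  have hba : 0 < b - a := by linarith
  have hab2 : a < b + 2 * σ := by linarith
  set N := n ^ 2 * (b + 2 * σ - a) with hN
  have hN0 : 0 ≤ N := mul_nonneg (by positivity) (by linarith)
  set K0 := 1 + 2 * σ * (2 * n) ^ 2 with hK0
  have hK00 : 0 ≤ K0 := by positivity
  obtain ⟨L, hL0, hL⟩ := exists_nsq_nl_le hab2 κ d e (by positivity : 0 ≤ 2 * K0 + 2 * N)
  refine ⟨2 * C * K0 + (3 * C + 3 * c) * (b - a) * (2 * n) ^ 2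
    + (C + C ^ 2 / c) * (2 * (L * (1 + (2 * K0 + 2 * N)) ^ 2) + 2 * N), by positivity,
    fun {t1 t2 p p1 p2 p3 pt} G h hh t ht h0 h1 => ?_⟩
  have ht' := Ioo_subset_Icc_self ht
  have cw := continuous_sub_initial G.sol.cont t1
  have cs := G.continuous_source t
  have j := G.jet_sub t
  have hlip : LipAt a (b + 2 * σ) (fun s x => p s x - p t1 x) t := (G.good t ht).2.sub_const _
  have hbσ : b + h ≤ b + 2 * σ := by linarith [hh.2]
  have c3 := j.c3
  refine ⟨_, LipAt.hasDerivAt_energy_dq hab.le hh.1 W.cont cw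
    (zt := fun x => -(p3 t x - p3 t1 x) + source κ d e p p1 p3 t1 t x) (by fun_prop)
    (hlip.mono cw le_rfl (by linarith [hh.1]) hbσ)
    (fun x hx => G.hasDerivAt_sub ht ⟨hx.1, hx.2.trans hbσ⟩), ?_⟩
  simp only [dq_neg_add]
  have hm : ∀ x ∈ Icc a A ∪ Icc B b, ‖dq h (fun x => p1 t x - p1 t1 x) x‖ ^ 2 ≤ (2 * n) ^ 2 := by
    intro x hx
    rw [← avg_eq_dq hh.1.ne' j.d1 j.cont2]
    refine pow_le_pow_left₀ (norm_nonneg _) (norm_avg_le fun r hr => ?_) 2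
    exact G.norm_sub2_le ht' (G.strip_add hx (mul_nonneg hh.1.le hr.1)
      (by nlinarith [hh.1, hh.2, hr.1, hr.2]))
  have e1 := W.energy_dq_le hab.le (j.dq h) hh.1.ne' cs hm (by positivity)
  obtain ⟨w0, w1⟩ := G.nsq_sub_extend_le ht'
  have havg : ∀ {f : ℝ → ℂ}, Continuous f → nsq a b (avg h f) ≤ nsq a (b + 2 * σ) f := fun hf' =>
    (nsq_avg_le hab.le hh.1.le hf').trans (nsq_mono_interval le_rfl (by linarith [hh.1])
      (by linarith [hh.2]) hf')
  have e2 : nsq a b (dq h (fun x => p t x - p t1 x)) ≤ K0 := by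
    rw [← avg_eq_dq hh.1.ne' j.d0 j.cont1]
    exact (havg j.cont1).trans (by linarith)
  have j0 := G.sol.jet t
  have ji := G.sol.jet t1
  have e3 := nsq_le_of_nsq_sub_le G.ab2.le j0.cont0 ji.cont0 (w0.trans (by linarith : _ ≤ K0))
    (G.nsq_initial_le ji.cont0 G.i0)
  have e4 := nsq_le_of_nsq_sub_le G.ab2.le j0.cont1 ji.cont1 (w1.trans (by linarith : _ ≤ K0))
    (G.nsq_initial_le ji.cont1 G.i1)
  have e5 : nsq a (b + 2 * σ) (source κ d e p p1 p3 t1 t) ≤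
      2 * (L * (1 + (2 * K0 + 2 * N)) ^ 2) + 2 * N := by
    have f1 := nsq_sub_le G.ab2.le (G.sol.continuous_nl t) ji.c3
    have f2 := hL _ _ j0.d0 j0.cont1 e3
    have f3 : L * (1 + nsq a (b + 2 * σ) (p1 t)) ^ 2 ≤ L * (1 + (2 * K0 + 2 * N)) ^ 2 := by
      have := nsq_nonneg G.ab2.le (p1 t)
      gcongr
    have f4 := G.nsq_initial_le ji.c3 G.i3
    unfold source
    linarith
  have e6 := mul_le_mul_of_nonneg_left ((havg cs).trans e5) (by positivity : 0 ≤ C + C ^ 2 / c)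
  have e7 := mul_le_mul_of_nonneg_left e2 hC.le
  linarith

end DerivativeControl

section DerivativeSmallness

variable {κ d e a b A B σ n t1 t2 c C : ℝ} {p p1 p2 p3 pt : ℝ → ℝ → ℂ} {φ φ1 φ2 φ3 : ℝ → ℝ}

theorem tendsto_energy_dq {f f1 : ℝ → ℂ} (hφ : Continuous φ) (hd : ∀ x, HasDerivAt f (f1 x) x)
    (hc : Continuous f1) (a b : ℝ) :
    Tendsto (fun h => ∫ x in a..b, φ x * ‖dq h f x‖ ^ 2) (𝓝[>] 0)
      (𝓝 (∫ x in a..b, φ x * ‖f1 x‖ ^ 2)) := by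
  refine (tendsto_energy_avg hφ hc a b).congr' ?_
  filter_upwards [self_mem_nhdsWithin] with h hh
  rw [avg_eq_dq (ne_of_gt hh) hd hc]

theorem GapData.continuousAt_energy_sub1 (G : GapData κ d e a b A B σ n t1 t2 p p1 p2 p3 pt)
    (hφ : Continuous φ) {t : ℝ} (ht : t ∈ Ioo t1 t2) :
    ContinuousAt (fun s => ∫ x in a..b, φ x * ‖p1 s x - p1 t1 x‖ ^ 2) t := by
  have ci := (G.sol.jet t1).cont1
  refine continuousAt_energy (F := fun s x => p1 s x - p1 t1 x) G.ab.le hφ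
    (fun s => (G.sol.jet s).cont1.sub ci) fun x hx => ?_
  have h := (G.good t ht).1 x ⟨hx.1, by linarith [hx.2, G.σ_pos]⟩
  exact h.sub (ci.comp continuous_snd).continuousAt

theorem GapData.nsq_sub1_le (G : GapData κ d e a b A B σ n t1 t2 p p1 p2 p3 pt)
    (W : Weight a b A B c C φ φ1 φ2 φ3) {t : ℝ} (ht : t ∈ Ioo t1 t2) (hτ : t - t1 ≤ σ ^ 2) :
    nsq a b (fun x => p1 t x - p1 t1 x) ≤ c⁻¹ * (∫ x in a..b, φ x * ‖p1 t x - p1 t1 x‖ ^ 2)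
      + (b - a) * (16 * n ^ 2 * (t - t1)) :=
  W.nsq_le G.ab.le (G.jet_sub t).cont1
    (fun _ hx => G.norm_sub1_sq_le ⟨ht.1, ht.2.le⟩ hτ (G.strip_of_inner hx))
    (mul_nonneg (by positivity) (by linarith [ht.1]))

/-- The first derivative stays close to its initial value in `L²` for a short time. -/
theorem Weight.exists_nsq_sub1_le (W : Weight a b A B c C φ φ1 φ2 φ3) (hab : a < b)
    (hσ : 0 < σ) (hn : 1 ≤ n) (κ d e : ℝ) : ∃ K τ0, 0 ≤ K ∧ 0 < τ0 ∧
      ∀ {t1 t2 : ℝ} {p p1 p2 p3 pt : ℝ → ℝ → ℂ},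
      GapData κ d e a b A B σ n t1 t2 p p1 p2 p3 pt → ∀ t ∈ Ioo t1 t2, t - t1 < τ0 →
      nsq a b (fun x => p t x - p t1 x) ≤ K * (t - t1) ^ 2 ∧
      nsq a b (fun x => p1 t x - p1 t1 x) ≤ K * (t - t1) ∧
      nsq a b (fun x => p t x - p t1 x) ≤ 1 ∧ nsq a b (fun x => p1 t x - p1 t1 x) ≤ 1 := by
  have hC := W.C_pos
  have hc := W.c_pos
  have hba : 0 < b - a := by linarith
  have hn0 : 0 < n := by linarith
  obtain ⟨K1, τ1, hK1, hτ1, H1⟩ := W.exists_short_time_energy hab hσ hn κ d e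
  obtain ⟨K4, hK4, H4⟩ := W.exists_energy_dq_deriv_le hab hσ hn κ d e
  set Q := (b - a) * (16 * n ^ 2) with hQ
  have hQ0 : 0 < Q := by positivity
  set τ0 := min (min τ1 (σ ^ 2)) (min (min 1 (1 / (K1 + 1))) (min (c / 2 / (C + K4)) (1 / (2 * Q))))
    with hτ0
  have hτ0pos : 0 < τ0 := by
    refine lt_min (lt_min hτ1 (by positivity)) (lt_min (lt_min one_pos (by positivity))
      (lt_min (by positivity) (by positivity)))
  refine ⟨K1 + c⁻¹ * (C + K4) + Q, τ0, by positivity, hτ0pos,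
    fun {t1 t2 p p1 p2 p3 pt} G t ht htau => ?_⟩
  have small : ∀ u, u - t1 < τ0 → u - t1 < τ1 ∧ u - t1 ≤ σ ^ 2 ∧ u - t1 ≤ 1 ∧
      (K1 + 1) * (u - t1) ≤ 1 ∧ (C + K4) * (u - t1) < c / 2 ∧ Q * (u - t1) ≤ 1 / 2 := by
    intro u hu
    simp only [hτ0, lt_min_iff] at hu
    obtain ⟨⟨h1, h2⟩, ⟨h3, h4⟩, h5, h6⟩ := hu
    refine ⟨h1, h2.le, h3.le, ?_, ?_, ?_⟩
    · rw [lt_div_iff₀ (by positivity)] at h4; linarith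
    · rw [lt_div_iff₀ (by positivity)] at h5; linarith
    · rw [lt_div_iff₀ (by positivity)] at h6; linarith
  have low : ∀ u ∈ Ioo t1 t2, u - t1 < τ0 → nsq a b (fun x => p u x - p t1 x) ≤ 1 := by
    intro u hu hu0
    obtain ⟨h1, -, h3, h4, -⟩ := small u hu0
    refine (H1 G u hu h1).2.1.trans ?_
    have : 0 < u - t1 := by linarith [hu.1]
    nlinarith
  set Y : ℝ → ℝ := fun s => ∫ x in a..b, φ x * ‖p1 s x - p1 t1 x‖ ^ 2 with hY
  have hYle : ∀ u ∈ Ioo t1 t2, u - t1 < τ0 → nsq a b (fun x => p1 u x - p1 t1 x) ≤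
      c⁻¹ * Y u + Q * (u - t1) := by
    intro u hu hu0
    refine (G.nsq_sub1_le W hu (small u hu0).2.1).trans_eq ?_
    rw [hQ]; ring
  have one : ∀ u ∈ Ioo t1 t2, u - t1 < τ0 → Y u ≤ c / 2 →
      nsq a b (fun x => p1 u x - p1 t1 x) ≤ 1 := by
    intro u hu hu0 hyu
    have e1 := hYle u hu hu0
    have e2 := mul_le_mul_of_nonneg_left hyu (inv_nonneg.2 hc.le)
    have e3 : c⁻¹ * (c / 2) = 1 / 2 := by field_simp
    linarith [(small u hu0).2.2.2.2.2]
  have grow : ∀ s u, t1 < s → s ≤ u → u < t2 → u - t1 < τ0 → (∀ v ∈ Icc s u, Y v ≤ c / 2) →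
      Y u ≤ Y s + K4 * (u - s) := by
    intro s u hs hsu hu hu0 hbd
    refine le_add_of_tendsto_of_hasDerivAt_le (σ := σ)
      (Y := fun h s => ∫ x in a..b, φ x * ‖dq h (fun x => p s x - p t1 x) x‖ ^ 2) hsu hσ
      (fun v => tendsto_energy_dq W.cont (G.jet_sub v).d0 (G.jet_sub v).cont1 a b)
      fun h hh v hv => ?_
    have hv' : v ∈ Ioo t1 t2 := ⟨hs.trans_le hv.1, hv.2.trans_lt hu⟩
    have hv0 : v - t1 < τ0 := by linarith [hv.2]
    obtain ⟨D, hD, hDle⟩ := H4 G h hh v hv' (low v hv' hv0) (one v hv' hv0 (hbd v hv))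
    refine ⟨D, hD, hDle.trans ?_⟩
    have := mul_nonneg hc.le (nsq_nonneg hab.le (dq h (fun x => p1 v x - p1 t1 x)))
    linarith
  have hτ : 0 < t - t1 := by linarith [ht.1]
  obtain ⟨s, ⟨hs1, hst⟩, hs⟩ : ∃ s, s ∈ Ioo t1 t ∧
      nsq a b (fun x => p1 s x - p1 t1 x) ≤ t - t1 := by
    have hfr := frequently_le_of_dissipation (D := fun s => nsq a b (fun x => p1 s x - p1 t1 x))
      ht.1 hc
      (fun s => W.energy_nonneg hab.le (fun x => p s x - p t1 x)) (G.tendsto_energy W)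
      (fun u hu => (H1 G u ⟨hu.1, hu.2.trans ht.2⟩ ((small u (by linarith [hu.2])).1)).2.2) hτ
    obtain ⟨s, h1, h2⟩ := (hfr.and_eventually (Ioo_mem_nhdsGT ht.1)).exists
    exact ⟨s, h2, h1⟩
  have hYs : Y s ≤ C * (t - t1) := (W.energy_le_nsq hab.le (G.jet_sub s).cont1).trans
    (mul_le_mul_of_nonneg_left hs hC.le)
  have hsm := (small t htau).2.2.2.2.1
  have hK4τ : K4 * (t - t1) ≥ 0 := mul_nonneg hK4 hτ.le
  have hboot := lt_of_bootstrap (r := Y) (s := s) (t := t) (ρ := c / 2)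
    (fun u hu => (G.continuousAt_energy_sub1 W.cont
      ⟨hs1.trans_le hu.1, hu.2.trans_lt ht.2⟩).continuousWithinAt)
    (by linarith) (fun u hu hbd => by
      have := grow s u hs1 hu.1 (hu.2.trans_lt ht.2) (by linarith [hu.2]) hbd
      have := mul_le_mul_of_nonneg_left (by linarith [hu.2] : u - s ≤ t - t1) hK4
      linarith)
  have hYt : Y t ≤ (C + K4) * (t - t1) := by
    have := grow s t hs1 hst.le ht.2 htau fun v hv => (hboot v hv).le
    have := mul_le_mul_of_nonneg_left (by linarith : t - s ≤ t - t1) hK4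
    linarith
  have hw := (H1 G t ht (small t htau).1).2.1
  refine ⟨hw.trans ?_, (hYle t ht htau).trans ?_, low t ht htau,
    one t ht htau (hboot t ⟨hst.le, le_rfl⟩).le⟩
  · gcongr
    have : 0 ≤ c⁻¹ * (C + K4) := by positivity
    linarith
  · have := mul_le_mul_of_nonneg_left hYt (inv_nonneg.2 hc.le)
    have := mul_nonneg hK1 hτ.le
    linarith

/-- At some intermediate time the difference quotients of the derivative are bounded in `L²`. -/
theorem Weight.exists_nsq_dq_sub1_le (W : Weight a b A B c C φ φ1 φ2 φ3) (hab : a < b)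
    (hσ : 0 < σ) (hn : 1 ≤ n) (κ d e : ℝ) : ∃ K τ0, 0 ≤ K ∧ 0 < τ0 ∧
      ∀ {t1 t2 : ℝ} {p p1 p2 p3 pt : ℝ → ℝ → ℂ},
      GapData κ d e a b A B σ n t1 t2 p p1 p2 p3 pt → ∀ t ∈ Ioo t1 t2, t - t1 < τ0 →
      nsq a b (fun x => p t x - p t1 x) ≤ K * (t - t1) ^ 2 ∧
      nsq a b (fun x => p t x - p t1 x) ≤ 1 ∧ nsq a b (fun x => p1 t x - p1 t1 x) ≤ 1 ∧
      ∀ h ∈ Ioc 0 σ, ∃ s ∈ Ioc t1 t, nsq a b (dq h (fun x => p1 s x - p1 t1 x)) ≤ K := by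
  have hC := W.C_pos
  have hc := W.c_pos
  have hn0 : 0 < n := by linarith
  obtain ⟨K1, τ1, hK1, hτ1, H1⟩ := W.exists_nsq_sub1_le hab hσ hn κ d e
  obtain ⟨K4, hK4, H4⟩ := W.exists_energy_dq_deriv_le hab hσ hn κ d e
  set R := C * (K1 + 2 * σ * (16 * n ^ 2)) with hR
  have hR0 : 0 ≤ R := by positivity
  set M := (R + K4 + 1) / (2 * c) with hM
  have hM0 : 0 ≤ M := by positivity
  refine ⟨K1 + M, min τ1 (σ ^ 2), by positivity, lt_min hτ1 (by positivity),
    fun {t1 t2 p p1 p2 p3 pt} G t ht htau => ?_⟩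
  obtain ⟨hτ1', hτσ⟩ := lt_min_iff.1 htau
  obtain ⟨e1, -, e3, e4⟩ := H1 G t ht hτ1'
  refine ⟨e1.trans (by gcongr; linarith), e3, e4, fun h hh => ?_⟩
  by_contra! hcon
  set s0 := (t1 + t) / 2 with hs0
  have h1 : t1 < s0 := by linarith [ht.1]
  have h2 : s0 < t := by linarith [ht.1]
  have hin : ∀ u ∈ Icc s0 t, u ∈ Ioo t1 t2 := fun u hu =>
    ⟨h1.trans_le hu.1, hu.2.trans_lt ht.2⟩
  have hder : ∀ u ∈ Icc s0 t, ∃ D, HasDerivAt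
      (fun s => ∫ x in a..b, φ x * ‖dq h (fun x => p s x - p t1 x) x‖ ^ 2) D u ∧
      D ≤ -(R + 1) := by
    intro u hu
    obtain ⟨-, -, f3, f4⟩ := H1 G u (hin u hu) (by linarith [hu.2])
    obtain ⟨D, hD, hDle⟩ := H4 G h hh u (hin u hu) f3 f4
    refine ⟨D, hD, hDle.trans ?_⟩
    have g1 := hcon u ⟨(hin u hu).1, hu.2⟩
    have g2 : M ≤ nsq a b (dq h (fun x => p1 u x - p1 t1 x)) := by linarith
    have g3 := mul_le_mul_of_nonneg_left g2 (by positivity : 0 ≤ 2 * c)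
    have g4 : 2 * c * M = R + K4 + 1 := by rw [hM]; field_simp
    linarith
  choose! D hD hDle using hder
  have hfin := le_of_hasDerivAt_le h2.le hD hDle
  have hpos := W.energy_nonneg hab.le (dq h (fun x => p t x - p t1 x))
  have js := G.jet_sub s0
  have hs0' := hin s0 ⟨le_rfl, h2.le⟩
  have hstart : ∫ x in a..b, φ x * ‖dq h (fun x => p s0 x - p t1 x) x‖ ^ 2 ≤ R * (s0 - t1) := by
    refine (W.energy_le_nsq hab.le (continuous_dq h js.cont0)).trans ?_
    rw [← avg_eq_dq hh.1.ne' js.d0 js.cont1, hR, mul_assoc]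
    refine mul_le_mul_of_nonneg_left ?_ hC.le
    have g1 := (nsq_avg_le hab.le hh.1.le js.cont1).trans (nsq_mono_interval le_rfl
      (by linarith [hh.1]) (by linarith [hh.2] : b + h ≤ b + 2 * σ) js.cont1)
    have g2 := nsq_extend_le (a := a) (b := b) (s := 2 * σ) (by linarith) js.cont1 fun x hx =>
      G.norm_sub1_sq_le ⟨hs0'.1, hs0'.2.le⟩ (by linarith) (G.strip_of_right hx)
    have g3 := (H1 G s0 hs0' (by linarith)).2.1
    linarith
  have hmul : (s0 - t1) = t - s0 := by rw [hs0]; ring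
  rw [hmul] at hstart
  have : 0 < t - s0 := by linarith
  linarith

end DerivativeSmallness

section SecondDerivative

variable {κ d e a b A B σ n t1 t2 c C : ℝ} {p p1 p2 p3 pt : ℝ → ℝ → ℂ} {φ φ1 φ2 φ3 : ℝ → ℝ}

theorem norm_sq_le_of_nl_sub {L S V P Q Rr X : ℝ}
    (hX0 : 0 ≤ X) (hQ : Q ^ 2 ≤ S) (hR : Rr ^ 2 ≤ S) {r : ℝ}
    (h : X ≤ L * ((1 + Q ^ 2) * V + (Q + Rr) * P * r)) :
    X ^ 2 ≤ L ^ 2 * (2 * (1 + S) ^ 2 * V ^ 2 + 8 * S * P ^ 2 * r ^ 2) := by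
  have h1 : X ^ 2 ≤ (L * ((1 + Q ^ 2) * V + (Q + Rr) * P * r)) ^ 2 := pow_le_pow_left₀ hX0 h 2
  have h2 : ((1 + Q ^ 2) * V) ^ 2 ≤ (1 + S) ^ 2 * V ^ 2 := by
    rw [mul_pow]; gcongr
  have h3 : (Q + Rr) ^ 2 ≤ 4 * S := by nlinarith [sq_nonneg (Q - Rr)]
  have h4 : ((Q + Rr) * P * r) ^ 2 ≤ 4 * S * P ^ 2 * r ^ 2 := by
    rw [mul_pow, mul_pow]; gcongr
  have h5 : ((1 + Q ^ 2) * V + (Q + Rr) * P * r) ^ 2 ≤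
      2 * ((1 + S) ^ 2 * V ^ 2) + 2 * (4 * S * P ^ 2 * r ^ 2) := by
    nlinarith [sq_nonneg ((1 + Q ^ 2) * V - (Q + Rr) * P * r)]
  rw [mul_pow] at h1
  have := mul_le_mul_of_nonneg_left h5 (sq_nonneg L)
  linarith

theorem exists_nsq_dq_nl_le (hab : a < b) (hσ : 0 < σ) (κ d e : ℝ) {N : ℝ} (hN : 0 ≤ N) :
    ∃ K, 0 ≤ K ∧ ∀ q q1 : ℝ → ℂ, (∀ x, HasDerivAt q (q1 x) x) → Continuous q1 →
      nsq a (b + σ) q ≤ N → nsq a (b + σ) q1 ≤ N → ∀ h ∈ Ioc 0 σ,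
      nsq a b (dq h (fun x => nl κ d e (q x) (q1 x))) ≤ K * (1 + nsq a b (dq h q1)) := by
  have hba : 0 < b - a := by linarith
  have hba' : 0 < b + σ - a := by linarith
  set L := |κ| + |d| + |e| with hL
  have hL0 : 0 ≤ L := by positivity
  set S := N / (b + σ - a) + N / 1 + 1 * N with hS
  have hS0 : 0 ≤ S := by positivity
  set T := N / (b - a) + N / 1 with hT
  have hT0 : 0 ≤ T := by positivity
  refine ⟨L ^ 2 * (2 * (1 + S) ^ 2 + 8 * S * (T + 1) * N), by positivity,
    fun q q1 hd hc1 hq hq1 h hh => ?_⟩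
  have cq : Continuous q := continuous_iff_continuousAt.2 fun x => (hd x).continuousAt
  have cN := Continuous.nl κ d e cq hc1
  have cdq1 := continuous_dq h hc1
  have cdN := continuous_dq h cN
  set D := nsq a b (dq h q1) with hD
  have hD0 : 0 ≤ D := nsq_nonneg hab.le _
  have hsup : ∀ x ∈ Icc a (b + σ), ‖q x‖ ^ 2 ≤ S := fun x hx => by
    refine (sobolev_interval_young (by linarith) hd hc1 hq one_pos hx).trans ?_
    rw [hS]; gcongr
  have hP : nsq a b (dq h q) ≤ N := by
    rw [← avg_eq_dq hh.1.ne' hd hc1]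
    exact ((nsq_avg_le hab.le hh.1.le hc1).trans (nsq_mono_interval le_rfl (by linarith [hh.1])
      (by linarith [hh.2]) hc1)).trans hq1
  have hpt : ∀ x ∈ Icc a b, ‖dq h (fun x => nl κ d e (q x) (q1 x)) x‖ ^ 2 ≤
      L ^ 2 * (2 * (1 + S) ^ 2) * ‖dq h q1 x‖ ^ 2
        + L ^ 2 * (8 * S * (T + 1 * D)) * ‖q1 x‖ ^ 2 := by
    intro x hx
    have hx1 := hsup x ⟨hx.1, by linarith [hx.2]⟩
    have hx2 := hsup (x + h) ⟨by linarith [hx.1, hh.1], by linarith [hx.2, hh.2]⟩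
    have hPx : ‖dq h q x‖ ^ 2 ≤ T + 1 * D :=
      sobolev_interval_young hab (HasDerivAt.dq_fun hd) cdq1 hP one_pos hx
    have key : ‖dq h (fun x => nl κ d e (q x) (q1 x)) x‖ ≤ L * ((1 + ‖q (x + h)‖ ^ 2)
        * ‖dq h q1 x‖ + (‖q (x + h)‖ + ‖q x‖) * ‖dq h q x‖ * ‖q1 x‖) := by
      have := norm_nl_sub_le κ d e (q (x + h)) (q1 (x + h)) (q x) (q1 x)
      simp only [dq, norm_div, Complex.norm_real, Real.norm_eq_abs, abs_of_pos hh.1]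
      rw [div_le_iff₀ hh.1]
      refine this.trans_eq ?_
      have := hh.1.ne'
      rw [← hL]
      field_simp
    have := norm_sq_le_of_nl_sub (norm_nonneg _) hx2 hx1 key
    have h8 : L ^ 2 * (8 * S * ‖dq h q x‖ ^ 2 * ‖q1 x‖ ^ 2) ≤
        L ^ 2 * (8 * S * (T + 1 * D) * ‖q1 x‖ ^ 2) := by gcongr
    linarith
  have hint : nsq a b (dq h (fun x => nl κ d e (q x) (q1 x))) ≤
      L ^ 2 * (2 * (1 + S) ^ 2) * D + L ^ 2 * (8 * S * (T + 1 * D)) * nsq a b q1 := by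
    rw [hD]
    unfold nsq
    rw [← intervalIntegral.integral_const_mul, ← intervalIntegral.integral_const_mul,
      ← intervalIntegral.integral_add (Continuous.intervalIntegrable (by fun_prop) _ _)
        (Continuous.intervalIntegrable (by fun_prop) _ _)]
    exact intervalIntegral.integral_mono_on hab.le
      (Continuous.intervalIntegrable (by fun_prop) _ _)
      (Continuous.intervalIntegrable (by fun_prop) _ _) hpt
  have hq1' : nsq a b q1 ≤ N :=
    (nsq_mono_interval le_rfl hab.le (by linarith) hc1).trans hq1
  have h9 : L ^ 2 * (8 * S * (T + 1 * D)) * nsq a b q1 ≤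
      L ^ 2 * (8 * S * ((T + 1) * (1 + D))) * N := by
    have : T + 1 * D ≤ (T + 1) * (1 + D) := by nlinarith
    have := nsq_nonneg hab.le q1
    gcongr
  have h10 : L ^ 2 * (2 * (1 + S) ^ 2) * D ≤ L ^ 2 * (2 * (1 + S) ^ 2) * (1 + D) := by
    gcongr; linarith
  linarith

theorem GapData.norm_dq1_le (G : GapData κ d e a b A B σ n t1 t2 p p1 p2 p3 pt) {t x h : ℝ}
    (ht : t ∈ Icc t1 t2) (hh : h ∈ Ioc 0 σ) (hx : x ∈ Icc a A ∪ Icc B b ∪ Icc b (b + σ)) :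
    ‖dq h (p1 t) x‖ ≤ n := by
  have j := G.sol.jet t
  rw [← avg_eq_dq hh.1.ne' j.d1 j.cont2]
  refine norm_avg_le fun r hr => G.s2 t ht _ ?_
  have h0 : 0 ≤ h * r := mul_nonneg hh.1.le hr.1
  have h1 : h * r ≤ σ := by nlinarith [hh.1, hh.2, hr.1, hr.2]
  rcases hx with hx | hx
  · exact G.strip_add hx h0 (by linarith [G.σ_pos])
  · exact G.strip_of_right ⟨by linarith [hx.1], by linarith [hx.2]⟩

/-- Growth of the energy of second difference quotients of the solution. -/
theorem Weight.exists_energy_dq_dq_deriv_le (W : Weight a b A B c C φ φ1 φ2 φ3) (hab : a < b)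
    (hσ : 0 < σ) (hn : 1 ≤ n) (κ d e : ℝ) : ∃ K, 0 ≤ K ∧
      ∀ {t1 t2 : ℝ} {p p1 p2 p3 pt : ℝ → ℝ → ℂ},
      GapData κ d e a b A B σ n t1 t2 p p1 p2 p3 pt → ∀ h ∈ Ioc 0 σ, ∀ k ∈ Ioc 0 σ,
      ∀ t ∈ Ioo t1 t2,
      nsq a b (fun x => p t x - p t1 x) ≤ 1 → nsq a b (fun x => p1 t x - p1 t1 x) ≤ 1 →
      ∃ D, HasDerivAt (fun s => ∫ x in a..b, φ x * ‖dq k (dq h (p s)) x‖ ^ 2) D t ∧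
        D ≤ K * (1 + ∫ x in a..b, φ x * ‖dq h (p1 t) x‖ ^ 2) := by
  have hC := W.C_pos
  have hc := W.c_pos
  have hn0 : 0 ≤ n := by linarith
  have hba : 0 < b - a := by linarith
  have hab1 : a < b + σ := by linarith
  set N := n ^ 2 * (b + 2 * σ - a) with hN
  have hN0 : 0 ≤ N := mul_nonneg (by positivity) (by linarith)
  set K0 := 1 + 2 * σ * (2 * n) ^ 2 with hK0
  have hK00 : 0 ≤ K0 := by positivity
  obtain ⟨L, hL0, hL⟩ := exists_nsq_dq_nl_le hab1 hσ κ d e (by positivity : 0 ≤ 2 * K0 + 2 * N)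
  set m := (b - a) * n ^ 2 + σ * n ^ 2 with hm
  have hm0 : 0 ≤ m := by positivity
  set Q := (3 * C + 3 * c) * (b - a) * n ^ 2 with hQ
  have hQ0 : 0 ≤ Q := by positivity
  set R := 2 * C + (C + C ^ 2 / c) * L with hR
  have hR0 : 0 ≤ R := by positivity
  refine ⟨R * (1 + m + c⁻¹) + Q, by positivity,
    fun {t1 t2 p p1 p2 p3 pt} G h hh k hk t ht h0 h1 => ?_⟩
  have ht' := Ioo_subset_Icc_self ht
  have j := G.sol.jet t
  have cN := G.sol.continuous_nl t
  have cf := continuous_dq h cN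
  have c3 := j.c3
  have hlip : LipAt a (b + σ) (fun s => dq h (p s)) t :=
    LipAt.dq G.sol.cont hab1.le hh.1 ((G.good t ht).2.mono G.sol.cont le_rfl
      (by linarith [hh.1]) (by linarith [hh.2]))
  have hder : ∀ x ∈ Icc a (b + 2 * σ), HasDerivAt (fun s => p s x)
      (-p3 t x + nl κ d e (p t x) (p1 t x)) t := fun x hx => G.sol.hasDerivAt (G.good t ht) hx
  refine ⟨_, LipAt.hasDerivAt_energy_dq (z := fun s => dq h (p s)) hab.le hk.1 W.cont
    (fun s => continuous_dq h (G.sol.cont s))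
    (zt := dq h (fun x => -p3 t x + nl κ d e (p t x) (p1 t x)))
    (continuous_dq h (by fun_prop))
    (hlip.mono (fun s => continuous_dq h (G.sol.cont s)) le_rfl (by linarith [hk.1])
      (by linarith [hk.2])) (fun x hx => ?_), ?_⟩
  · exact hasDerivAt_dq_family (hder x ⟨hx.1, by linarith [hx.2, hk.2]⟩)
      (hder (x + h) ⟨by linarith [hx.1, hh.1], by linarith [hx.2, hk.2, hh.2]⟩)
  have esplit : dq h (fun x => -p3 t x + nl κ d e (p t x) (p1 t x)) =
      fun x => -dq h (p3 t) x + dq h (fun x => nl κ d e (p t x) (p1 t x)) x :=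
    funext fun x => dq_neg_add h _ _ x
  rw [esplit]
  simp only [dq_neg_add]
  have jV := j.dq h
  have hms : ∀ x ∈ Icc a A ∪ Icc B b, ‖dq k (dq h (p1 t)) x‖ ^ 2 ≤ n ^ 2 := by
    intro x hx
    refine pow_le_pow_left₀ (norm_nonneg _) ?_ 2
    rw [← avg_eq_dq hk.1.ne' jV.d1 jV.cont2]
    refine norm_avg_le fun r hr => ?_
    rw [← avg_eq_dq hh.1.ne' j.d2 j.c3]
    refine norm_avg_le fun r' hr' => G.s3 t ht' _ ?_
    rw [add_assoc]
    have := hh.1; have := hh.2; have := hk.1; have := hk.2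
    exact G.strip_add hx (add_nonneg (mul_nonneg hk.1.le hr.1) (mul_nonneg hh.1.le hr'.1))
      (by nlinarith [hr.1, hr.2, hr'.1, hr'.2])
  have e1 := W.energy_dq_le hab.le (jV.dq k) hk.1.ne' cf hms (by positivity)
  have havg : ∀ {f : ℝ → ℂ}, Continuous f → nsq a b (avg k f) ≤ nsq a (b + σ) f := fun hf' =>
    (nsq_avg_le hab.le hk.1.le hf').trans (nsq_mono_interval le_rfl (by linarith [hk.1])
      (by linarith [hk.2]) hf')
  set Z := ∫ x in a..b, φ x * ‖dq h (p1 t) x‖ ^ 2 with hZ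
  have hZ0 : 0 ≤ Z := W.energy_nonneg hab.le _
  have eV : nsq a (b + σ) (dq h (p1 t)) ≤ c⁻¹ * Z + m := by
    have f1 := nsq_extend_le (a := a) (b := b) (M := n ^ 2) hσ.le jV.cont1 fun x hx =>
      pow_le_pow_left₀ (norm_nonneg _) (G.norm_dq1_le ht' hh (Or.inr hx)) 2
    have f2 := W.nsq_le hab.le jV.cont1 (m := n ^ 2) (fun x hx =>
      pow_le_pow_left₀ (norm_nonneg _) (G.norm_dq1_le ht' hh (Or.inl hx)) 2) (by positivity)
    linarith
  have e2 : nsq a b (dq k (dq h (p t))) ≤ nsq a (b + σ) (dq h (p1 t)) := by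
    rw [← avg_eq_dq hk.1.ne' jV.d0 jV.cont1]
    exact havg jV.cont1
  obtain ⟨w0, w1⟩ := G.nsq_sub_extend_le ht'
  have ji := G.sol.jet t1
  have ebb : b + σ + σ = b + 2 * σ := by ring
  have e3 := nsq_le_of_nsq_sub_le G.ab2.le j.cont0 ji.cont0 (w0.trans (by linarith : _ ≤ K0))
    (G.nsq_initial_le ji.cont0 G.i0)
  have e4 := nsq_le_of_nsq_sub_le G.ab2.le j.cont1 ji.cont1 (w1.trans (by linarith : _ ≤ K0))
    (G.nsq_initial_le ji.cont1 G.i1)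
  have e5 := hL _ _ j.d0 j.cont1 (by rw [ebb]; exact e3) (by rw [ebb]; exact e4) h hh
  have e6 := mul_le_mul_of_nonneg_left ((havg cf).trans e5) (by positivity : 0 ≤ C + C ^ 2 / c)
  have e7 : (C + C ^ 2 / c) * (L * (1 + nsq a (b + σ) (dq h (p1 t)))) ≤
      (C + C ^ 2 / c) * L * (1 + (c⁻¹ * Z + m)) := by
    rw [← mul_assoc]; gcongr
  have e8 : 2 * C * nsq a b (dq k (dq h (p t))) ≤ 2 * C * (1 + (c⁻¹ * Z + m)) := by
    gcongr; linarith
  have e9 := mul_nonneg hc.le (nsq_nonneg hab.le (dq k (dq h (p1 t))))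
  have e10 : R * (1 + (c⁻¹ * Z + m)) + Q ≤ (R * (1 + m + c⁻¹) + Q) * (1 + Z) := by
    have g1 : 0 ≤ R * (1 + m) * Z := by positivity
    have g2 : 0 ≤ R * c⁻¹ := by positivity
    have g3 : 0 ≤ Q * Z := by positivity
    nlinarith
  have e11 : R * (1 + (c⁻¹ * Z + m)) = 2 * C * (1 + (c⁻¹ * Z + m)) +
    (C + C ^ 2 / c) * L * (1 + (c⁻¹ * Z + m)) := by rw [hR]; ring
  linarith

end SecondDerivative

section GapEstimate

variable {κ d e a b A B σ n t1 t2 c C : ℝ} {p p1 p2 p3 pt : ℝ → ℝ → ℂ} {φ φ1 φ2 φ3 : ℝ → ℝ}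

theorem GapData.continuousAt_energy_dq1 (G : GapData κ d e a b A B σ n t1 t2 p p1 p2 p3 pt)
    (hφ : Continuous φ) {t h : ℝ} (hh : h ∈ Ioc 0 σ) (ht : t ∈ Ioo t1 t2) :
    ContinuousAt (fun s => ∫ x in a..b, φ x * ‖dq h (p1 s) x‖ ^ 2) t := by
  refine continuousAt_energy (F := fun s x => dq h (p1 s) x) G.ab.le hφ
    (fun s => continuous_dq h (G.sol.jet s).cont1) fun x hx => ?_
  have hσ := G.σ_pos
  have g1 := (G.good t ht).1 x ⟨hx.1, by linarith [hx.2]⟩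
  have g2 := (G.good t ht).1 (x + h) ⟨by linarith [hx.1, hh.1], by linarith [hx.2, hh.2]⟩
  have g3 : ContinuousAt (fun z : ℝ × ℝ => p1 z.1 (z.2 + h)) (t, x) :=
    ContinuousAt.comp (f := fun z : ℝ × ℝ => (z.1, z.2 + h)) (x := (t, x)) g2
      (Continuous.continuousAt (by fun_prop))
  exact (g3.sub g1).div_const _

/-- Short time estimate on a time interval of good times: the solution is `L²`-Lipschitz at the
initial time, and its second derivative is bounded in `L²`. -/
theorem Weight.exists_nsq_sub_le_nsq_deriv2_le (W : Weight a b A B c C φ φ1 φ2 φ3) (hab : a < b)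
    (hσ : 0 < σ) (hn : 1 ≤ n) (κ d e : ℝ) : ∃ K τ0, 0 ≤ K ∧ 0 < τ0 ∧
      ∀ {t1 t2 : ℝ} {p p1 p2 p3 pt : ℝ → ℝ → ℂ},
      GapData κ d e a b A B σ n t1 t2 p p1 p2 p3 pt → ∀ t ∈ Ioo t1 t2, t - t1 < τ0 →
      nsq a (b + 2 * σ) (fun x => p t x - p t1 x) ≤ K * (t - t1) ^ 2 ∧
      nsq a (b + 2 * σ) (p2 t) ≤ K := by
  have hC := W.C_pos
  have hc := W.c_pos
  have hn0 : 0 ≤ n := by linarith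
  have hba : 0 < b - a := by linarith
  obtain ⟨K1, τ1, hK1, hτ1, H1⟩ := W.exists_nsq_dq_sub1_le hab hσ hn κ d e
  obtain ⟨K5, hK5, H5⟩ := W.exists_energy_dq_dq_deriv_le hab hσ hn κ d e
  set ρ0 := C * (2 * K1 + 2 * (n ^ 2 * (b - a))) with hρ0
  have hρ00 : 0 ≤ ρ0 := by positivity
  set ρ := ρ0 + 2 with hρ
  have hρpos : 0 < ρ := by positivity
  refine ⟨K1 + c⁻¹ * ρ + (b - a) * n ^ 2 + 2 * σ * n ^ 2, min τ1 (1 / (K5 * (1 + ρ) + 1)),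
    by positivity, lt_min hτ1 (by positivity), fun {t1 t2 p p1 p2 p3 pt} G t ht htau => ?_⟩
  obtain ⟨hτ1', hτ⟩ := lt_min_iff.1 htau
  rw [lt_div_iff₀ (by positivity)] at hτ
  have ht' := Ioo_subset_Icc_self ht
  have hτ0 : 0 < t - t1 := by linarith [ht.1]
  have j := G.sol.jet t
  constructor
  · have f1 := (H1 G t ht hτ1').1
    have f2 := nsq_extend_le (a := a) (b := b) (s := 2 * σ) (M := (n * (t - t1)) ^ 2)
      (by linarith) (G.jet_sub t).cont0 fun x hx =>
      pow_le_pow_left₀ (norm_nonneg _) (G.lip t ht' x (G.strip_of_right hx)) 2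
    have f3 : 0 ≤ (c⁻¹ * ρ + (b - a) * n ^ 2) * (t - t1) ^ 2 := by positivity
    nlinarith
  have hZ : ∀ h ∈ Ioc 0 σ, ∫ x in a..b, φ x * ‖dq h (p1 t) x‖ ^ 2 ≤ ρ := by
    intro h hh
    obtain ⟨s, hs, hsK⟩ := (H1 G t ht hτ1').2.2.2 h hh
    have cdq : ∀ u, Continuous (dq h (p1 u)) := fun u => continuous_dq h (G.sol.jet u).cont1
    have hsub : dq h (fun x => p1 s x - p1 t1 x) = fun x => dq h (p1 s) x - dq h (p1 t1) x := by
      funext x; unfold dq; ring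
    rw [hsub] at hsK
    have hi : nsq a b (dq h (p1 t1)) ≤ n ^ 2 * (b - a) := by
      refine nsq_le_of_bound hab.le (cdq t1) fun x hx => pow_le_pow_left₀ (norm_nonneg _) ?_ 2
      have ji := G.sol.jet t1
      rw [← avg_eq_dq hh.1.ne' ji.d1 ji.cont2]
      refine norm_avg_le fun r hr => G.i2 _ ⟨?_, ?_⟩
      · have := mul_nonneg hh.1.le hr.1
        linarith [hx.1]
      · have : h * r ≤ σ := by nlinarith [hh.1, hh.2, hr.1, hr.2]
        linarith [hx.2]
    have hZs : ∫ x in a..b, φ x * ‖dq h (p1 s) x‖ ^ 2 ≤ ρ0 :=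
      (W.energy_le_nsq hab.le (cdq s)).trans (mul_le_mul_of_nonneg_left
        (nsq_le_of_nsq_sub_le hab.le (cdq s) (cdq t1) hsK hi) hC.le)
    have hin : ∀ u ∈ Icc s t, u ∈ Ioo t1 t2 := fun u hu =>
      ⟨hs.1.trans_le hu.1, hu.2.trans_lt ht.2⟩
    refine (lt_of_bootstrap (r := fun u => ∫ x in a..b, φ x * ‖dq h (p1 u) x‖ ^ 2) (s := s)
      (t := t) (ρ := ρ) (fun u hu => (G.continuousAt_energy_dq1 W.cont hh
        (hin u hu)).continuousWithinAt) (by linarith) (fun u hu hbd => ?_) t ⟨hs.2, le_rfl⟩).le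
    have hgrow := le_add_of_tendsto_of_hasDerivAt_le (σ := σ) (K := K5 * (1 + ρ))
      (Y := fun k u => ∫ x in a..b, φ x * ‖dq k (dq h (p u)) x‖ ^ 2)
      (r := fun u => ∫ x in a..b, φ x * ‖dq h (p1 u) x‖ ^ 2) hu.1 hσ
      (fun v => tendsto_energy_dq W.cont ((G.sol.jet v).dq h).d0 (cdq v) a b)
      fun k hk v hv => by
        have hv' := hin v ⟨hv.1, hv.2.trans hu.2⟩
        obtain ⟨-, g1, g2, -⟩ := H1 G v hv' (by linarith [hv.2, hu.2])
        obtain ⟨D, hD, hDle⟩ := H5 G h hh k hk v hv' g1 g2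
        refine ⟨D, hD, hDle.trans ?_⟩
        gcongr
        exact hbd v hv
    have g3 : K5 * (1 + ρ) * (u - s) ≤ K5 * (1 + ρ) * (t - t1) := by
      have : u - s ≤ t - t1 := by linarith [hu.2, hs.1]
      gcongr
    linarith
  have hlim : ∫ x in a..b, φ x * ‖p2 t x‖ ^ 2 ≤ ρ :=
    le_of_tendsto (tendsto_energy_dq W.cont j.d1 j.cont2 a b)
      (by filter_upwards [Ioc_mem_nhdsGT hσ] with h hh using hZ h hh)
  have f1 := W.nsq_le hab.le j.cont2 (m := n ^ 2) (fun x hx =>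
    pow_le_pow_left₀ (norm_nonneg _) (G.s2 t ht' x (G.strip_of_inner hx)) 2) (by positivity)
  have f2 := nsq_extend_le (a := a) (b := b) (s := 2 * σ) (M := n ^ 2) (by linarith) j.cont2
    fun x hx => pow_le_pow_left₀ (norm_nonneg _) (G.s2 t ht' x (G.strip_of_right hx)) 2
  have f3 := mul_le_mul_of_nonneg_left hlim (inv_nonneg.2 hc.le)
  linarith

/-- The short time estimate with constants depending only on the geometry and on the bound `n`. -/
theorem exists_gap_estimate {a b A B σ n : ℝ} (haA : a < A) (hAB : A < B) (hBb : B < b)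
    (hσ : 0 < σ) (hn : 1 ≤ n) (κ d e : ℝ) : ∃ K τ0, 0 ≤ K ∧ 0 < τ0 ∧
      ∀ {t1 t2 : ℝ} {p p1 p2 p3 pt : ℝ → ℝ → ℂ},
      GapData κ d e a b A B σ n t1 t2 p p1 p2 p3 pt → ∀ t ∈ Ioo t1 t2, t - t1 < τ0 →
      nsq a (b + 2 * σ) (fun x => p t x - p t1 x) ≤ K * (t - t1) ^ 2 ∧
      nsq a (b + 2 * σ) (p2 t) ≤ K := by
  obtain ⟨φ, φ1, φ2, φ3, c, C, W⟩ := Weight.exists haA hAB hBb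
  exact W.exists_nsq_sub_le_nsq_deriv2_le (by linarith) hσ hn κ d e

end GapEstimate

section Category

theorem exists_open_inter_subset_of_closed_cover {X : Type*} [MetricSpace X] [CompleteSpace X]
    {T V : Set X} (hT : IsClosed T) (hV : IsOpen V) (hne : (V ∩ T).Nonempty) {F : ℕ → Set X}
    (hF : ∀ n, IsClosed (F n)) (hcov : ∀ t ∈ V ∩ T, ∃ n, t ∈ F n) :
    ∃ n, ∃ U ⊆ V, IsOpen U ∧ (U ∩ T).Nonempty ∧ U ∩ T ⊆ F n := by
  have : CompleteSpace T := hT.completeSpace_coe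
  let f : Option ℕ → Set T := fun o => o.elim ((↑) ⁻¹' Vᶜ) fun n => (↑) ⁻¹' F n
  have hf : ∀ o, IsClosed (f o) := by
    rintro (_ | n)
    · exact hV.isClosed_compl.preimage continuous_subtype_val
    · exact (hF n).preimage continuous_subtype_val
  have hU : ⋃ o, f o = univ := by
    refine eq_univ_of_forall fun t => mem_iUnion.2 ?_
    by_cases ht : (t : X) ∈ V
    · obtain ⟨n, hn⟩ := hcov t ⟨ht, t.2⟩
      exact ⟨some n, hn⟩
    · exact ⟨none, ht⟩
  obtain ⟨x, hxV, hxT⟩ := hne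
  obtain ⟨y, hyV, hy⟩ := (dense_iUnion_interior_of_closed hf hU).inter_open_nonempty
    ((Subtype.val : T → X) ⁻¹' V) (hV.preimage continuous_subtype_val) ⟨⟨x, hxT⟩, hxV⟩
  obtain ⟨o, ho⟩ := mem_iUnion.1 hy
  rcases o with _ | n
  · exact absurd hyV (interior_subset ho)
  · obtain ⟨U, hUo, hUe⟩ := isOpen_induced_iff.1 (isOpen_interior (s := f (some n)))
    refine ⟨n, U ∩ V, inter_subset_right, hUo.inter hV, ⟨y, ⟨?_, hyV⟩, y.2⟩, ?_⟩
    · have : y ∈ (↑) ⁻¹' U := by rw [hUe]; exact ho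
      exact this
    · rintro z ⟨⟨hz, -⟩, hzT⟩
      have : (⟨z, hzT⟩ : T) ∈ interior (f (some n)) := by rw [← hUe]; exact hz
      exact (interior_subset this : (⟨z, hzT⟩ : T) ∈ f (some n))

end Category

section JointContinuity

theorem norm_sub_sq_le_of_nsq {a b x y M : ℝ} {f f1 : ℝ → ℂ} (hd : ∀ x, HasDerivAt f (f1 x) x)
    (hc : Continuous f1) (hM : nsq a b f1 ≤ M) (hx : x ∈ Icc a b) (hy : y ∈ Icc a b) :
    ‖f y - f x‖ ^ 2 ≤ |y - x| * M := by
  wlog hxy : x ≤ y generalizing x y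
  · rw [norm_sub_rev, abs_sub_comm]
    exact this hy hx (le_of_not_ge hxy)
  have h1 := intervalIntegral.integral_eq_sub_of_hasDerivAt (a := x) (b := y) (fun z _ => hd z)
    (hc.intervalIntegrable _ _)
  have h2 := cauchy_schwarz_interval hxy (f := fun _ => (1 : ℝ)) (g := fun z => ‖f1 z‖)
    continuous_const hc.norm
  have h3 := intervalIntegral.norm_integral_le_integral_norm (f := f1) (μ := volume) hxy
  simp only [one_mul, one_pow, intervalIntegral.integral_const, smul_eq_mul, mul_one] at h2
  rw [h1] at h3
  have h4 := pow_le_pow_left₀ (norm_nonneg _) (h3.trans h2) 2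
  have h5 : nsq x y f1 ≤ M := (nsq_mono_interval hx.1 hxy hy.2 hc).trans hM
  have h6 : 0 ≤ y - x := sub_nonneg.2 hxy
  rw [mul_pow, Real.sq_sqrt h6, ← nsq, Real.sq_sqrt (nsq_nonneg hxy f1)] at h4
  rw [abs_of_nonneg h6]
  exact h4.trans (mul_le_mul_of_nonneg_left h5 h6)

/-- If the second derivative is locally bounded in `L²`, the first derivative is jointly
continuous. -/
theorem continuousAt_deriv_of_nsq_bounded {a b M t0 x0 : ℝ} {p p1 p2 : ℝ → ℝ → ℂ}
    (hd : ∀ t x, HasDerivAt (p t) (p1 t x) x) (hd1 : ∀ t x, HasDerivAt (p1 t) (p2 t x) x)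
    (hc : ∀ t, Continuous (p2 t)) (ht : ∀ x, ContinuousAt (fun t => p t x) t0)
    (hM : ∀ᶠ t in 𝓝 t0, nsq a b (p2 t) ≤ M) (hx0 : x0 ∈ Ioo a b) :
    ContinuousAt (Function.uncurry p1) (t0, x0) := by
  have hc1 : ∀ t, Continuous (p1 t) := fun t =>
    continuous_iff_continuousAt.2 fun x => (hd1 t x).continuousAt
  have hab : a < b := hx0.1.trans hx0.2
  have hM0 : 0 ≤ M := (nsq_nonneg hab.le _).trans hM.self_of_nhds
  rw [Metric.continuousAt_iff']
  intro ε hε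
  obtain ⟨h, hh, hhb, hhM⟩ : ∃ h, 0 < h ∧ x0 + h ∈ Icc a b ∧ 2 * h * M < (ε / 4) ^ 2 := by
    have l1 : Tendsto (fun h : ℝ => 2 * h * M) (𝓝 0) (𝓝 (2 * 0 * M)) :=
      Continuous.tendsto (by fun_prop) 0
    have l2 : Tendsto (fun h : ℝ => x0 + h) (𝓝 0) (𝓝 (x0 + 0)) :=
      Continuous.tendsto (by fun_prop) 0
    rw [mul_zero, zero_mul] at l1
    rw [add_zero] at l2
    have ev := (l2.eventually (Icc_mem_nhds hx0.1 hx0.2)).and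
      (l1.eventually_lt_const (by positivity : 0 < (ε / 4) ^ 2))
    obtain ⟨h, ⟨h1, h2⟩, h3⟩ := ((ev.filter_mono nhdsWithin_le_nhds).and
      (self_mem_nhdsWithin (s := Ioi (0 : ℝ)))).exists
    exact ⟨h, h3, h1, h2⟩
  have hh2 : ∀ᶠ x in 𝓝 x0, x ∈ Icc a b ∧ |x - x0| < h :=
    Eventually.and (Icc_mem_nhds hx0.1 hx0.2) (Metric.ball_mem_nhds x0 hh)
  have hdq : ∀ᶠ t in 𝓝 t0, ‖dq h (p t) x0 - dq h (p t0) x0‖ < ε / 4 := by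
    have l : ContinuousAt (fun t => ‖dq h (p t) x0 - dq h (p t0) x0‖) t0 :=
      ((((ht (x0 + h)).sub (ht x0)).div_const _).sub continuousAt_const).norm
    refine l.tendsto.eventually_lt_const ?_
    rw [sub_self, norm_zero]; positivity
  have near : ∀ t, nsq a b (p2 t) ≤ M → ∀ x, x ∈ Icc a b → |x - x0| < h →
      ‖p1 t x - dq h (p t) x0‖ ≤ ε / 4 := by
    intro t hMt x hx hxh
    rw [norm_sub_rev, ← avg_eq_dq hh.ne' (hd t) (hc1 t), avg_sub_const (hc1 t)]
    refine norm_avg_le fun r hr => ?_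
    have hr1 : 0 ≤ h * r := mul_nonneg hh.le hr.1
    have hr2 : h * r ≤ h := mul_le_of_le_one_right hh.le hr.2
    have key := norm_sub_sq_le_of_nsq (hd1 t) (hc t) hMt hx
      (y := x0 + h * r) ⟨by linarith [hx0.1], by linarith [hhb.2]⟩
    have habs : |x0 + h * r - x| ≤ 2 * h := by
      rw [abs_lt] at hxh
      rw [abs_le]; constructor <;> linarith
    refine (sq_le_sq₀ (norm_nonneg _) (by positivity)).1 ?_
    exact key.trans ((mul_le_mul_of_nonneg_right habs hM0).trans hhM.le)
  rw [nhds_prod_eq]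
  filter_upwards [(hM.and hdq).prod_mk hh2] with z hz
  obtain ⟨⟨z1, z2⟩, z3, z4⟩ := hz
  have e1 := near z.1 z1 z.2 z3 z4
  have e2 := near t0 hM.self_of_nhds x0 ⟨hx0.1.le, hx0.2.le⟩ (by simpa using hh)
  rw [dist_eq_norm]
  have : p1 z.1 z.2 - p1 t0 x0 = (p1 z.1 z.2 - dq h (p z.1) x0)
    + (dq h (p z.1) x0 - dq h (p t0) x0) - (p1 t0 x0 - dq h (p t0) x0) := by ring
  calc ‖Function.uncurry p1 z - Function.uncurry p1 (t0, x0)‖ = _ := congrArg norm this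
    _ ≤ _ := (norm_sub_le _ _).trans (add_le_add_left (norm_add_le _ _) _)
    _ < ε := by linarith

theorem continuousAt_of_continuousAt_deriv {t0 x0 : ℝ} {p p1 : ℝ → ℝ → ℂ}
    (hd : ∀ t x, HasDerivAt (p t) (p1 t x) x) (ht : ContinuousAt (fun t => p t x0) t0)
    (h1 : ContinuousAt (Function.uncurry p1) (t0, x0)) :
    ContinuousAt (Function.uncurry p) (t0, x0) := by
  set M := ‖p1 t0 x0‖ + 1 with hM
  have hb : ∀ᶠ z in 𝓝 (t0, x0), ‖p1 z.1 z.2‖ < M :=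
    h1.norm.tendsto.eventually_lt_const (by simp [hM])
  rw [Metric.eventually_nhds_iff_ball] at hb
  obtain ⟨δ, hδ, hball⟩ := hb
  have hz : Tendsto (fun z : ℝ × ℝ => p z.1 z.2 - p z.1 x0) (𝓝 (t0, x0)) (𝓝 0) := by
    have l : Tendsto (fun z : ℝ × ℝ => M * ‖z.2 - x0‖) (𝓝 (t0, x0)) (𝓝 (M * ‖x0 - x0‖)) :=
      Continuous.tendsto (by fun_prop) (t0, x0)
    rw [sub_self, norm_zero, mul_zero] at l
    refine squeeze_zero_norm' ?_ l
    filter_upwards [Metric.ball_mem_nhds (t0, x0) hδ] with z hzb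
    rw [Metric.mem_ball, Prod.dist_eq, max_lt_iff] at hzb
    refine Convex.norm_image_sub_le_of_norm_hasDerivWithin_le (s := Metric.ball x0 δ)
      (fun x _ => (hd z.1 x).hasDerivWithinAt) (fun x hx => ?_) (convex_ball x0 δ)
      (Metric.mem_ball_self hδ) hzb.2
    exact (hball (z.1, x) (by
      rw [Metric.mem_ball, Prod.dist_eq, max_lt_iff]; exact ⟨hzb.1, hx⟩)).le
  have h2 : Tendsto (fun z : ℝ × ℝ => p z.1 x0) (𝓝 (t0, x0)) (𝓝 (p t0 x0)) :=
    ht.tendsto.comp (Continuous.tendsto (f := Prod.fst) continuous_fst (t0, x0))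
  have h3 := hz.add h2
  simp only [sub_add_cancel, zero_add] at h3
  exact h3

end JointContinuity

section History

theorem nonpos_of_history {g : ℝ → ℝ} {s r : ℝ} (hg : ContinuousOn g (Icc s r)) (hs : g s ≤ 0)
    (step : ∀ u ∈ Ico s r, (∀ v ∈ Icc s u, g v ≤ 0) → ∀ᶠ v in 𝓝[>] u, v ≤ r → g v ≤ 0) :
    ∀ t ∈ Icc s r, g t ≤ 0 := by
  by_contra! hcon
  obtain ⟨x, hx, hgx⟩ := hcon
  set S := {v | v ∈ Icc s r ∧ 0 < g v} with hS
  have hne : S.Nonempty := ⟨x, hx, hgx⟩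
  have hbd : BddBelow S := ⟨s, fun y hy => hy.1.1⟩
  set u := sInf S with hu
  have hsu : s ≤ u := le_csInf hne fun y hy => hy.1.1
  have hux : u ≤ x := csInf_le hbd ⟨hx, hgx⟩
  have hur : u ≤ r := hux.trans hx.2
  have hlt : ∀ v ∈ Icc s u, v < u → g v ≤ 0 := fun v hv hvu => by
    by_contra hpos
    exact notMem_of_lt_csInf hvu hbd ⟨⟨hv.1, hv.2.trans hur⟩, not_le.1 hpos⟩
  have hgu : g u ≤ 0 := by
    by_contra hpos
    have hsu' : s < u := lt_of_le_of_ne hsu fun h => hpos (h ▸ hs)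
    have hev : ∀ᶠ v in 𝓝[Ioo s u] u, 0 < g v :=
      ((hg u ⟨hsu, hur⟩).mono (fun v hv => ⟨hv.1.le, hv.2.le.trans hur⟩)).eventually
        (lt_mem_nhds (not_le.1 hpos))
    have : (𝓝[Ioo s u] u).NeBot := by
      rw [← mem_closure_iff_nhdsWithin_neBot, closure_Ioo hsu'.ne]
      exact ⟨hsu, le_rfl⟩
    obtain ⟨v, h1, h2⟩ := (hev.and self_mem_nhdsWithin).exists
    exact absurd h1 (not_lt.2 (hlt v ⟨h2.1.le, h2.2.le⟩ h2.2))
  have hur' : u < r := by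
    refine lt_of_le_of_ne hur fun h => ?_
    have : x = u := le_antisymm (h ▸ hx.2) hux
    exact absurd hgx (not_lt.2 (this ▸ hgu))
  have hst := step u ⟨hsu, hur'⟩ fun v hv => by
    rcases hv.2.lt_or_eq with h | h
    · exact hlt v hv h
    · exact h ▸ hgu
  obtain ⟨w, hw, hsub⟩ := mem_nhdsGT_iff_exists_Ioo_subset.1 hst
  obtain ⟨y, hy, hyw⟩ := exists_lt_of_csInf_lt hne (show sInf S < w from hw)
  have huy : u < y := lt_of_le_of_ne (csInf_le hbd hy) fun h => absurd hy.2 (not_lt.2 (h ▸ hgu))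
  exact absurd hy.2 (not_lt.2 (hsub ⟨huy, hyw⟩ hy.1.2))

end History

section Gaps

theorem integral_norm_add_sq_le {X : Type*} [MeasurableSpace X] {μ : Measure X} {f g : X → ℂ}
    {C α β : ℝ} (hα : 0 < α) (hβ : 0 < β) (hf : Integrable (fun x => ‖f x‖ ^ 2) μ)
    (hg : Integrable (fun x => ‖g x‖ ^ 2) μ) (hfg : Integrable (fun x => ‖f x + g x‖ ^ 2) μ)
    (h1 : ∫ x, ‖f x‖ ^ 2 ∂μ ≤ C * α ^ 2) (h2 : ∫ x, ‖g x‖ ^ 2 ∂μ ≤ C * β ^ 2) :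
    ∫ x, ‖f x + g x‖ ^ 2 ∂μ ≤ C * (α + β) ^ 2 := by
  have h3 : ∫ x, ‖f x + g x‖ ^ 2 ∂μ ≤ ∫ x, ((1 + β / α) * ‖f x‖ ^ 2
      + (1 + α / β) * ‖g x‖ ^ 2) ∂μ := by
    refine integral_mono hfg ((hf.const_mul _).add (hg.const_mul _)) fun x => ?_
    have e1 := pow_le_pow_left₀ (norm_nonneg _) (norm_add_le (f x) (g x)) 2
    refine e1.trans ?_
    have e2 : (1 + β / α) * ‖f x‖ ^ 2 + (1 + α / β) * ‖g x‖ ^ 2 - (‖f x‖ + ‖g x‖) ^ 2 =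
        (β * ‖f x‖ - α * ‖g x‖) ^ 2 / (α * β) := by field_simp; ring
    have : 0 ≤ (β * ‖f x‖ - α * ‖g x‖) ^ 2 / (α * β) := by positivity
    linarith
  rw [integral_add (hf.const_mul _) (hg.const_mul _), integral_const_mul, integral_const_mul] at h3
  have e1 := mul_le_mul_of_nonneg_left h1 (by positivity : 0 ≤ 1 + β / α)
  have e2 := mul_le_mul_of_nonneg_left h2 (by positivity : 0 ≤ 1 + α / β)
  have e3 : (1 + β / α) * (C * α ^ 2) + (1 + α / β) * (C * β ^ 2) = C * (α + β) ^ 2 := by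
    field_simp; ring
  linarith

/-- A function that is differentiable in time with bounded derivative on a closed set of times,
and `L²`-Lipschitz across the gaps of this set, is `L²`-Lipschitz. -/
theorem nsq_sub_le_of_gaps {a b s r K N M : ℝ} (hab : a ≤ b) (hsr : s ≤ r) (hK : 0 ≤ K)
    {T : Set ℝ} {q qt : ℝ → ℝ → ℂ} (hT : IsClosed T) (hs : s ∈ T) (hq : ∀ t, Continuous (q t))
    (hd : ∀ x t, HasDerivAt (fun t => q t x) (qt t x) t) (hct : ∀ x, Continuous fun t => qt t x)
    (hM : ∀ t ∈ Icc s r, ∀ x ∈ Icc a b, ‖q t x‖ ≤ M)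
    (hN : ∀ t ∈ T ∩ Icc s r, ∀ x ∈ Icc a b, ‖qt t x‖ ≤ N)
    (hgap : ∀ t ∈ Ioc s r, t ∉ T → ∃ t1 ∈ T ∩ Ico s t,
      nsq a b (fun x => q t x - q t1 x) ≤ K * (t - t1) ^ 2) :
    ∀ t ∈ Icc s r, nsq a b (fun x => q t x - q s x) ≤
      (K + (N + 1) ^ 2 * (b - a)) * (t - s) ^ 2 := by
  intro t ht
  have hba : 0 ≤ b - a := sub_nonneg.2 hab
  have hN0 : 0 ≤ N := (norm_nonneg _).trans (hN s ⟨hs, le_rfl, hsr⟩ a ⟨le_rfl, hab⟩)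
  set C := K + (N + 1) ^ 2 * (b - a) with hC
  have hKC : K ≤ C := by rw [hC]; linarith [mul_nonneg (sq_nonneg (N + 1)) hba]
  have hNC : (N + 1) ^ 2 * (b - a) ≤ C := by linarith
  set D : ℕ → Set ℝ := fun k => Icc a b ∩ {x | ∀ s' ∈ T ∩ Icc s r, ∀ v ∈ Icc s r,
    |v - s'| ≤ 1 / ((k : ℝ) + 1) → ‖q v x - q s' x‖ ≤ (N + 1) * |v - s'|} with hD
  have hDc : ∀ k, IsClosed (D k) := by
    intro k
    refine isClosed_Icc.inter ?_
    simp only [Set.ofPred_forall]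
    refine isClosed_iInter fun s' => isClosed_iInter fun _ => isClosed_iInter fun v =>
      isClosed_iInter fun _ => isClosed_iInter fun _ => ?_
    exact isClosed_le ((hq v).sub (hq s')).norm continuous_const
  have hDm : Monotone D := by
    intro k l hkl x hx
    refine ⟨hx.1, fun s' hs' v hv h => hx.2 s' hs' v hv (h.trans ?_)⟩
    have : (k : ℝ) ≤ l := by exact_mod_cast hkl
    gcongr
  have hDU : ⋃ k, D k = Icc a b := by
    refine Subset.antisymm (iUnion_subset fun k => inter_subset_left) fun x hx => ?_
    obtain ⟨δ, hδ, huc⟩ := Metric.uniformContinuousOn_iff.1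
      (isCompact_Icc.uniformContinuousOn_of_continuous (hct x).continuousOn (s := Icc s r)) 1
      one_pos
    obtain ⟨k, hk⟩ := exists_nat_one_div_lt hδ
    refine mem_iUnion.2 ⟨k, hx, fun s' hs' v hv h => ?_⟩
    have hsub : uIcc s' v ⊆ Icc s r := by
      rw [← uIcc_of_le hsr] at hs' hv ⊢
      exact uIcc_subset_uIcc hs'.2 hv
    refine Convex.norm_image_sub_le_of_norm_hasDerivWithin_le (s := uIcc s' v)
      (f := fun t => q t x) (fun w _ => (hd x w).hasDerivWithinAt) (fun w hw => ?_)
      (convex_uIcc s' v) left_mem_uIcc right_mem_uIcc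
    have h1 : |w - s'| ≤ |v - s'| := abs_sub_left_of_mem_uIcc hw
    have h2 := huc w (hsub hw) s' hs'.2 (by rw [Real.dist_eq]; linarith)
    rw [dist_eq_norm] at h2
    have h3 := norm_sub_norm_le (qt w x) (qt s' x)
    linarith [hN s' hs' x hx]
  have hint : ∀ k u v, IntegrableOn (fun x => ‖q u x - q v x‖ ^ 2) (D k) := fun k u v =>
    (Continuous.integrableOn_Icc (by have := hq u; have := hq v; fun_prop)).mono_set
      (inter_subset_left : D k ⊆ Icc a b)
  have hset : ∀ u v, nsq a b (fun x => q u x - q v x) = ∫ x in Icc a b, ‖q u x - q v x‖ ^ 2 := by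
    intro u v
    rw [nsq, intervalIntegral.integral_of_le hab, integral_Icc_eq_integral_Ioc]
  have hle : ∀ k u v, ∫ x in D k, ‖q u x - q v x‖ ^ 2 ≤ nsq a b (fun x => q u x - q v x) := by
    intro k u v
    rw [hset]
    exact setIntegral_mono_set (Continuous.integrableOn_Icc
      (by have := hq u; have := hq v; fun_prop)) (Eventually.of_forall fun x => by positivity)
      (Eventually.of_forall (inter_subset_left : D k ⊆ Icc a b))
  have htri : ∀ k v w, s ≤ w → w < v → ∫ x in D k, ‖q w x - q s x‖ ^ 2 ≤ C * (w - s) ^ 2 →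
      ∫ x in D k, ‖q v x - q w x‖ ^ 2 ≤ C * (v - w) ^ 2 →
      ∫ x in D k, ‖q v x - q s x‖ ^ 2 ≤ C * (v - s) ^ 2 := by
    intro k v w hsw hwv h1 h2
    rcases hsw.eq_or_lt with rfl | hsw
    · exact h2
    · have e1 : ∀ x, q v x - q w x + (q w x - q s x) = q v x - q s x := fun x => by ring
      have := integral_norm_add_sq_le (sub_pos.2 hwv) (sub_pos.2 hsw) (hint k v w) (hint k w s)
        (by simp only [e1]; exact hint k v s) h2 h1
      simp only [e1] at this
      rwa [sub_add_sub_cancel] at this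
  have hDk : ∀ k, ∀ v ∈ Icc s r, (∫ x in D k, ‖q v x - q s x‖ ^ 2) - C * (v - s) ^ 2 ≤ 0 := by
    intro k
    refine nonpos_of_history (ContinuousOn.sub ?_ (by fun_prop)) (by simp) ?_
    · have hM2 : ∀ v ∈ Icc s r, ∀ x ∈ Icc a b, ‖q v x - q s x‖ ≤ 2 * M := fun v hv x hx => by
        refine (norm_sub_le _ _).trans ?_
        linarith [hM v hv x hx, hM s ⟨le_rfl, hsr⟩ x hx]
      refine continuousOn_of_dominated (bound := fun _ => (2 * M) ^ 2)
        (fun v _ => (hint k v s).aestronglyMeasurable) (fun v hv => ?_) ?_ ?_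
      · refine (ae_restrict_iff' (hDc k).measurableSet).2 (Eventually.of_forall fun x hx => ?_)
        rw [norm_pow, norm_norm]
        exact pow_le_pow_left₀ (norm_nonneg _) (hM2 v hv x hx.1) 2
      · exact (continuous_const.integrableOn_Icc).mono_set (inter_subset_left : D k ⊆ Icc a b)
      · refine Eventually.of_forall fun x => Continuous.continuousOn ?_
        have : Continuous fun v => q v x :=
          continuous_iff_continuousAt.2 fun v => (hd x v).continuousAt
        fun_prop
    · intro u hu hist
      have hist' : ∀ w ∈ Icc s u, ∫ x in D k, ‖q w x - q s x‖ ^ 2 ≤ C * (w - s) ^ 2 :=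
        fun w hw => by linarith [hist w hw]
      by_cases huT : u ∈ T
      · have hk0 : (0 : ℝ) < 1 / ((k : ℝ) + 1) := by positivity
        filter_upwards [Ioo_mem_nhdsGT (show u < u + 1 / ((k : ℝ) + 1) by linarith)] with v hv hvr
        have huv : 0 < v - u := sub_pos.2 hv.1
        have h2 : ∫ x in D k, ‖q v x - q u x‖ ^ 2 ≤ C * (v - u) ^ 2 := by
          have hb : ∀ x ∈ D k, ‖q v x - q u x‖ ^ 2 ≤ ((N + 1) * (v - u)) ^ 2 := by
            intro x hx
            refine pow_le_pow_left₀ (norm_nonneg _) ?_ 2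
            have := hx.2 u ⟨huT, hu.1, hu.2.le⟩ v ⟨hu.1.trans hv.1.le, hvr⟩
              (by rw [abs_of_pos huv]; linarith [hv.2])
            rwa [abs_of_pos huv] at this
          have h3 : ∫ x in D k, ‖q v x - q u x‖ ^ 2 ≤ ∫ _ in D k, ((N + 1) * (v - u)) ^ 2 :=
            setIntegral_mono_on (hint k v u) ((continuous_const.integrableOn_Icc).mono_set
              (inter_subset_left : D k ⊆ Icc a b)) (hDc k).measurableSet hb
          have h4 : ∫ _ in D k, ((N + 1) * (v - u)) ^ 2 ≤ ∫ _ in Icc a b, ((N + 1) * (v - u)) ^ 2 :=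
            setIntegral_mono_set continuous_const.integrableOn_Icc
              (Eventually.of_forall fun x => by positivity)
              (Eventually.of_forall (inter_subset_left : D k ⊆ Icc a b))
          have h5 : ∫ _ in Icc a b, ((N + 1) * (v - u)) ^ 2 = (b - a) * ((N + 1) * (v - u)) ^ 2 := by
            simp [hab]
          have h6 : (N + 1) ^ 2 * (b - a) * (v - u) ^ 2 ≤ C * (v - u) ^ 2 := by gcongr
          linarith
        have := htri k v u hu.1 hv.1 (hist' u ⟨hu.1, le_rfl⟩) h2
        linarith
      · have hTc : Tᶜ ∈ 𝓝 u := hT.isOpen_compl.mem_nhds huT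
        obtain ⟨ε, hε, hball⟩ := Metric.mem_nhds_iff.1 hTc
        filter_upwards [Ioo_mem_nhdsGT (show u < u + ε by linarith)] with v hv hvr
        have hin : ∀ w, u ≤ w → w ≤ v → w ∉ T := fun w h1 h2 => hball (by
          rw [Metric.mem_ball, Real.dist_eq, abs_lt]; constructor <;> linarith [hv.2])
        obtain ⟨t1, ⟨ht1T, ht1⟩, hgapv⟩ := hgap v ⟨hu.1.trans_lt hv.1, hvr⟩ (hin v hv.1.le le_rfl)
        have ht1u : t1 ≤ u := by
          by_contra h
          exact hin t1 (not_le.1 h).le ht1.2.le ht1T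
        have := htri k v t1 ht1.1 ht1.2 (hist' t1 ⟨ht1.1, ht1u⟩)
          ((hle k v t1).trans (hgapv.trans (by gcongr)))
        linarith
  have hlim := tendsto_setIntegral_of_monotone (μ := volume) (f := fun x => ‖q t x - q s x‖ ^ 2)
    (fun k => (hDc k).measurableSet) hDm (by
      rw [hDU]; exact Continuous.integrableOn_Icc (by have := hq t; have := hq s; fun_prop))
  rw [hDU, ← hset] at hlim
  exact le_of_tendsto' hlim fun k => by linarith [hDk k t ht]

end Gaps

section Strips

variable {κ d e : ℝ} {p p1 p2 p3 pt : ℝ → ℝ → ℂ}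

theorem exists_bound_third_of_le {a b A n L : ℝ} (hab : a < b) (hL : 0 ≤ L) :
    ∃ M, ∀ {f f1 f2 f3 : ℝ → ℂ}, Jet f f1 f2 f3 → (∀ x ∈ Icc a b, ‖f x‖ ≤ A) →
      (∀ x ∈ Icc a b, ‖f3 x‖ ≤ n + L * ‖f1 x‖) → ∀ x ∈ Icc a b, ‖f3 x‖ ≤ M := by
  obtain ⟨l, hl, hlb, hlL⟩ : ∃ l, 0 < l ∧ 4 * l ≤ b - a ∧ L * (2 * l ^ 2) ≤ 1 / 2 := by
    have h1 : Tendsto (fun l : ℝ => 4 * l) (𝓝 0) (𝓝 (4 * 0)) := Continuous.tendsto (by fun_prop) 0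
    have h2 : Tendsto (fun l : ℝ => L * (2 * l ^ 2)) (𝓝 0) (𝓝 (L * (2 * 0 ^ 2))) :=
      Continuous.tendsto (by fun_prop) 0
    have h3 := (h1.eventually_le_const (u := b - a) (by simpa using hab)).and
      (h2.eventually_le_const (u := 1 / 2) (by norm_num))
    obtain ⟨l, ⟨hl1, hl2⟩, hl⟩ := ((h3.filter_mono nhdsWithin_le_nhds).and
      (self_mem_nhdsWithin (a := (0 : ℝ)) (s := Ioi 0))).exists
    exact ⟨l, hl, hl1, hl2⟩
  refine ⟨2 * (n + L * (6 * A / l)), fun {f f1 f2 f3} j hf hf3 => ?_⟩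
  obtain ⟨y, hy, hmax⟩ := isCompact_Icc.exists_isMaxOn (nonempty_Icc.2 hab.le)
    j.c3.norm.continuousOn
  have hM : ∀ x ∈ Icc a b, ‖f3 x‖ ≤ ‖f3 y‖ := fun x hx => hmax hx
  have h1 := (j.interpolation hf hM hl hlb hy).2
  have h2 := (hf3 y hy).trans (add_le_add_right (mul_le_mul_of_nonneg_left h1 hL) n)
  have h3 := mul_le_mul_of_nonneg_right hlL (norm_nonneg (f3 y))
  intro x hx
  refine (hM x hx).trans ?_
  nlinarith

theorem exists_bound_of_thirdDiffBound {a b A m : ℝ} (hab : a < b) (hA : 0 ≤ A) (hm : 0 ≤ m) :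
    ∃ M, 0 ≤ M ∧ ∀ {f f1 f2 f3 : ℝ → ℂ}, Jet f f1 f2 f3 → (∀ x ∈ Icc a b, ‖f x‖ ≤ A) →
      ThirdDiffBound a b m f → ∀ x ∈ Icc a b,
        ‖f x‖ ≤ M ∧ ‖f1 x‖ ≤ M ∧ ‖f2 x‖ ≤ M ∧ ‖f3 x‖ ≤ M := by
  set l := (b - a) / 4 with hl
  have hl0 : 0 < l := by rw [hl]; linarith
  have e1 : 0 ≤ 4 * A / l ^ 2 := by positivity
  have e2 : 0 ≤ 2 * l * m := by positivity
  have e3 : 0 ≤ 6 * A / l := by positivity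
  have e4 : 0 ≤ 2 * l ^ 2 * m := by positivity
  refine ⟨A + m + (4 * A / l ^ 2 + 2 * l * m) + (6 * A / l + 2 * l ^ 2 * m), by positivity,
    fun {f f1 f2 f3} j hf ht x hx => ?_⟩
  have hM : ∀ x ∈ Icc a b, ‖f3 x‖ ≤ m := fun x hx => j.norm_le_of_thirdDiffBound hab ht hx
  obtain ⟨h1, h2⟩ := j.interpolation hf hM hl0 (by rw [hl]; linarith) hx
  have h3 := hf x hx
  have h4 := hM x hx
  refine ⟨?_, ?_, ?_, ?_⟩ <;> linarith

theorem SepSol.continuousAt_of_thirdDiffBound (S : SepSol κ d e p p1 p2 p3 pt) {a b A m t : ℝ}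
    (hA : ∀ᶠ s in 𝓝 t, ∀ x ∈ Icc a b, ‖p s x‖ ≤ A)
    (hm : ∀ᶠ s in 𝓝 t, ThirdDiffBound a b m (p s)) {x : ℝ} (hx : x ∈ Ioo a b) :
    ContinuousAt (Function.uncurry p1) (t, x) := by
  have hab : a < b := hx.1.trans hx.2
  have hA0 : 0 ≤ A := (norm_nonneg _).trans (hA.self_of_nhds x ⟨hx.1.le, hx.2.le⟩)
  obtain ⟨M, hM0, hM⟩ := exists_bound_of_thirdDiffBound (m := max m 0) hab hA0 (le_max_right _ _)
  refine continuousAt_deriv_of_nsq_bounded (M := M ^ 2 * (b - a)) (fun t => (S.jet t).d0)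
    (fun t => (S.jet t).d1) (fun t => (S.jet t).cont2) (fun x => (S.dt x t).continuousAt) ?_ hx
  filter_upwards [hA, hm] with s hs hs'
  refine nsq_le_of_bound hab.le (S.jet s).cont2 fun x hx => ?_
  have hs2 : ThirdDiffBound a b (max m 0) (p s) := fun y h hh hy hyh =>
    (hs' y h hh hy hyh).trans (by gcongr; exact le_max_left _ _)
  exact pow_le_pow_left₀ (norm_nonneg _) (hM (S.jet s) hs hs2 x hx).2.2.1 2

theorem SepSol.norm_third_le (S : SepSol κ d e p p1 p2 p3 pt) {t x A n : ℝ}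
    (hc : ContinuousAt (Function.uncurry p1) (t, x)) (hA : ‖p t x‖ ≤ A) (hn : ‖pt t x‖ ≤ n) :
    ‖p3 t x‖ ≤ n + (|κ| + |d| + |e|) * (1 + A ^ 2) * ‖p1 t x‖ := by
  have h1 := S.pde t x hc
  have h2 : p3 t x = nl κ d e (p t x) (p1 t x) - pt t x := by rw [h1]; ring
  have h3 := norm_nl_le κ d e (p t x) (p1 t x)
  have h4 : (|κ| + |d| + |e|) * (1 + ‖p t x‖ ^ 2) * ‖p1 t x‖ ≤
      (|κ| + |d| + |e|) * (1 + A ^ 2) * ‖p1 t x‖ := by gcongr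
  rw [h2]
  refine (norm_sub_le _ _).trans ?_
  linarith

theorem SepSol.norm_time_le_of_lip (S : SepSol κ d e p p1 p2 p3 pt) {t x n T1 T2 : ℝ}
    (hn : 0 ≤ n) (ht : t ∈ Ioo T1 T2)
    (h : ∀ s ∈ Icc T1 T2, ‖p s x - p t x‖ ≤ n * |s - t|) : ‖pt t x‖ ≤ n := by
  refine (S.dt x t).le_of_lip' hn ?_
  filter_upwards [Icc_mem_nhds ht.1 ht.2] with s hs
  exact h s hs

theorem SepSol.exists_lipschitz_strip (S : SepSol κ d e p p1 p2 p3 pt) {α β : ℝ} (hαβ : α < β)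
    (T1 T2 : ℝ) : ∃ α' β' n, α < α' ∧ α' < β' ∧ β' < β ∧ 0 ≤ n ∧
      ∀ x ∈ Icc α' β', ∀ s ∈ Icc T1 T2, ∀ t ∈ Icc T1 T2, ‖p t x - p s x‖ ≤ n * |t - s| := by
  let F : ℕ → Set ℝ := fun n => {x | ∀ s ∈ Icc T1 T2, ∀ t ∈ Icc T1 T2,
    ‖p t x - p s x‖ ≤ n * |t - s|}
  have hF : ∀ n, IsClosed (F n) := fun n => by
    have hc : ∀ t, Continuous fun x => p t x := fun t => S.cont t
    simp only [F, Set.ofPred_forall]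
    refine isClosed_iInter fun s => isClosed_iInter fun _ => isClosed_iInter fun t =>
      isClosed_iInter fun _ => isClosed_le ?_ continuous_const
    exact ((hc t).sub (hc s)).norm
  have hcov : ∀ x ∈ Ioo α β ∩ univ, ∃ n, x ∈ F n := fun x _ => by
    obtain ⟨C, hC⟩ := isCompact_Icc.exists_bound_of_continuousOn (S.ct x).continuousOn
      (s := Icc T1 T2)
    obtain ⟨n, hn⟩ := exists_nat_ge C
    refine ⟨n, fun s hs t ht => ?_⟩
    refine (Convex.norm_image_sub_le_of_norm_hasDerivWithin_le (s := Icc T1 T2) (C := C)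
      (fun r _ => (S.dt x r).hasDerivWithinAt) hC (convex_Icc _ _) hs ht).trans ?_
    rw [Real.norm_eq_abs]
    gcongr
  obtain ⟨n, U, hUV, hU, ⟨y, hyU, -⟩, hUF⟩ := exists_open_inter_subset_of_closed_cover isClosed_univ
    isOpen_Ioo (by simpa using hαβ) hF hcov
  obtain ⟨ε, hε, hball⟩ := Metric.isOpen_iff.1 hU y hyU
  rw [Real.ball_eq_Ioo] at hball
  have hsub : ∀ x ∈ Icc (y - ε / 2) (y + ε / 2), x ∈ U := fun x hx =>
    hball ⟨by linarith [hx.1], by linarith [hx.2]⟩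
  refine ⟨y - ε / 2, y + ε / 2, n, ?_, by linarith, ?_, Nat.cast_nonneg n,
    fun x hx => hUF ⟨hsub x hx, mem_univ _⟩⟩
  · exact (hUV (hsub _ ⟨le_rfl, by linarith⟩)).1
  · exact (hUV (hsub _ ⟨by linarith, le_rfl⟩)).2

/-- Every strip contains a smaller strip on which the solution is controlled on a given time
interval. -/
theorem SepSol.exists_strip (S : SepSol κ d e p p1 p2 p3 pt) {α β T1 T2 : ℝ} (hαβ : α < β)
    (hT : T1 < T2) : ∃ α' β' M, α < α' ∧ α' < β' ∧ β' < β ∧ 0 ≤ M ∧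
      (∀ t ∈ Icc T1 T2, ∀ x ∈ Icc α' β',
        ‖p t x‖ ≤ M ∧ ‖p1 t x‖ ≤ M ∧ ‖p2 t x‖ ≤ M ∧ ‖p3 t x‖ ≤ M) ∧
      (∀ x ∈ Icc α' β', ∀ s ∈ Icc T1 T2, ∀ t ∈ Icc T1 T2, ‖p t x - p s x‖ ≤ M * |t - s|) ∧
      ∀ t ∈ Ioo T1 T2, ∀ x ∈ Icc α' β', ContinuousAt (Function.uncurry p1) (t, x) := by
  obtain ⟨α1, β1, n, hα1, hαβ1, hβ1, hn, hlip⟩ := S.exists_lipschitz_strip hαβ T1 T2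
  obtain ⟨C, hC⟩ := isCompact_Icc.exists_bound_of_continuousOn (S.cont T1).continuousOn
    (s := Icc α1 β1)
  have hC0 : 0 ≤ C := (norm_nonneg _).trans (hC α1 ⟨le_rfl, hαβ1.le⟩)
  set A := C + n * (T2 - T1) with hAdef
  have hA0 : 0 ≤ A := by have := mul_nonneg hn (sub_nonneg.2 hT.le); linarith
  have hA : ∀ t ∈ Icc T1 T2, ∀ x ∈ Icc α1 β1, ‖p t x‖ ≤ A := fun t ht x hx => by
    have h1 := hlip x hx T1 ⟨le_rfl, hT.le⟩ t ht
    rw [abs_of_nonneg (sub_nonneg.2 ht.1)] at h1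
    have h2 : n * (t - T1) ≤ n * (T2 - T1) := by gcongr; exact ht.2
    have h3 : ‖p t x‖ ≤ ‖p t x - p T1 x‖ + ‖p T1 x‖ := by
      simpa using norm_add_le (p t x - p T1 x) (p T1 x)
    linarith [hC x hx]
  set η := (β1 - α1) / 6 with hη
  have hη0 : 0 < η := by rw [hη]; linarith
  have hsub1 : ∀ x ∈ Icc (α1 + η) (β1 - η), x ∈ Ioo α1 β1 := fun x hx =>
    ⟨by linarith [hx.1], by linarith [hx.2]⟩
  have hab2 : α1 + η < β1 - η := by linarith
  obtain ⟨M3, hM3⟩ := exists_bound_third_of_le (a := α1 + η) (b := β1 - η) (n := n)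
    (L := (|κ| + |d| + |e|) * (1 + A ^ 2)) hab2 (by positivity)
  have hD : ∀ t ∈ Icc T1 T2, ThirdDiffBound (α1 + η) (β1 - η) (max M3 0) (p t) := by
    set D := {t | ThirdDiffBound (α1 + η) (β1 - η) (max M3 0) (p t)} with hDdef
    have hDc : IsClosed D := isClosed_thirdDiffBound _ _ _ fun x =>
      continuous_iff_continuousAt.2 fun t => (S.dt x t).continuousAt
    have hIoo : Ioo T1 T2 ⊆ D := by
      by_contra hcon
      rw [Set.not_subset] at hcon
      obtain ⟨t0, ht0, ht0D⟩ := hcon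
      obtain ⟨m, U, hUV, hU, ⟨y, hyU, -⟩, hUF⟩ := exists_open_inter_subset_of_closed_cover
        (T := (univ : Set ℝ)) (V := Ioo T1 T2 ∩ Dᶜ)
        (F := fun m : ℕ => {t | ThirdDiffBound α1 β1 m (p t)}) isClosed_univ
        (isOpen_Ioo.inter hDc.isOpen_compl) ⟨t0, ⟨ht0, ht0D⟩, mem_univ _⟩
        (fun m => isClosed_thirdDiffBound _ _ _ fun x =>
          continuous_iff_continuousAt.2 fun t => (S.dt x t).continuousAt)
        (fun t _ => by
          obtain ⟨C, hC⟩ := isCompact_Icc.exists_bound_of_continuousOn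
            (S.jet t).c3.continuousOn (s := Icc α1 β1)
          obtain ⟨m, hm⟩ := exists_nat_ge C
          exact ⟨m, (S.jet t).thirdDiffBound fun x hx => (hC x hx).trans hm⟩)
      have hyT := (hUV hyU).1
      refine (hUV hyU).2 ((S.jet y).thirdDiffBound fun x hx => ?_)
      refine (hM3 (S.jet y) (fun x hx => hA y ⟨hyT.1.le, hyT.2.le⟩ x (Ioo_subset_Icc_self
        (hsub1 x hx))) (fun x hx => ?_) x hx).trans (le_max_left _ _)
      refine S.norm_third_le (S.continuousAt_of_thirdDiffBound (A := A) (m := m) ?_ ?_ (hsub1 x hx))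
        (hA y ⟨hyT.1.le, hyT.2.le⟩ x (Ioo_subset_Icc_self (hsub1 x hx)))
        (S.norm_time_le_of_lip hn hyT fun s hs => hlip x (Ioo_subset_Icc_self (hsub1 x hx)) y
          ⟨hyT.1.le, hyT.2.le⟩ s hs)
      · filter_upwards [Icc_mem_nhds hyT.1 hyT.2] with s hs
        exact hA s hs
      · filter_upwards [hU.mem_nhds hyU] with s hs
        exact hUF ⟨hs, mem_univ _⟩
    intro t ht
    rw [← closure_Ioo hT.ne] at ht
    exact closure_minimal hIoo hDc ht
  obtain ⟨M, hM0, hM⟩ := exists_bound_of_thirdDiffBound (m := max M3 0) hab2 hA0 (le_max_right _ _)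
  have hsub2 : ∀ x ∈ Icc (α1 + 2 * η) (β1 - 2 * η), x ∈ Ioo (α1 + η) (β1 - η) := fun x hx =>
    ⟨by linarith [hx.1], by linarith [hx.2]⟩
  refine ⟨α1 + 2 * η, β1 - 2 * η, M + n, by linarith, by linarith, by linarith, by linarith,
    fun t ht x hx => ?_, fun x hx s hs t ht => ?_, fun t ht x hx => ?_⟩
  · have hx2 := Ioo_subset_Icc_self (hsub2 x hx)
    obtain ⟨h0, h1, h2, h3⟩ := hM (S.jet t) (fun x hx => hA t ht x (Ioo_subset_Icc_self
        (hsub1 x hx))) (hD t ht) x hx2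
    refine ⟨?_, ?_, ?_, ?_⟩ <;> linarith
  · refine (hlip x (Ioo_subset_Icc_self (hsub1 x (Ioo_subset_Icc_self (hsub2 x hx)))) s hs t
      ht).trans ?_
    gcongr
    linarith
  · refine S.continuousAt_of_thirdDiffBound (A := A) (m := max M3 0) ?_ ?_ (hsub2 x hx)
    · filter_upwards [Icc_mem_nhds ht.1 ht.2] with s hs x hx
      exact hA s hs x (Ioo_subset_Icc_self (hsub1 x hx))
    · filter_upwards [Icc_mem_nhds ht.1 ht.2] with s hs
      exact hD s hs

end Strips

section Reflection

variable {κ d e : ℝ} {p p1 p2 p3 pt : ℝ → ℝ → ℂ}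

theorem nsq_comp_neg (a b : ℝ) (f : ℝ → ℂ) : nsq (-b) (-a) (fun x => f (-x)) = nsq a b f := by
  simp only [nsq]
  rw [intervalIntegral.integral_comp_neg (fun x => ‖f x‖ ^ 2), neg_neg, neg_neg]

theorem Jet.comp_neg {f f1 f2 f3 : ℝ → ℂ} (j : Jet f f1 f2 f3) :
    Jet (fun x => f (-x)) (fun x => -f1 (-x)) (fun x => f2 (-x)) (fun x => -f3 (-x)) where
  d0 x := by simpa [Function.comp_def] using (j.d0 (-x)).scomp x (hasDerivAt_neg x)
  d1 x := by simpa using ((j.d1 (-x)).scomp x (hasDerivAt_neg x)).fun_neg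
  d2 x := by simpa [Function.comp_def] using (j.d2 (-x)).scomp x (hasDerivAt_neg x)
  c3 := (j.c3.comp continuous_neg).neg

theorem continuousAt_uncurry_neg {f : ℝ → ℝ → ℂ} {t x : ℝ}
    (h : ContinuousAt (Function.uncurry f) (t, x)) :
    ContinuousAt (Function.uncurry fun s y => -f (-s) (-y)) (-t, -x) := by
  have h' : ContinuousAt (Function.uncurry f) (-(-t, -x)) := by simpa using h
  exact (h'.comp (f := fun z : ℝ × ℝ => -z) continuous_neg.continuousAt).neg

/-- The equation is invariant under the reflection `(t, x) ↦ (-t, -x)`. -/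
theorem SepSol.reflect (S : SepSol κ d e p p1 p2 p3 pt) :
    SepSol κ d e (fun t x => p (-t) (-x)) (fun t x => -p1 (-t) (-x)) (fun t x => p2 (-t) (-x))
      (fun t x => -p3 (-t) (-x)) (fun t x => -pt (-t) (-x)) where
  jet t := (S.jet (-t)).comp_neg
  dt x t := by simpa [Function.comp_def] using (S.dt (-x) (-t)).scomp t (hasDerivAt_neg t)
  ct x := ((S.ct (-x)).comp continuous_neg).neg
  pde t x h := by
    have h1 : ContinuousAt (Function.uncurry p1) (-t, -x) := by
      simpa using continuousAt_uncurry_neg h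
    rw [S.pde _ _ h1]
    simp only [nl, map_neg]
    ring

theorem LipAt.reflect {a b t : ℝ} (h : LipAt a b p t) :
    LipAt (-b) (-a) (fun t x => p (-t) (-x)) (-t) := by
  obtain ⟨C, hC⟩ := h
  refine ⟨C, ?_⟩
  have h1 : Tendsto (fun s : ℝ => -s) (𝓝 (-t)) (𝓝 t) := by
    simpa using (continuous_neg (G := ℝ)).tendsto (-t)
  filter_upwards [h1.eventually hC] with s hs
  rw [nsq_comp_neg a b fun x => p (-s) x - p (- -t) x, neg_neg]
  refine hs.trans (le_of_eq ?_)
  ring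

theorem GoodTime.reflect {a b t : ℝ} (h : GoodTime a b p p1 t) :
    GoodTime (-b) (-a) (fun t x => p (-t) (-x)) (fun t x => -p1 (-t) (-x)) (-t) := by
  refine ⟨fun x hx => ?_, h.2.reflect⟩
  have := continuousAt_uncurry_neg (h.1 (-x) ⟨by linarith [hx.2], by linarith [hx.1]⟩)
  rwa [neg_neg] at this

end Reflection

section BadTimes

/-- A closed set `T` of times on which the solution is bounded by `n`, outside of which all times
are good, together with control of the solution along the sides of the region. -/
structure BadTimes (κ d e a A B b n T1 T2 : ℝ) (T : Set ℝ) (p p1 p2 p3 pt : ℝ → ℝ → ℂ) :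
    Prop where
  sol : SepSol κ d e p p1 p2 p3 pt
  aA : a < A
  AB : A < B
  Bb : B < b
  one_le : 1 ≤ n
  strip : ∀ t ∈ Icc T1 T2, ∀ x ∈ Icc a A ∪ Icc B b,
    ‖p t x‖ ≤ n ∧ ‖p1 t x‖ ≤ n ∧ ‖p2 t x‖ ≤ n ∧ ‖p3 t x‖ ≤ n
  lip : ∀ x ∈ Icc a A ∪ Icc B b, ∀ s ∈ Icc T1 T2, ∀ t ∈ Icc T1 T2,
    ‖p t x - p s x‖ ≤ n * |t - s|
  cont : ∀ t ∈ Ioo T1 T2, ∀ x ∈ Icc a A ∪ Icc B b, ContinuousAt (Function.uncurry p1) (t, x)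
  closed : IsClosed T
  good : ∀ t ∈ Ioo T1 T2, t ∉ T → GoodTime a b p p1 t
  bound : ∀ t ∈ T ∩ Icc T1 T2, ∀ x ∈ Icc a b,
    ‖p t x‖ ≤ n ∧ ‖p1 t x‖ ≤ n ∧ ‖p2 t x‖ ≤ n ∧ ‖p3 t x‖ ≤ n

variable {κ d e a A B b n T1 T2 : ℝ} {T : Set ℝ} {p p1 p2 p3 pt : ℝ → ℝ → ℂ}

theorem BadTimes.ab (H : BadTimes κ d e a A B b n T1 T2 T p p1 p2 p3 pt) : a < b := by
  linarith [H.aA, H.AB, H.Bb]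

theorem BadTimes.mono (H : BadTimes κ d e a A B b n T1 T2 T p p1 p2 p3 pt) {S1 S2 : ℝ}
    (h1 : T1 ≤ S1) (h2 : S2 ≤ T2) : BadTimes κ d e a A B b n S1 S2 T p p1 p2 p3 pt :=
  have hI := Icc_subset_Icc h1 h2
  have hO := Ioo_subset_Ioo h1 h2
  { H with
    strip := fun t ht => H.strip t (hI ht)
    lip := fun x hx s hs t ht => H.lip x hx s (hI hs) t (hI ht)
    cont := fun t ht => H.cont t (hO ht)
    good := fun t ht => H.good t (hO ht)
    bound := fun t ht => H.bound t ⟨ht.1, hI ht.2⟩ }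

theorem BadTimes.reflect (H : BadTimes κ d e a A B b n T1 T2 T p p1 p2 p3 pt) :
    BadTimes κ d e (-b) (-B) (-A) (-a) n (-T2) (-T1) ((fun t => -t) ⁻¹' T)
      (fun t x => p (-t) (-x)) (fun t x => -p1 (-t) (-x)) (fun t x => p2 (-t) (-x))
      (fun t x => -p3 (-t) (-x)) (fun t x => -pt (-t) (-x)) where
  sol := H.sol.reflect
  aA := neg_lt_neg H.Bb
  AB := neg_lt_neg H.AB
  Bb := neg_lt_neg H.aA
  one_le := H.one_le
  strip t ht x hx := by
    have hx' : -x ∈ Icc a A ∪ Icc B b := by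
      rcases hx with hx | hx
      · exact Or.inr ⟨by linarith [hx.2], by linarith [hx.1]⟩
      · exact Or.inl ⟨by linarith [hx.2], by linarith [hx.1]⟩
    simpa only [norm_neg] using H.strip (-t) ⟨by linarith [ht.2], by linarith [ht.1]⟩ _ hx'
  lip x hx s hs t ht := by
    have hx' : -x ∈ Icc a A ∪ Icc B b := by
      rcases hx with hx | hx
      · exact Or.inr ⟨by linarith [hx.2], by linarith [hx.1]⟩
      · exact Or.inl ⟨by linarith [hx.2], by linarith [hx.1]⟩
    refine (H.lip _ hx' (-s) ⟨by linarith [hs.2], by linarith [hs.1]⟩ (-t)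
      ⟨by linarith [ht.2], by linarith [ht.1]⟩).trans (le_of_eq ?_)
    rw [show -t - -s = -(t - s) by ring, abs_neg]
  cont t ht x hx := by
    have hx' : -x ∈ Icc a A ∪ Icc B b := by
      rcases hx with hx | hx
      · exact Or.inr ⟨by linarith [hx.2], by linarith [hx.1]⟩
      · exact Or.inl ⟨by linarith [hx.2], by linarith [hx.1]⟩
    have := continuousAt_uncurry_neg (H.cont (-t) ⟨by linarith [ht.2], by linarith [ht.1]⟩ _ hx')
    rwa [neg_neg, neg_neg] at this
  closed := H.closed.preimage continuous_neg
  good t ht htT := by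
    have := (H.good (-t) ⟨by linarith [ht.2], by linarith [ht.1]⟩ htT).reflect
    rwa [neg_neg] at this
  bound t ht x hx := by
    simpa only [norm_neg] using H.bound (-t) ⟨ht.1, by linarith [ht.2.2], by linarith [ht.2.1]⟩
      (-x) ⟨by linarith [hx.2], by linarith [hx.1]⟩

theorem BadTimes.exists_gap (H : BadTimes κ d e a A B b n T1 T2 T p p1 p2 p3 pt) :
    ∃ K τ, 0 ≤ K ∧ 0 < τ ∧ ∀ s ∈ T, ∀ t ∉ T, T1 ≤ s → s < t → t < T2 → t - s < τ →
      ∃ t1 ∈ T ∩ Ico s t, nsq a b (fun x => p t x - p t1 x) ≤ K * (t - t1) ^ 2 ∧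
        nsq a b (p2 t) ≤ K := by
  set σ := min (A - a) (b - B) / 4 with hσ
  have hσ1 : 4 * σ ≤ A - a := by rw [hσ]; linarith [min_le_left (A - a) (b - B)]
  have hσ2 : 4 * σ ≤ b - B := by rw [hσ]; linarith [min_le_right (A - a) (b - B)]
  have hσ0 : 0 < σ := by
    have := lt_min (sub_pos.2 H.aA) (sub_pos.2 H.Bb)
    rw [hσ]; linarith
  obtain ⟨K, τ, hK, hτ, h⟩ := exists_gap_estimate (a := a) (A := A - 2 * σ) (B := B)
    (b := b - 2 * σ) (n := n) (σ := σ) (by linarith) (by linarith [H.AB]) (by linarith) hσ0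
    H.one_le κ d e
  refine ⟨K, τ, hK, hτ, fun s hs t ht hTs hst htT hτt => ?_⟩
  set D := T ∩ Icc s t with hD
  have hDc : IsClosed D := H.closed.inter isClosed_Icc
  have hDb : BddAbove D := ⟨t, fun r hr => hr.2.2⟩
  have hsD : s ∈ D := ⟨hs, le_rfl, hst.le⟩
  have h1 : sSup D ∈ D := hDc.csSup_mem ⟨s, hsD⟩ hDb
  set t1 := sSup D with ht1
  have h1t : t1 < t := lt_of_le_of_ne h1.2.2 fun h => ht (h ▸ h1.1)
  have hgap : ∀ r ∈ Ioc t1 t, r ∉ T := fun r hr hrT =>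
    absurd (le_csSup hDb ⟨hrT, h1.2.1.trans hr.1.le, hr.2⟩) (not_le.2 hr.1)
  obtain ⟨ε, hε, hball⟩ := Metric.isOpen_iff.1 H.closed.isOpen_compl t ht
  rw [Real.ball_eq_Ioo] at hball
  set t2 := min (t + ε) T2 with ht2
  have ht2t : t < t2 := lt_min (by linarith) htT
  have ht2T : t2 ≤ T2 := min_le_right _ _
  have hI : Icc t1 t2 ⊆ Icc T1 T2 := Icc_subset_Icc (hTs.trans h1.2.1) ht2T
  have hstrip : ∀ x ∈ Icc a (A - 2 * σ + 2 * σ) ∪ Icc B (b - 2 * σ + 2 * σ),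
      x ∈ Icc a A ∪ Icc B b := fun x hx => by simpa only [sub_add_cancel] using hx
  have ht1I : t1 ∈ T ∩ Icc T1 T2 := ⟨h1.1, hI ⟨le_rfl, (h1t.trans ht2t).le⟩⟩
  have hini : ∀ x ∈ Icc a (b - 2 * σ + 2 * σ), x ∈ Icc a b := fun x hx => by
    simpa only [sub_add_cancel] using hx
  have G : GapData κ d e a (b - 2 * σ) (A - 2 * σ) B σ n t1 t2 p p1 p2 p3 pt :=
    { sol := H.sol
      aA := by linarith
      AB := by linarith [H.AB]
      Bb := by linarith
      σ_pos := hσ0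
      time := h1t.trans ht2t
      one_le := H.one_le
      good := fun r hr => by
        rw [sub_add_cancel]
        refine H.good r ⟨(hTs.trans h1.2.1).trans_lt hr.1, hr.2.trans_le ht2T⟩ ?_
        by_cases hrt : r ≤ t
        · exact hgap r ⟨hr.1, hrt⟩
        · exact hball ⟨by linarith, hr.2.trans_le (min_le_left _ _)⟩
      s0 := fun r hr x hx => (H.strip r (hI hr) x (hstrip x hx)).1
      s1 := fun r hr x hx => (H.strip r (hI hr) x (hstrip x hx)).2.1
      s2 := fun r hr x hx => (H.strip r (hI hr) x (hstrip x hx)).2.2.1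
      s3 := fun r hr x hx => (H.strip r (hI hr) x (hstrip x hx)).2.2.2
      lip := fun r hr x hx => by
        have := H.lip x (hstrip x hx) t1 ht1I.2 r (hI hr)
        rwa [abs_of_nonneg (sub_nonneg.2 hr.1)] at this
      i0 := fun x hx => (H.bound t1 ht1I x (hini x hx)).1
      i1 := fun x hx => (H.bound t1 ht1I x (hini x hx)).2.1
      i2 := fun x hx => (H.bound t1 ht1I x (hini x hx)).2.2.1
      i3 := fun x hx => (H.bound t1 ht1I x (hini x hx)).2.2.2 }
  have := h G t ⟨h1t, ht2t⟩ (by linarith [h1.2.1])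
  rw [sub_add_cancel] at this
  exact ⟨t1, ⟨h1.1, h1.2.1, h1t⟩, this⟩

theorem BadTimes.eventually_nsq_second_right
    (H : BadTimes κ d e a A B b n T1 T2 T p p1 p2 p3 pt) {s : ℝ} (hs : s ∈ T)
    (hsI : s ∈ Ioo T1 T2) : ∃ K ε, 0 < ε ∧ ∀ t ∈ Ico s (s + ε), nsq a b (p2 t) ≤ K := by
  obtain ⟨K, τ, hK, hτ, h⟩ := H.exists_gap
  refine ⟨max K (n ^ 2 * (b - a)), min τ (T2 - s), lt_min hτ (sub_pos.2 hsI.2), fun t ht => ?_⟩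
  have ht1 := ht.2.trans_le (add_le_add_right (min_le_left _ _) s)
  have ht2 := ht.2.trans_le (add_le_add_right (min_le_right _ _) s)
  by_cases htT : t ∈ T
  · refine (nsq_le_of_bound H.ab.le (H.sol.jet t).cont2 fun x hx => ?_).trans (le_max_right _ _)
    exact pow_le_pow_left₀ (norm_nonneg _) (H.bound t ⟨htT, by linarith [hsI.1, ht.1],
      by linarith⟩ x hx).2.2.1 2
  · have hst : s < t := lt_of_le_of_ne ht.1 fun h => htT (h ▸ hs)
    obtain ⟨t1, -, -, h2⟩ := h s hs t htT hsI.1.le hst (by linarith) (by linarith)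
    exact h2.trans (le_max_left _ _)

theorem BadTimes.exists_continuousAt (H : BadTimes κ d e a A B b n T1 T2 T p p1 p2 p3 pt) {s : ℝ}
    (hs : s ∈ T) (hsI : s ∈ Ioo T1 T2) : ∃ S1 S2, T1 ≤ S1 ∧ S2 ≤ T2 ∧ s ∈ Ioo S1 S2 ∧
      ∀ t ∈ Ioo S1 S2, ∀ x ∈ Icc a b, ContinuousAt (Function.uncurry p1) (t, x) := by
  obtain ⟨K, ε, hε, h⟩ := H.eventually_nsq_second_right hs hsI
  obtain ⟨K', ε', hε', h'⟩ := H.reflect.eventually_nsq_second_right (s := -s) (by simpa using hs)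
    ⟨by linarith [hsI.2], by linarith [hsI.1]⟩
  refine ⟨max T1 (s - ε'), min T2 (s + ε), le_max_left _ _, min_le_left _ _,
    ⟨max_lt hsI.1 (by linarith), lt_min hsI.2 (by linarith)⟩, fun t ht x hx => ?_⟩
  have ht1 := (max_lt_iff.1 ht.1)
  have ht2 := (lt_min_iff.1 ht.2)
  by_cases hxA : x ≤ A
  · exact H.cont t ⟨ht1.1, ht2.1⟩ x (Or.inl ⟨hx.1, hxA⟩)
  by_cases hxB : B ≤ x
  · exact H.cont t ⟨ht1.1, ht2.1⟩ x (Or.inr ⟨hxB, hx.2⟩)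
  refine continuousAt_deriv_of_nsq_bounded (M := max K K') (fun t => (H.sol.jet t).d0)
    (fun t => (H.sol.jet t).d1) (fun t => (H.sol.jet t).cont2)
    (fun x => (H.sol.dt x t).continuousAt) ?_
    (a := a) (b := b) ⟨by linarith [H.aA], by linarith [H.Bb]⟩
  filter_upwards [Ioo_mem_nhds ht1.2 ht2.2] with r hr
  by_cases hrs : s ≤ r
  · exact (h r ⟨hrs, hr.2⟩).trans (le_max_left _ _)
  · have := h' (-r) ⟨by linarith, by linarith [hr.1]⟩
    rw [nsq_comp_neg a b fun x => p2 (- -r) x, neg_neg] at this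
    exact this.trans (le_max_right _ _)

theorem BadTimes.exists_lip_right (H : BadTimes κ d e a A B b n T1 T2 T p p1 p2 p3 pt)
    (hc : ∀ t ∈ Ioo T1 T2, ∀ x ∈ Icc a b, ContinuousAt (Function.uncurry p1) (t, x)) {s : ℝ}
    (hs : s ∈ T) (hsI : s ∈ Ioo T1 T2) :
    ∃ C ε, 0 < ε ∧ ∀ t ∈ Icc s (s + ε), nsq a b (fun x => p t x - p s x) ≤ C * (t - s) ^ 2 := by
  obtain ⟨K, τ, hK, hτ, h⟩ := H.exists_gap
  have hlt : 0 < min τ (T2 - s) := lt_min hτ (sub_pos.2 hsI.2)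
  set ε := min τ (T2 - s) / 2 with hε
  have hε1 : ε < τ := by linarith [min_le_left τ (T2 - s)]
  have hε2 : s + ε < T2 := by linarith [min_le_right τ (T2 - s)]
  have hε0 : 0 < ε := by linarith
  have hIcc : ∀ t ∈ Icc s (s + ε), t ∈ Ioo T1 T2 := fun t ht =>
    ⟨by linarith [ht.1, hsI.1], by linarith [ht.2]⟩
  obtain ⟨M, hM⟩ := (isCompact_Icc (a := s) (b := s + ε)).prod (isCompact_Icc (a := a) (b := b))
    |>.exists_bound_of_continuousOn (f := Function.uncurry p) fun z hz =>
      (continuousAt_of_continuousAt_deriv (fun t => (H.sol.jet t).d0)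
        (H.sol.dt z.2 z.1).continuousAt (hc z.1 (hIcc _ hz.1) z.2 hz.2)).continuousWithinAt
  refine ⟨_, ε, hε0, nsq_sub_le_of_gaps (K := K) (M := M)
    (N := n + (|κ| + |d| + |e|) * (1 + n ^ 2) * n) H.ab.le (by linarith) hK H.closed hs H.sol.cont
    H.sol.dt H.sol.ct (fun t ht x hx => hM (t, x) ⟨ht, hx⟩) (fun t ht x hx => ?_)
    (fun t ht htT => ?_)⟩
  · obtain ⟨h0, h1, h2, h3⟩ := H.bound t ⟨ht.1, Ioo_subset_Icc_self (hIcc t ht.2)⟩ x hx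
    rw [H.sol.pde t x (hc t (hIcc t ht.2) x hx)]
    refine (norm_add_le _ _).trans ?_
    rw [norm_neg]
    refine add_le_add h3 ((norm_nl_le κ d e _ _).trans ?_)
    gcongr
  · obtain ⟨t1, h1, h2, -⟩ := h s hs t htT hsI.1.le ht.1 (by linarith [ht.2]) (by linarith [ht.2])
    exact ⟨t1, h1, h2⟩

theorem BadTimes.eventually_good (H : BadTimes κ d e a A B b n T1 T2 T p p1 p2 p3 pt) {s : ℝ}
    (hs : s ∈ T) (hsI : s ∈ Ioo T1 T2) : ∀ᶠ t in 𝓝 s, GoodTime a b p p1 t := by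
  obtain ⟨S1, S2, h1, h2, hsS, hc⟩ := H.exists_continuousAt hs hsI
  have H' := H.mono h1 h2
  filter_upwards [Ioo_mem_nhds hsS.1 hsS.2] with t ht
  by_cases htT : t ∈ T
  swap
  · exact H'.good t ht htT
  obtain ⟨C, ε, hε, h⟩ := H'.exists_lip_right hc htT ht
  obtain ⟨C', ε', hε', h'⟩ := H'.reflect.exists_lip_right (s := -t) (fun r hr x hx => by
    have := continuousAt_uncurry_neg (hc (-r) ⟨by linarith [hr.2], by linarith [hr.1]⟩ (-x)
      ⟨by linarith [hx.2], by linarith [hx.1]⟩)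
    rwa [neg_neg, neg_neg] at this) (by simpa using htT)
    ⟨by linarith [ht.2], by linarith [ht.1]⟩
  refine ⟨hc t ht, max C C', ?_⟩
  filter_upwards [Icc_mem_nhds (show t - ε' < t by linarith) (show t < t + ε by linarith)] with r hr
  by_cases hrt : t ≤ r
  · exact (h r ⟨hrt, hr.2⟩).trans (by gcongr; exact le_max_left _ _)
  · have := h' (-r) ⟨by linarith, by linarith [hr.1]⟩
    rw [nsq_comp_neg a b fun x => p (- -r) x - p (- -t) x, neg_neg, neg_neg,
      show (-r - -t) ^ 2 = (r - t) ^ 2 by ring] at this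
    exact this.trans (by gcongr; exact le_max_right _ _)

end BadTimes

/-- Solutions which are separately smooth have a jointly continuous space derivative. -/
theorem SepSol.continuousAt {κ d e : ℝ} {p p1 p2 p3 pt : ℝ → ℝ → ℂ}
    (S : SepSol κ d e p p1 p2 p3 pt) (t0 x0 : ℝ) :
    ContinuousAt (Function.uncurry p1) (t0, x0) := by
  obtain ⟨a, A, M, ha, haA, hA, hM, hLb, hLl, hLc⟩ := S.exists_strip (α := x0 - 2) (β := x0 - 1)
    (T1 := t0 - 1) (T2 := t0 + 1) (by linarith) (by linarith)
  obtain ⟨B, b, M', hB, hBb, hb, hM', hRb, hRl, hRc⟩ := S.exists_strip (α := x0 + 1) (β := x0 + 2)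
    (T1 := t0 - 1) (T2 := t0 + 1) (by linarith) (by linarith)
  set O : Set ℝ := {t | ∀ᶠ s in 𝓝 t, GoodTime a b p p1 s} with hO
  have hOo : IsOpen O := isOpen_setOfPred_eventually_nhds
  have hab : a < b := by linarith
  have hempty : ¬(Ioo (t0 - 1) (t0 + 1) ∩ Oᶜ).Nonempty := fun hne => by
    have hpc : ∀ x, Continuous fun t => p t x := fun x =>
      continuous_iff_continuousAt.2 fun t => (S.dt x t).continuousAt
    obtain ⟨m, U, hUV, hU, ⟨s, hsU, hsT⟩, hUF⟩ := exists_open_inter_subset_of_closed_cover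
      hOo.isClosed_compl isOpen_Ioo hne
      (F := fun m : ℕ => {t | ∀ x ∈ Icc a b, ‖p t x‖ ≤ m} ∩ {t | ThirdDiffBound a b m (p t)})
      (fun m => by
        refine IsClosed.inter ?_ (isClosed_thirdDiffBound _ _ _ hpc)
        simp only [Set.ofPred_forall]
        exact isClosed_iInter fun x => isClosed_iInter fun _ =>
          isClosed_le (hpc x).norm continuous_const)
      (fun t _ => by
        obtain ⟨C, hC⟩ := isCompact_Icc.exists_bound_of_continuousOn
          (S.jet t).c3.continuousOn (s := Icc a b)
        obtain ⟨C', hC'⟩ := isCompact_Icc.exists_bound_of_continuousOn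
          (S.cont t).continuousOn (s := Icc a b)
        obtain ⟨m, hm⟩ := exists_nat_ge (max C C')
        exact ⟨m, fun x hx => (hC' x hx).trans ((le_max_right _ _).trans hm),
          (S.jet t).thirdDiffBound fun x hx => (hC x hx).trans ((le_max_left _ _).trans hm)⟩)
    obtain ⟨N, hN0, hN⟩ := exists_bound_of_thirdDiffBound hab (Nat.cast_nonneg m)
      (Nat.cast_nonneg (α := ℝ) m)
    obtain ⟨ε, hε, hball⟩ := Metric.isOpen_iff.1 hU s hsU
    rw [Real.ball_eq_Ioo] at hball
    have hsub : Icc (s - ε / 2) (s + ε / 2) ⊆ U := fun t ht =>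
      hball ⟨by linarith [ht.1], by linarith [ht.2]⟩
    have hsubI : Icc (s - ε / 2) (s + ε / 2) ⊆ Icc (t0 - 1) (t0 + 1) := fun t ht =>
      Ioo_subset_Icc_self (hUV (hsub ht))
    set n := 1 + M + M' + N with hn
    have H : BadTimes κ d e a A B b n (s - ε / 2) (s + ε / 2) Oᶜ p p1 p2 p3 pt :=
      { sol := S
        aA := haA
        AB := by linarith
        Bb := hBb
        one_le := by linarith
        strip := fun t ht x hx => by
          rcases hx with hx | hx
          · obtain ⟨h0, h1, h2, h3⟩ := hLb t (hsubI ht) x hx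
            refine ⟨?_, ?_, ?_, ?_⟩ <;> linarith
          · obtain ⟨h0, h1, h2, h3⟩ := hRb t (hsubI ht) x hx
            refine ⟨?_, ?_, ?_, ?_⟩ <;> linarith
        lip := fun x hx r hr t ht => by
          rcases hx with hx | hx
          · exact (hLl x hx r (hsubI hr) t (hsubI ht)).trans (by gcongr; linarith)
          · exact (hRl x hx r (hsubI hr) t (hsubI ht)).trans (by gcongr; linarith)
        cont := fun t ht x hx => by
          have ht' := hUV (hsub (Ioo_subset_Icc_self ht))
          rcases hx with hx | hx
          · exact hLc t ht' x hx
          · exact hRc t ht' x hx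
        closed := hOo.isClosed_compl
        good := fun t _ htT => by
          have htO : ∀ᶠ s in 𝓝 t, GoodTime a b p p1 s := not_not.1 htT
          exact htO.self_of_nhds
        bound := fun t ht x hx => by
          have hF := hUF ⟨hsub ht.2, ht.1⟩
          obtain ⟨h0, h1, h2, h3⟩ := hN (S.jet t) hF.1 hF.2 x hx
          refine ⟨?_, ?_, ?_, ?_⟩ <;> linarith }
    exact hsT (H.eventually_good hsT ⟨by linarith, by linarith⟩)
  have h0 : t0 ∈ O := by
    by_contra h
    exact hempty ⟨t0, ⟨by linarith, by linarith⟩, h⟩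
  have hg : ∀ᶠ s in 𝓝 t0, GoodTime a b p p1 s := h0
  exact hg.self_of_nhds.1 x0 ⟨by linarith, by linarith⟩

section Reduction

theorem hasDerivAt_along_line {p p1 : ℝ → ℝ → ℂ} {k t x : ℝ} {pt : ℂ}
    (hd : ∀ t x, HasDerivAt (p t) (p1 t x) x) (ht : HasDerivAt (fun s => p s (x + k * t)) pt t)
    (h1 : ContinuousAt (Function.uncurry p1) (t, x + k * t)) :
    HasDerivAt (fun s => p s (x + k * s)) (pt + k * p1 t (x + k * t)) t := by
  set X := x + k * t with hX
  suffices h : HasDerivAt (fun s => p s (x + k * s) - p s X) (k * p1 t X) t by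
    have := ht.fun_add h
    simpa using this
  rw [hasDerivAt_iff_isLittleO, Asymptotics.isLittleO_iff]
  intro ε hε
  set η := ε / (|k| + 1) with hη
  have hη0 : 0 < η := by positivity
  obtain ⟨δ, hδ, hball⟩ := Metric.continuousAt_iff.1 h1 η hη0
  have hk : Tendsto (fun s => x + k * s) (𝓝 t) (𝓝 X) := Continuous.tendsto (by fun_prop) t
  filter_upwards [Metric.ball_mem_nhds t hδ, hk.eventually (Metric.ball_mem_nhds X hδ)] with s hs hs'
  have h2 : ∀ y ∈ uIcc X (x + k * s), ‖p1 s y - p1 t X‖ ≤ η := fun y hy => by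
    have hy' : dist y X < δ := by
      refine lt_of_le_of_lt ?_ hs'
      rw [Real.dist_eq, Real.dist_eq]
      exact abs_sub_left_of_mem_uIcc hy
    have := hball (x := (s, y)) (by rw [Prod.dist_eq]; exact max_lt hs hy')
    rw [dist_eq_norm] at this
    exact this.le
  have h3 := Convex.norm_image_sub_le_of_norm_hasDerivWithin_le (s := uIcc X (x + k * s)) (C := η)
    (f := fun y => p s y - y * p1 t X) (fun y _ => ((hd s y).fun_sub
      ((hasDerivAt_id y).ofReal_comp.mul_const (p1 t X))).hasDerivWithinAt)
    (fun y hy => by simpa using h2 y hy) (convex_uIcc _ _) left_mem_uIcc right_mem_uIcc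
  have e1 : p s (x + k * s) - ((x + k * s : ℝ) : ℂ) * p1 t X - (p s X - (X : ℂ) * p1 t X) =
      p s (x + k * s) - p s X - (p t (x + k * t) - p t X) - (s - t) • ((k : ℂ) * p1 t X) := by
    rw [Complex.real_smul, ← hX, sub_self, hX]
    push_cast
    ring
  simp only [e1] at h3
  refine h3.trans ?_
  rw [show x + k * s - X = k * (s - t) by rw [hX]; ring, norm_mul, Real.norm_eq_abs k, ← mul_assoc]
  gcongr
  rw [hη, div_mul_eq_mul_div, div_le_iff₀ (by positivity)]
  gcongr
  linarith

theorem Jet.deriv_eq {f f1 f2 f3 : ℝ → ℂ} (j : Jet f f1 f2 f3) : deriv f = f1 :=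
  funext fun x => (j.d0 x).deriv

theorem Jet.iteratedDeriv_two_eq {f f1 f2 f3 : ℝ → ℂ} (j : Jet f f1 f2 f3) :
    iteratedDeriv 2 f = f2 := by
  rw [iteratedDeriv_succ, iteratedDeriv_one, j.deriv_eq]
  exact funext fun x => (j.d1 x).deriv

theorem Jet.iteratedDeriv_three_eq {f f1 f2 f3 : ℝ → ℂ} (j : Jet f f1 f2 f3) :
    iteratedDeriv 3 f = f3 := by
  rw [iteratedDeriv_succ, j.iteratedDeriv_two_eq]
  exact funext fun x => (j.d2 x).deriv

theorem Jet.deriv_conj_eq {f f1 f2 f3 : ℝ → ℂ} (j : Jet f f1 f2 f3) (x : ℝ) :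
    deriv (fun y => (starRingEnd ℂ) (f y)) x = (starRingEnd ℂ) (f1 x) :=
  (j.d0 x).star.deriv

theorem ContDiff.jet {f : ℝ → ℂ} (hf : ContDiff ℝ 3 f) :
    Jet f (deriv f) (iteratedDeriv 2 f) (iteratedDeriv 3 f) where
  d0 x := (hf.differentiable (by norm_num) x).hasDerivAt
  d1 x := by
    have h := hf.differentiable_iteratedDeriv 1 (by norm_num) x
    rw [iteratedDeriv_succ (n := 1)]
    rw [iteratedDeriv_one] at h ⊢
    exact h.hasDerivAt
  d2 x := by
    have h := hf.differentiable_iteratedDeriv 2 (by norm_num) x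
    rw [iteratedDeriv_succ (n := 2)]
    exact h.hasDerivAt
  c3 := hf.continuous_iteratedDeriv 3 (by norm_num)

theorem Jet.comp_add_const {f f1 f2 f3 : ℝ → ℂ} (j : Jet f f1 f2 f3) (c : ℝ) :
    Jet (fun x => f (x + c)) (fun x => f1 (x + c)) (fun x => f2 (x + c)) fun x => f3 (x + c) where
  d0 x := (j.d0 (x + c)).comp_add_const x c
  d1 x := (j.d1 (x + c)).comp_add_const x c
  d2 x := (j.d2 (x + c)).comp_add_const x c
  c3 := j.c3.comp (continuous_add_const c)

theorem hasDerivAt_exp_affine (θ : ℝ) (c : ℂ) (x : ℝ) :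
    HasDerivAt (fun x : ℝ => exp (I * θ * x + c)) (I * θ * exp (I * θ * x + c)) x := by
  have h : HasDerivAt (fun x : ℝ => I * (θ : ℂ) * (x : ℂ) + c) (I * θ) x := by
    simpa using ((hasDerivAt_id x).ofReal_comp.const_mul (I * (θ : ℂ))).add_const c
  exact h.cexp.congr_deriv (mul_comm _ _)

theorem Jet.exp_mul {f f1 f2 f3 : ℝ → ℂ} (j : Jet f f1 f2 f3) (θ : ℝ) (c : ℂ) :
    Jet (fun x => exp (I * θ * x + c) * f x) (fun x => exp (I * θ * x + c) * (f1 x + I * θ * f x))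
      (fun x => exp (I * θ * x + c) * (f2 x + 2 * (I * θ) * f1 x + (I * θ) ^ 2 * f x))
      fun x => exp (I * θ * x + c) *
        (f3 x + 3 * (I * θ) * f2 x + 3 * (I * θ) ^ 2 * f1 x + (I * θ) ^ 3 * f x) where
  d0 x := ((hasDerivAt_exp_affine θ c x).fun_mul (j.d0 x)).congr_deriv (by ring)
  d1 x := ((hasDerivAt_exp_affine θ c x).fun_mul
    ((j.d1 x).fun_add ((j.d0 x).const_mul (I * (θ : ℂ))))).congr_deriv (by ring)
  d2 x := ((hasDerivAt_exp_affine θ c x).fun_mul (((j.d2 x).fun_add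
    ((j.d1 x).const_mul (2 * (I * (θ : ℂ))))).fun_add
      ((j.d0 x).const_mul ((I * (θ : ℂ)) ^ 2)))).congr_deriv (by ring)
  c3 := by
    have := j.c3
    have := j.cont0
    have := j.cont1
    have := j.cont2
    fun_prop

theorem continuousAt_deriv_of_equation {k b d e : ℝ} (hb : b ≠ 0) {q q1 q2 q3 qt : ℝ → ℝ → ℂ}
    (jet : ∀ t, Jet (q t) (q1 t) (q2 t) (q3 t))
    (dt : ∀ x t, HasDerivAt (fun s => q s x) (qt t x) t) (ct : ∀ x, Continuous fun t => qt t x)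
    (pde : ∀ t x, ContinuousAt (Function.uncurry q1) (t, x) →
      qt t x + k * q1 t x + b * q3 t x + d * (‖q t x‖ : ℂ) ^ 2 * q1 t x
        + e * q t x ^ 2 * (starRingEnd ℂ) (q1 t x) = 0) (t x : ℝ) :
    ContinuousAt (Function.uncurry q1) (t, x) := by
  have hbC : (b : ℂ) ≠ 0 := ofReal_ne_zero.2 hb
  have scale : ∀ {t x : ℝ}, ContinuousAt (Function.uncurry fun s => q1 (b⁻¹ * s)) (b * t, x) →
      ContinuousAt (Function.uncurry q1) (t, x) := fun {t x} h => by
    have h1 : Continuous fun z : ℝ × ℝ => (b * z.1, z.2) := by fun_prop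
    have := ContinuousAt.comp (x := (t, x)) (f := fun z : ℝ × ℝ => (b * z.1, z.2)) h
      h1.continuousAt
    refine this.congr (Eventually.of_forall fun z => ?_)
    simp [Function.uncurry, hb]
  have S : SepSol (k / b) (d / b) (e / b) (fun t => q (b⁻¹ * t)) (fun t => q1 (b⁻¹ * t))
      (fun t => q2 (b⁻¹ * t)) (fun t => q3 (b⁻¹ * t)) (fun t x => b⁻¹ * qt (b⁻¹ * t) x) :=
    { jet := fun t => jet _
      dt := fun x t => by
        have h := (dt x (b⁻¹ * t)).scomp t ((hasDerivAt_id t).const_mul b⁻¹)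
        exact h.congr_deriv (by simp)
      ct := fun x => by
        have := (ct x).comp (continuous_const_mul b⁻¹)
        exact continuous_const.mul this
      pde := fun t x h => by
        have h1 := pde (b⁻¹ * t) x (scale (by rwa [mul_inv_cancel_left₀ hb]))
        simp only [nl]
        push_cast
        generalize b⁻¹ * t = τ at h1 ⊢
        field_simp
        linear_combination h1 }
  exact scale (S.continuousAt _ _)

end Reduction

end Regularity

/-- The algebraic identity behind the reduction: multiplying by the phase removes the even order
terms. -/
theorem phase_identity {a b c d e θ ν k : ℝ} (hc : c = (d - e) * θ) (ha : a = 3 * b * θ)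
    (hk : k = 3 * b * θ ^ 2) (hν : ν = -(2 * b * θ ^ 3)) {E u u1 u2 u3 ut : ℂ} (hE : ‖E‖ = 1) :
    E * (ut + I * ν * u) + k * (E * (u1 + I * θ * u)) + b * (E *
        (u3 + 3 * (I * θ) * u2 + 3 * (I * θ) ^ 2 * u1 + (I * θ) ^ 3 * u))
      + d * (‖E * u‖ : ℂ) ^ 2 * (E * (u1 + I * θ * u))
      + e * (E * u) ^ 2 * (starRingEnd ℂ) (E * (u1 + I * θ * u)) =
    E * (ut + I * a * u2 + b * u3 + I * c * (‖u‖ : ℂ) ^ 2 * u + d * (‖u‖ : ℂ) ^ 2 * u1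
      + e * u ^ 2 * (starRingEnd ℂ) u1) := by
  have h1 : E * (starRingEnd ℂ) E = 1 := by rw [mul_conj']; simp [hE]
  have h2 : u * (starRingEnd ℂ) u = (‖u‖ : ℂ) ^ 2 := mul_conj' u
  have h3 : I ^ 2 = -1 := I_sq
  rw [norm_mul, hE, one_mul]
  simp only [map_mul, map_add, conj_I, conj_ofReal]
  rw [← h2, hc, ha, hk, hν]
  push_cast
  linear_combination (e * E * u ^ 2 * ((starRingEnd ℂ) u1 - I * θ * (starRingEnd ℂ) u)) * h1
    + (3 * b * E * θ ^ 2 * u1 + b * E * I * θ ^ 3 * u) * h3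

/-- reduction to complex modified KdV. If `c = (d−e)a/(3b)` and
`v(x,t) = exp(i(a/(3b))x + i(a³/(27b²))t) u(x + (a²/(3b))t, t)`, then `u` solves the
Airy–Schrödinger equation iff `v` solves the complex mKdV-type equation
`∂ₜv + b ∂ₓ³v + d |v|²∂ₓv + e v²∂ₓv̄ = 0`. -/
theorem reduction_to_complex_mKdV (a b c d e : ℝ) (hb : b ≠ 0)
    (hc : c = (d - e) * a / (3 * b)) (u : ℝ → ℝ → ℂ)
    (hux : ∀ t, ContDiff ℝ 3 (fun x => u x t))
    (hut : ∀ x, ContDiff ℝ 1 (fun t => u x t)) :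
    let v : ℝ → ℝ → ℂ := fun x t =>
      Complex.exp (Complex.I * ((a / (3 * b) : ℝ) : ℂ) * (x : ℂ) +
        Complex.I * ((a ^ 3 / (27 * b ^ 2) : ℝ) : ℂ) * (t : ℂ)) *
        u (x + (a ^ 2 / (3 * b)) * t) t
    (AirySchrodingerEq a b c d e u ↔
      ∀ x t : ℝ,
        deriv (fun τ => v x τ) t
          + (b : ℂ) * iteratedDeriv 3 (fun y => v y t) x
          + (d : ℂ) * (‖v x t‖ : ℂ) ^ 2 * deriv (fun y => v y t) x
          + (e : ℂ) * (v x t) ^ 2 * deriv (fun y => (starRingEnd ℂ) (v y t)) x = 0) := by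
  intro v
  set θ : ℝ := a / (3 * b) with hθ
  set k : ℝ := a ^ 2 / (3 * b) with hk
  set ν : ℝ := -(2 * b * θ ^ 3) with hν
  have ha' : a = 3 * b * θ := by rw [hθ]; field_simp
  have hk' : k = 3 * b * θ ^ 2 := by rw [hk, hθ]; field_simp
  have hc' : c = (d - e) * θ := by rw [hc, hθ]; field_simp
  have hμ : a ^ 3 / (27 * b ^ 2) = θ * k + ν := by rw [hν, hk', hθ]; field_simp; ring
  set E : ℝ → ℝ → ℂ := fun t x => exp (I * θ * x + I * ν * t) with hE
  set ut : ℝ → ℝ → ℂ := fun t x => deriv (fun τ => u x τ) t with hut'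
  have juu := fun t => (hux t).jet
  set q : ℝ → ℝ → ℂ := fun t x => E t x * u x t with hq
  have jet := fun t => (juu t).exp_mul θ (I * ν * t)
  set q1 : ℝ → ℝ → ℂ := fun t x => E t x * (deriv (fun y => u y t) x + I * θ * u x t) with hq1
  set q3 : ℝ → ℝ → ℂ := fun t x => E t x * (iteratedDeriv 3 (fun y => u y t) x
    + 3 * (I * θ) * iteratedDeriv 2 (fun y => u y t) x
    + 3 * (I * θ) ^ 2 * deriv (fun y => u y t) x + (I * θ) ^ 3 * u x t) with hq3
  set qt : ℝ → ℝ → ℂ := fun t x => E t x * (ut t x + I * ν * u x t) with hqt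
  have hdu : ∀ x t, HasDerivAt (fun τ => u x τ) (ut t x) t := fun x t =>
    ((hut x).differentiable (by norm_num) t).hasDerivAt
  have dt : ∀ x t, HasDerivAt (fun s => q s x) (qt t x) t := fun x t => by
    have h1 := hasDerivAt_exp_affine ν (I * θ * x) t
    simp only [add_comm _ (I * (θ : ℂ) * (x : ℂ))] at h1
    exact (h1.fun_mul (hdu x t)).congr_deriv (by simp only [hqt, hE]; ring)
  have ct : ∀ x, Continuous fun t => qt t x := fun x => by
    have h1 : Continuous fun t => ut t x := (hut x).continuous_deriv le_rfl
    have h2 := (hut x).continuous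
    simp only [hqt, hE]
    fun_prop
  have hEn : ∀ t x, ‖E t x‖ = 1 := fun t x => by
    simp only [hE]
    rw [show I * (θ : ℂ) * x + I * ν * t = ((θ * x + ν * t : ℝ) : ℂ) * I by push_cast; ring]
    exact norm_exp_ofReal_mul_I _
  have hu_iff : AirySchrodingerEq a b c d e u ↔ ∀ t x, qt t x + k * q1 t x + b * q3 t x
      + d * (‖q t x‖ : ℂ) ^ 2 * q1 t x + e * q t x ^ 2 * (starRingEnd ℂ) (q1 t x) = 0 := by
    rw [AirySchrodingerEq, forall_comm]
    refine forall_congr' fun t => forall_congr' fun x => ?_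
    have hE0 : E t x ≠ 0 := exp_ne_zero _
    rw [(juu t).deriv_conj_eq x]
    simp only [hq, hq1, hq3, hqt]
    rw [phase_identity hc' ha' hk' hν (hEn t x), mul_eq_zero, or_iff_right hE0]
  have hv : ∀ x t, v x t = q t (x + k * t) := fun x t => by
    simp only [v, hq, hE, hμ, ← hθ, ← hk]
    push_cast
    ring_nf
  have hv_iff : ∀ x t, ContinuousAt (Function.uncurry q1) (t, x + k * t) →
      (deriv (fun τ => v x τ) t + (b : ℂ) * iteratedDeriv 3 (fun y => v y t) x
        + (d : ℂ) * (‖v x t‖ : ℂ) ^ 2 * deriv (fun y => v y t) x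
        + (e : ℂ) * (v x t) ^ 2 * deriv (fun y => (starRingEnd ℂ) (v y t)) x = 0 ↔
      qt t (x + k * t) + k * q1 t (x + k * t) + b * q3 t (x + k * t)
        + d * (‖q t (x + k * t)‖ : ℂ) ^ 2 * q1 t (x + k * t)
        + e * q t (x + k * t) ^ 2 * (starRingEnd ℂ) (q1 t (x + k * t)) = 0) := fun x t h => by
    have hj := (jet t).comp_add_const (k * t)
    have h1 := (hasDerivAt_along_line (fun t => (jet t).d0) (dt _ t) h).deriv
    simp only [hv]
    rw [h1, hj.iteratedDeriv_three_eq, hj.deriv_conj_eq, hj.deriv_eq]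
  rw [hu_iff]
  constructor
  · intro h x t
    exact (hv_iff x t (continuousAt_deriv_of_equation hb jet dt ct (fun t x _ => h t x) _ _)).2
      (h t _)
  · intro h
    have hpde : ∀ t x, ContinuousAt (Function.uncurry q1) (t, x) → qt t x + k * q1 t x + b * q3 t x
        + d * (‖q t x‖ : ℂ) ^ 2 * q1 t x + e * q t x ^ 2 * (starRingEnd ℂ) (q1 t x) = 0 :=
      fun t x hc => by
        have := hv_iff (x - k * t) t
        rw [sub_add_cancel] at this
        exact (this hc).1 (h _ _)
    exact fun t x => hpde t x (continuousAt_deriv_of_equation hb jet dt ct hpde t x)
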